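/- Let X be an infinite, connected, locally finite, vertex-transitive simple graph with vertex set V and graph metric d. Suppose there exist K > 0 and a sequence (Aₙ) of finite connected subsets of V such that |∂Aₙ| → ∞ as n → ∞ and depth(Aₙ) > |∂Aₙ|/K − K for every n. Then X has quadratic growth. -/

import Mathlib

open SimpleGraph

/-- Closed `r`-neighbourhood of a set `A` in the graph metric of `X`. -/
def gnbhd {V : Type*} (X : SimpleGraph V) (A : Set V) (r : ℝ) : Set V :=
  {v : V | ∃ a ∈ A, (X.dist v a : ℝ) ≤ r}

/-- The induced subgraph on `Z` is connected. -/
def ConnSet {V : Type*} (X : SimpleGraph V) (Z : Set V) : Prop :=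
  (X.induce Z).Connected

/-- `U` is a connected component of the subset `S` of the vertex set: `U` is a
nonempty connected subset of `S` which is maximal among connected subsets of `S`. -/
def IsCompOf {V : Type*} (X : SimpleGraph V) (U S : Set V) : Prop :=
  U ⊆ S ∧ U.Nonempty ∧ ConnSet X U ∧
    ∀ U' : Set V, U ⊆ U' → U' ⊆ S → ConnSet X U' → U' = U

/-- A subset `Z` is narrow if it is quasi-isometric to a subset of `ℝ`
with respect to the ambient graph metric. -/
def Narrow {V : Type*} (X : SimpleGraph V) (Z : Set V) : Prop :=
  ∃ (lam c : ℝ) (f : Z → ℝ), 1 ≤ lam ∧ 0 ≤ c ∧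
    ∀ x y : Z, |f x - f y| ≤ lam * (X.dist x.1 y.1 : ℝ) + c ∧
      (X.dist x.1 y.1 : ℝ) ≤ lam * |f x - f y| + c

/-- A subset is wide if it is not narrow. -/
def Wide {V : Type*} (X : SimpleGraph V) (Z : Set V) : Prop := ¬ Narrow X Z

/-- `ρ : ℤ → V` is a bi-infinite `(lam, c)`-quasi-geodesic path. -/
def IsBiQG {V : Type*} (X : SimpleGraph V) (lam c : ℝ) (ρ : ℤ → V) : Prop :=
  (∀ n : ℤ, X.Adj (ρ n) (ρ (n + 1))) ∧
    ∀ s t : ℤ, |(s : ℝ) - (t : ℝ)| / lam - c ≤ (X.dist (ρ s) (ρ t) : ℝ)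

/-- A bi-infinite quasi-geodesic: a bi-infinite path which is a
`(lam, c)`-quasi-geodesic for some `lam ≥ 1`, `c ≥ 0`. -/
def IsBiQuasiGeodesic {V : Type*} (X : SimpleGraph V) (ρ : ℤ → V) : Prop :=
  ∃ lam c : ℝ, 1 ≤ lam ∧ 0 ≤ c ∧ IsBiQG X lam c ρ

/-- The subset `S` has exactly two wide connected components. -/
def TwoWideComps {V : Type*} (X : SimpleGraph V) (S : Set V) : Prop :=
  ∃ U₁ U₂ : Set V, U₁ ≠ U₂ ∧
    IsCompOf X U₁ S ∧ IsCompOf X U₂ S ∧ Wide X U₁ ∧ Wide X U₂ ∧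
    ∀ U : Set V, IsCompOf X U S → Wide X U → U = U₁ ∨ U = U₂

/-- The uniformly bisecting quasi-geodesics property with separation constant `σ`. -/
def UBQ {V : Type*} (X : SimpleGraph V) (σ : ℝ) : Prop :=
  ∀ ρ : ℤ → V, IsBiQuasiGeodesic X ρ →
    TwoWideComps X ((gnbhd X (Set.range ρ) σ)ᶜ)

/-- One-way infinite path. -/
def IsRay {V : Type*} (X : SimpleGraph V) (w : ℕ → V) : Prop :=
  ∀ n : ℕ, X.Adj (w n) (w (n + 1))

/-- `d(w t, A) → ∞` as `t → ∞`. -/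
def DivergesFrom {V : Type*} (X : SimpleGraph V) (w : ℕ → V) (A : Set V) : Prop :=
  ∀ M : ℝ, ∃ N : ℕ, ∀ t : ℕ, N ≤ t → ∀ a ∈ A, M < (X.dist (w t) a : ℝ)

/-- `(w₁, w₂)` is a pair of witnesses for the bi-infinite quasi-geodesic `ρ`:
they are one-way infinite simple paths lying in distinct wide components of the
complement of `N_σ(ρ(ℤ))`, both diverging from `ρ`. -/
def WitnessPair {V : Type*} (X : SimpleGraph V) (σ : ℝ) (ρ : ℤ → V)
    (w₁ w₂ : ℕ → V) : Prop :=
  IsRay X w₁ ∧ Function.Injective w₁ ∧ IsRay X w₂ ∧ Function.Injective w₂ ∧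
  (∃ U₁ U₂ : Set V, U₁ ≠ U₂ ∧
    IsCompOf X U₁ ((gnbhd X (Set.range ρ) σ)ᶜ) ∧ Wide X U₁ ∧
    IsCompOf X U₂ ((gnbhd X (Set.range ρ) σ)ᶜ) ∧ Wide X U₂ ∧
    Set.range w₁ ⊆ U₁ ∧ Set.range w₂ ⊆ U₂) ∧
  DivergesFrom X w₁ (Set.range ρ) ∧ DivergesFrom X w₂ (Set.range ρ)

/-- Concatenation of the reversal of the ray `a` with the ray `b`, as a
bi-infinite path (`t ↦ a (-t)` for `t ≤ 0` and `t ↦ b t` for `t ≥ 0`). -/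
def biconcat {V : Type*} (a b : ℕ → V) : ℤ → V :=
  fun t => if t < 0 then a (-t).toNat else b t.toNat

/-- One-way infinite `(lam, c)`-quasi-geodesic ray. -/
def IsQGRay {V : Type*} (X : SimpleGraph V) (lam c : ℝ) (γ : ℕ → V) : Prop :=
  IsRay X γ ∧
    ∀ s t : ℕ, |(s : ℝ) - (t : ℝ)| / lam - c ≤ (X.dist (γ s) (γ t) : ℝ)

/-- An `(R, r, lam, c)`-cross-examiner, with the three rays `γ i`, the three
witnesses `w i` and the three finite paths `q i` (of length `qn i`) indexed by
`ZMod 3` (where the paper's index `3` corresponds to `0 : ZMod 3`). -/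
def IsCrossExaminer {V : Type*} (X : SimpleGraph V) (σ R r lam c : ℝ) (v₀ : V)
    (γ w : ZMod 3 → ℕ → V) (q : ZMod 3 → ℕ → V) (qn : ZMod 3 → ℕ) : Prop :=
  1 ≤ lam ∧ 0 ≤ c ∧ 10 * σ < r ∧ r < R ∧
  (∀ i : ZMod 3, IsQGRay X lam c (γ i) ∧ γ i 0 = v₀ ∧ IsRay X (w i) ∧
    (∀ j : ℕ, j < qn i → X.Adj (q i j) (q i (j + 1)))) ∧
  ∀ i : ZMod 3,
    -- (CE1)
    IsBiQG X lam c (biconcat (γ (i + 1)) (γ (i + 2))) ∧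
    -- (CE2)
    (∃ U : Set V,
      IsCompOf X U (Set.range (biconcat (γ (i + 1)) (γ (i + 2))) \
        gnbhd X (q 0 '' Set.Iic (qn 0) ∪ q 1 '' Set.Iic (qn 1) ∪ q 2 '' Set.Iic (qn 2))
          (10 * σ)) ∧ w i 0 ∈ U ∧ v₀ ∈ U) ∧
    -- (CE3)
    WitnessPair X σ (biconcat (γ (i + 1)) (γ (i + 2))) (w i) (γ i) ∧
    -- (CE4)
    (∀ t : ℕ, r < (t : ℝ) → ∀ s : ℤ,
      10 * σ < (X.dist (w i t) (biconcat (γ (i + 1)) (γ (i + 2)) s) : ℝ)) ∧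
    -- (CE5)
    (q i 0 ∈ Set.range (γ (i + 1)) ∧ q i (qn i) ∈ Set.range (γ (i + 2)) ∧
      (q i '' Set.Iic (qn i)) ∩
        gnbhd X (Set.range (w (i + 1)) ∪ Set.range (w (i + 2)) ∪ Set.range (γ i))
          (10 * σ) = ∅) ∧
    -- (CE6)
    q i '' Set.Iic (qn i) ⊆ gnbhd X {v₀} (R - 10 * σ) \ gnbhd X {v₀} (r + 10 * σ)

/-- `X` has quadratic growth. -/
def QuadGrowth {V : Type*} (X : SimpleGraph V) : Prop :=
  ∃ C : ℝ, 0 < C ∧ ∀ v : V, ∀ n : ℕ, 1 ≤ n →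
    ({u : V | X.dist u v ≤ n}.ncard : ℝ) ≤ C * (n : ℝ) ^ 2

/-- The set of vertices at distance exactly `1` from `A`. -/
def vertexBoundary {V : Type*} (X : SimpleGraph V) (A : Set V) : Set V :=
  {v : V | v ∉ A ∧ ∃ a ∈ A, X.Adj v a}

/-- The depth of `A`: `inf {r ≥ 0 : A ⊆ N_r(∂A)}`. -/
noncomputable def gdepth {V : Type*} (X : SimpleGraph V) (A : Set V) : ℝ :=
  sInf {r : ℝ | 0 ≤ r ∧ A ⊆ gnbhd X (vertexBoundary X A) r}

/-- A `(lam, c)`-quasi-circle of length `n ≥ 1`: a closed path all of whose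
subpaths of length at most `n / 2` are `(lam, c)`-quasi-geodesics. -/
def IsQuasiCircle {V : Type*} (X : SimpleGraph V) (lam c : ℝ) (n : ℕ)
    (C : ZMod n → V) : Prop :=
  1 ≤ n ∧ (∀ k : ZMod n, X.Adj (C k) (C (k + 1))) ∧
    ∀ (k : ZMod n) (m s t : ℕ), 2 * m ≤ n → s ≤ m → t ≤ m →
      |(s : ℝ) - (t : ℝ)| / lam - c ≤
        (X.dist (C (k + (s : ZMod n))) (C (k + (t : ZMod n))) : ℝ)

/-- A truncated `(lam, c)`-quasi-circle with major face `F` (of length `nF`) and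
minor face `f` (of length `nf`): `F` is the initial part of a `(lam, c)`-quasi-circle
and `f` is a `(lam, c)`-quasi-geodesic with the same endpoints as the remaining part. -/
def IsTruncQuasiCircle {V : Type*} (X : SimpleGraph V) (lam c : ℝ)
    (F : ℕ → V) (nF : ℕ) (f : ℕ → V) (nf : ℕ) : Prop :=
  (∀ i : ℕ, i < nF → X.Adj (F i) (F (i + 1))) ∧
  (∀ i : ℕ, i < nf → X.Adj (f i) (f (i + 1))) ∧
  f 0 = F nF ∧ f nf = F 0 ∧
  (∀ s t : ℕ, s ≤ nf → t ≤ nf →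
    |(s : ℝ) - (t : ℝ)| / lam - c ≤ (X.dist (f s) (f t) : ℝ)) ∧
  ∃ (n : ℕ) (C : ZMod n → V), IsQuasiCircle X lam c n C ∧ nF ≤ n ∧
    ∀ i : ℕ, i ≤ nF → C (i : ZMod n) = F i

/-- The graph `X`, with its graph metric, is quasi-isometric to the metric space `Y`. -/
def QIto {V : Type*} (X : SimpleGraph V) (Y : Type*) [PseudoMetricSpace Y] : Prop :=
  ∃ (lam c : ℝ) (f : V → Y), 1 ≤ lam ∧ 0 ≤ c ∧
    (∀ x x' : V, (X.dist x x' : ℝ) / lam - c ≤ dist (f x) (f x') ∧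
      dist (f x) (f x') ≤ lam * (X.dist x x' : ℝ) + c) ∧
    ∀ y : Y, ∃ x : V, dist y (f x) ≤ c

/-- The Gromov product `(x · y)_w` in the graph metric. -/
noncomputable def gromovProd {V : Type*} (X : SimpleGraph V) (w x y : V) : ℝ :=
  ((X.dist x w : ℝ) + (X.dist y w : ℝ) - (X.dist x y : ℝ)) / 2

/-- `X` is Gromov hyperbolic. -/
def GromovHyperbolic {V : Type*} (X : SimpleGraph V) : Prop :=
  ∃ δ : ℝ, 0 ≤ δ ∧ ∀ w x y z : V,
    min (gromovProd X w x z) (gromovProd X w y z) - δ ≤ gromovProd X w x y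

namespace TransGraph
open scoped Classical
open Finset

variable {V : Type*} {X : SimpleGraph V}

/-- An infinite connected locally finite vertex-transitive graph. -/
structure Homog (X : SimpleGraph V) : Prop where
  conn : X.Connected
  lf : ∀ v, (X.neighborSet v).Finite
  trans : ∀ u v, ∃ φ : X ≃g X, φ u = v
  inf : Infinite V

/-- The closed ball as a finset (empty if it happens to be infinite). -/
noncomputable def ball (X : SimpleGraph V) (x : V) (r : ℕ) : Finset V :=
  if h : {y | X.dist x y ≤ r}.Finite then h.toFinset else ∅

/-- The neighbours of `x` as a finset (empty if there are infinitely many). -/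
noncomputable def nbr (X : SimpleGraph V) (x : V) : Finset V :=
  if h : (X.neighborSet x).Finite then h.toFinset else ∅

/-- The common cardinality of balls of radius `r`. -/
noncomputable def vol (X : SimpleGraph V) (r : ℕ) : ℕ :=
  sInf (Set.range fun x => #(ball X x r))

/-- The common degree of the vertices. -/
noncomputable def deg (X : SimpleGraph V) : ℕ :=
  sInf (Set.range fun x => #(nbr X x))

lemma dist_map (φ : X ≃g X) (x y : V) : X.dist (φ x) (φ y) = X.dist x y := by
  have key : ∀ (ψ : X ≃g X) (x y : V), X.Reachable x y → X.dist (ψ x) (ψ y) ≤ X.dist x y := by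
    intro ψ x y h
    obtain ⟨w, hw⟩ := h.exists_walk_length_eq_dist
    have := X.dist_le (w.map ψ.toHom)
    rw [SimpleGraph.Walk.length_map, hw] at this
    exact this
  by_cases h : X.Reachable x y
  · refine le_antisymm (key φ x y h) ?_
    have h' : X.Reachable (φ x) (φ y) := h.map φ.toHom
    simpa using key φ.symm _ _ h'
  · have h' : ¬ X.Reachable (φ x) (φ y) := fun h' => h (by simpa using h'.map φ.symm.toHom)
    rw [SimpleGraph.dist_eq_zero_of_not_reachable h, SimpleGraph.dist_eq_zero_of_not_reachable h']

namespace Homog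
variable (hX : Homog X)
include hX

lemma tri (x y z : V) : X.dist x z ≤ X.dist x y + X.dist y z := hX.conn.dist_triangle

lemma mem_nbr {x y : V} : y ∈ nbr X x ↔ X.Adj x y := by
  rw [nbr, dif_pos (hX.lf x)]; simp

lemma dist_eq_zero {x y : V} : X.dist x y = 0 ↔ x = y := hX.conn.dist_eq_zero_iff

/-- A vertex on a geodesic from `x` to `y` at prescribed distance from `x`. -/
lemma exists_between {x y : V} {k l : ℕ} (h : X.dist x y = k + l) :
    ∃ z, X.dist x z = k ∧ X.dist z y = l := by
  obtain ⟨w, hw⟩ := hX.conn.exists_walk_length_eq_dist x y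
  refine ⟨w.getVert k, ?_⟩
  have h1 := X.dist_le (w.take k)
  have h2 := X.dist_le (w.drop k)
  rw [SimpleGraph.Walk.take_length] at h1
  rw [SimpleGraph.Walk.drop_length] at h2
  have := hX.tri x (w.getVert k) y
  omega

lemma exists_step {x y : V} {k : ℕ} (h : X.dist x y = k + 1) :
    ∃ z, X.dist x z = k ∧ X.Adj z y := by
  obtain ⟨z, h1, h2⟩ := hX.exists_between h
  exact ⟨z, h1, SimpleGraph.dist_eq_one_iff_adj.mp h2⟩

lemma finite_ball (x : V) (r : ℕ) : {y | X.dist x y ≤ r}.Finite := by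
  induction r with
  | zero =>
    refine (Set.finite_singleton x).subset fun y hy => ?_
    simp only [Set.mem_ofPred_eq, Nat.le_zero] at hy
    exact ((hX.dist_eq_zero).mp hy).symm
  | succ k ih =>
    have : {y | X.dist x y ≤ k + 1} ⊆ {y | X.dist x y ≤ k} ∪
        ⋃ z ∈ {y | X.dist x y ≤ k}, X.neighborSet z := by
      intro y hy
      simp only [Set.mem_ofPred_eq] at hy
      rcases Nat.lt_or_ge k (X.dist x y) with h | h
      · obtain ⟨z, hz, ha⟩ := hX.exists_step (show X.dist x y = k + 1 by omega)
        refine Or.inr ?_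
        simp only [Set.mem_iUnion]
        exact ⟨z, hz.le, ha⟩
      · exact Or.inl h
    exact (ih.union (ih.biUnion fun z _ => hX.lf z)).subset this

lemma mem_ball {x y : V} {r : ℕ} : y ∈ ball X x r ↔ X.dist x y ≤ r := by
  rw [ball, dif_pos (hX.finite_ball x r)]; simp

lemma mem_ball_comm {x y : V} {r : ℕ} : y ∈ ball X x r ↔ x ∈ ball X y r := by
  rw [hX.mem_ball, hX.mem_ball, SimpleGraph.dist_comm]

lemma ball_map (φ : X ≃g X) (x : V) (r : ℕ) :
    ball X (φ x) r = (ball X x r).map φ.toEquiv.toEmbedding := by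
  ext y
  simp only [hX.mem_ball, Finset.mem_map_equiv]
  rw [← dist_map φ x, show φ (φ.toEquiv.symm y) = y from φ.apply_symm_apply y]

lemma nbr_map (φ : X ≃g X) (x : V) :
    nbr X (φ x) = (nbr X x).map φ.toEquiv.toEmbedding := by
  ext y
  simp only [hX.mem_nbr, Finset.mem_map_equiv]
  conv_lhs => rw [← φ.apply_symm_apply y]
  rw [φ.map_adj_iff]
  rfl

lemma card_ball (x : V) (r : ℕ) : #(ball X x r) = vol X r := by
  have : ∀ y, #(ball X y r) = #(ball X x r) := by
    intro y
    obtain ⟨φ, rfl⟩ := hX.trans x y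
    rw [hX.ball_map, Finset.card_map]
  rw [vol, show (Set.range fun y => #(ball X y r)) = {#(ball X x r)} by
    ext n; simp only [Set.mem_range, this]; exact ⟨fun ⟨_, h⟩ => h.symm, fun h => ⟨x, h.symm⟩⟩]
  exact (csInf_singleton _).symm

lemma card_nbr (x : V) : #(nbr X x) = deg X := by
  have : ∀ y, #(nbr X y) = #(nbr X x) := by
    intro y
    obtain ⟨φ, rfl⟩ := hX.trans x y
    rw [hX.nbr_map, Finset.card_map]
  rw [deg, show (Set.range fun y => #(nbr X y)) = {#(nbr X x)} by
    ext n; simp only [Set.mem_range, this]; exact ⟨fun ⟨_, h⟩ => h.symm, fun h => ⟨x, h.symm⟩⟩]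
  exact (csInf_singleton _).symm

lemma ball_subset_ball (x : V) {r s : ℕ} (h : r ≤ s) : ball X x r ⊆ ball X x s := by
  intro y
  simp only [hX.mem_ball]
  omega

lemma self_mem_ball (x : V) (r : ℕ) : x ∈ ball X x r := by simp [hX.mem_ball]

lemma nonempty : Nonempty V := hX.conn.nonempty

lemma vol_mono {r s : ℕ} (h : r ≤ s) : vol X r ≤ vol X s := by
  obtain ⟨x⟩ := hX.nonempty
  rw [← hX.card_ball x, ← hX.card_ball x]
  exact Finset.card_le_card (hX.ball_subset_ball x h)

lemma vol_pos (r : ℕ) : 0 < vol X r := by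
  obtain ⟨x⟩ := hX.nonempty
  rw [← hX.card_ball x]
  exact Finset.card_pos.mpr ⟨x, hX.self_mem_ball x r⟩

lemma vol_add (r s : ℕ) : vol X (r + s) ≤ vol X r * vol X s := by
  obtain ⟨x⟩ := hX.nonempty
  rw [← hX.card_ball x (r + s), ← hX.card_ball x r]
  have : ball X x (r + s) ⊆ (ball X x r).biUnion fun y => ball X y s := by
    intro y hy
    simp only [Finset.mem_biUnion, hX.mem_ball] at hy ⊢
    rcases Nat.lt_or_ge (X.dist x y) r with h | h
    · exact ⟨y, h.le, by simp⟩
    · obtain ⟨z, h1, h2⟩ := hX.exists_between (show X.dist x y = r + (X.dist x y - r) by omega)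
      exact ⟨z, h1.le, by omega⟩
  refine (Finset.card_le_card this).trans ?_
  exact Finset.card_biUnion_le_card_mul _ _ _ fun y _ => (hX.card_ball y s).le

lemma exists_dist_gt (x : V) (r : ℕ) : ∃ y, r < X.dist x y := by
  by_contra! h
  have := hX.inf
  exact Set.infinite_univ ((hX.finite_ball x r).subset fun y _ => h y)

lemma exists_dist_eq (x : V) (r : ℕ) : ∃ y, X.dist x y = r := by
  obtain ⟨y, hy⟩ := hX.exists_dist_gt x r
  obtain ⟨z, h1, h2⟩ := hX.exists_between (show X.dist x y = r + (X.dist x y - r) by omega)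
  exact ⟨z, h1⟩

lemma lt_vol (r : ℕ) : r < vol X r := by
  induction r with
  | zero => exact hX.vol_pos 0
  | succ k ih =>
    obtain ⟨x⟩ := hX.nonempty
    obtain ⟨y, hy⟩ := hX.exists_dist_eq x (k + 1)
    have : ball X x k ⊂ ball X x (k + 1) := by
      refine Finset.ssubset_iff_of_subset (hX.ball_subset_ball x (by omega)) |>.mpr ⟨y, ?_, ?_⟩
      · simp [hX.mem_ball, hy]
      · simp [hX.mem_ball, hy]
    have := Finset.card_lt_card this
    rw [hX.card_ball, hX.card_ball] at this
    omega

lemma vol_zero : vol X 0 = 1 := by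
  obtain ⟨x⟩ := hX.nonempty
  rw [← hX.card_ball x, Finset.card_eq_one]
  refine ⟨x, ?_⟩
  ext y
  simp [hX.mem_ball, hX.dist_eq_zero, eq_comm]

lemma deg_pos : 0 < deg X := by
  obtain ⟨x⟩ := hX.nonempty
  obtain ⟨y, hy⟩ := hX.exists_dist_eq x 1
  rw [← hX.card_nbr x]
  exact Finset.card_pos.mpr ⟨y, hX.mem_nbr.mpr (SimpleGraph.dist_eq_one_iff_adj.mp hy)⟩

lemma dist_le_of_adj {x y z : V} (h : X.Adj y z) : X.dist x z ≤ X.dist x y + 1 := by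
  have := hX.tri x y z
  rwa [SimpleGraph.dist_eq_one_iff_adj.mpr h] at this

lemma mem_nbr_comm {x y : V} : y ∈ nbr X x ↔ x ∈ nbr X y := by
  rw [hX.mem_nbr, hX.mem_nbr, SimpleGraph.adj_comm]

end Homog
end TransGraph

namespace TransGraph
open scoped Classical
open Finset

variable {V : Type*} {X : SimpleGraph V}

/-- The outer vertex boundary as a finset. -/
noncomputable def bd (X : SimpleGraph V) (F : Finset V) : Finset V := F.biUnion (nbr X) \ F

/-- `X` contains arbitrarily large finite sets whose inradius is at least linear in the
size of the boundary. -/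
def Deep (X : SimpleGraph V) : Prop :=
  ∃ K : ℝ, 0 < K ∧ ∀ M : ℕ, ∃ (A : Finset V) (x : V) (t : ℕ),
    M ≤ #(bd X A) ∧ ball X x t ⊆ A ∧ (#(bd X A) : ℝ) ≤ K * (t + 1)

/-- The Følner property. -/
def Amenable (X : SimpleGraph V) : Prop :=
  ∀ δ : ℝ, 0 < δ → ∃ F : Finset V, F.Nonempty ∧ (#(bd X F) : ℝ) ≤ δ * #F

namespace Homog
variable (hX : Homog X)
include hX

lemma mem_bd {F : Finset V} {y : V} : y ∈ bd X F ↔ y ∉ F ∧ ∃ a ∈ F, X.Adj y a := by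
  simp only [bd, Finset.mem_sdiff, Finset.mem_biUnion, hX.mem_nbr, X.adj_comm y]
  tauto

lemma exists_bd_between {F : Finset V} {x : V} (hx : x ∈ F) :
    ∀ (n : ℕ) (y : V), y ∉ F → X.dist x y = n → ∃ z ∈ bd X F, X.dist x z ≤ n := by
  intro n
  induction n with
  | zero =>
    intro y hy h
    exact absurd ((hX.dist_eq_zero.mp h) ▸ hx) hy
  | succ n ih =>
    intro y hy h
    obtain ⟨z, h1, h2⟩ := hX.exists_step h
    by_cases hz : z ∈ F
    · exact ⟨y, hX.mem_bd.mpr ⟨hy, z, hz, h2.symm⟩, h.le⟩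
    · obtain ⟨w, hw, hw'⟩ := ih z hz h1
      exact ⟨w, hw, by omega⟩

lemma coe_bd (F : Finset V) : (bd X F : Set V) = vertexBoundary X F := by
  ext y
  simp [hX.mem_bd, vertexBoundary]

lemma deep_of_gdepth (K : ℝ) (hK : 0 < K) (A : ℕ → Set V) (hfin : ∀ n : ℕ, (A n).Finite)
    (hbdry : ∀ M : ℕ, ∃ N : ℕ, ∀ n : ℕ, N ≤ n → M ≤ (vertexBoundary X (A n)).ncard)
    (hdepth : ∀ n : ℕ,
      ((vertexBoundary X (A n)).ncard : ℝ) / K - K < gdepth X (A n)) : Deep X := by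
  refine ⟨K * (1 + K), by positivity, fun M => ?_⟩
  obtain ⟨N, hN⟩ := hbdry (M + ⌈K ^ 2⌉₊)
  have h1 := hN N le_rfl
  have h2 := hdepth N
  set F := (hfin N).toFinset with hF
  have hFA : (F : Set V) = A N := by simp [hF]
  rw [← hFA, ← hX.coe_bd, Set.ncard_coe_finset] at h1 h2
  have h3 : K ^ 2 ≤ (#(bd X F) : ℝ) := by
    refine (Nat.le_ceil _).trans ?_
    exact_mod_cast (by omega : ⌈K ^ 2⌉₊ ≤ #(bd X F))
  have h4 : 0 < gdepth X F := by
    refine lt_of_le_of_lt ?_ h2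
    rw [sub_nonneg, le_div_iff₀ hK]
    nlinarith
  obtain ⟨t, ht1, ht2⟩ : ∃ t : ℕ, (t : ℝ) < gdepth X F ∧ gdepth X F ≤ t + 1 := by
    have := Nat.ceil_pos.mpr h4
    refine ⟨⌈gdepth X F⌉₊ - 1, ?_, ?_⟩
    · exact Nat.lt_ceil.mp (by omega)
    · have h5 := Nat.le_ceil (gdepth X F)
      have : ((⌈gdepth X F⌉₊ - 1 : ℕ) : ℝ) + 1 = ⌈gdepth X F⌉₊ := by
        exact_mod_cast Nat.sub_add_cancel this
      linarith
  have h5 : ∃ x ∈ F, ∀ b ∈ bd X F, t < X.dist x b := by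
    by_contra! h
    refine absurd ht1 (not_lt.mpr ?_)
    refine csInf_le ⟨0, fun r hr => hr.1⟩ ⟨t.cast_nonneg, fun x hx => ?_⟩
    obtain ⟨b, hb, hb'⟩ := h x hx
    refine ⟨b, ?_, by exact_mod_cast hb'⟩
    rw [← hX.coe_bd]
    exact hb
  obtain ⟨x, hx, hxb⟩ := h5
  refine ⟨F, x, t, by omega, fun y hy => ?_, ?_⟩
  · by_contra hyF
    obtain ⟨z, hz, hz'⟩ := hX.exists_bd_between hx _ y hyF rfl
    have := hxb z hz
    have := hX.mem_ball.mp hy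
    omega
  · have h6 : (#(bd X F) : ℝ) / K - K < t + 1 := h2.trans_le ht2
    have h7 : (#(bd X F) : ℝ) < K * (t + 1 + K) := by
      rw [sub_lt_iff_lt_add, div_lt_iff₀ hK] at h6
      linarith
    nlinarith [mul_nonneg (mul_nonneg hK.le hK.le) (t.cast_nonneg : (0 : ℝ) ≤ t)]

lemma amenable_of_deep (h : Deep X) : Amenable X := by
  intro δ hδ
  by_contra! hcon
  obtain ⟨K, hK, h⟩ := h
  have hvol : ∀ r : ℕ, (1 + δ) ^ r ≤ (vol X r : ℝ) := by
    intro r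
    induction r with
    | zero => simp [hX.vol_zero]
    | succ r ih =>
      obtain ⟨x⟩ := hX.nonempty
      have h1 := hcon (ball X x r) ⟨x, hX.self_mem_ball x r⟩
      have h2 : ball X x r ∪ bd X (ball X x r) ⊆ ball X x (r + 1) := by
        intro y hy
        rcases Finset.mem_union.mp hy with hy | hy
        · exact hX.ball_subset_ball x (by omega) hy
        · obtain ⟨_, a, ha, hadj⟩ := hX.mem_bd.mp hy
          have := hX.dist_le_of_adj (x := x) hadj.symm
          have := hX.mem_ball.mp ha
          exact hX.mem_ball.mpr (by omega)
      have h3 := Finset.card_le_card h2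
      rw [Finset.card_union_of_disjoint (by rw [bd]; exact Finset.disjoint_sdiff), hX.card_ball,
        hX.card_ball] at h3
      rw [hX.card_ball] at h1
      have h4 : (vol X r : ℝ) + #(bd X (ball X x r)) ≤ vol X (r + 1) := by exact_mod_cast h3
      rw [pow_succ]
      nlinarith
  have hlim : Filter.Tendsto (fun t : ℕ => ((t : ℝ) ^ 1) / (1 + δ) ^ t) Filter.atTop (nhds 0) :=
    tendsto_pow_const_div_const_pow_of_one_lt 1 (by linarith)
  have hlim0 : Filter.Tendsto (fun t : ℕ => (1 : ℝ) / (1 + δ) ^ t) Filter.atTop (nhds 0) := by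
    simpa using tendsto_pow_const_div_const_pow_of_one_lt (r := 1 + δ) 0 (by linarith)
  have hlim2 : Filter.Tendsto (fun t : ℕ => K * (((t : ℝ) ^ 1) / (1 + δ) ^ t + 1 / (1 + δ) ^ t))
      Filter.atTop (nhds 0) := by
    simpa using (hlim.add hlim0).const_mul K
  obtain ⟨T, hT⟩ := (hlim2.eventually (gt_mem_nhds hδ)).exists_forall_of_atTop
  obtain ⟨A, x, t, hM, hA, hb⟩ := h (⌈K * (T + 1)⌉₊ + 1)
  have hM' : K * (T + 1) < #(bd X A) := by
    refine lt_of_le_of_lt (Nat.le_ceil _) ?_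
    exact_mod_cast hM
  have hTt : T ≤ t := by
    have : K * (T + 1) < K * (t + 1) := hM'.trans_le hb
    have := lt_of_mul_lt_mul_left this hK.le
    have : (T : ℝ) < t := by linarith
    exact_mod_cast this.le
  have h1 := hT t hTt
  have h2 : K * (t + 1) < δ * (1 + δ) ^ t := by
    have hp : (0 : ℝ) < (1 + δ) ^ t := by positivity
    rw [← add_div, ← mul_div_assoc, div_lt_iff₀ hp, pow_one] at h1
    exact h1
  have h3 := hcon A ⟨x, hA (hX.self_mem_ball x t)⟩
  have h4 : (vol X t : ℝ) ≤ #A := by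
    rw [← hX.card_ball x]
    exact_mod_cast Finset.card_le_card hA
  have h5 := hvol t
  have : δ * (1 + δ) ^ t ≤ δ * #A := by gcongr; linarith
  linarith

/-- Translation invariance of ball sums of an invariant kernel. -/
lemma sum_ball_invariant (m : V → V → ℝ) (hm : ∀ (φ : X ≃g X) x y, m (φ x) (φ y) = m x y)
    (x x' : V) (r : ℕ) : ∑ y ∈ ball X x' r, m x' y = ∑ y ∈ ball X x r, m x y := by
  obtain ⟨φ, rfl⟩ := hX.trans x x'
  rw [hX.ball_map, Finset.sum_map]
  exact Finset.sum_congr rfl fun y _ => hm φ x y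

lemma mass_transport (ham : Amenable X) (m : V → V → ℝ)
    (hm : ∀ (φ : X ≃g X) x y, m (φ x) (φ y) = m x y) (o : V) (r : ℕ) :
    ∑ y ∈ ball X o r, m o y = ∑ y ∈ ball X o r, m y o := by
  set D : V → V → ℝ := fun x y => m x y - m y x with hD
  set c : ℝ := ∑ y ∈ ball X o r, |D o y| with hc
  set s : ℝ := ∑ y ∈ ball X o r, D o y with hs
  have hc0 : 0 ≤ c := Finset.sum_nonneg fun _ _ => abs_nonneg _
  have hcx : ∀ x, ∑ y ∈ ball X x r, |D x y| = c := fun x =>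
    hX.sum_ball_invariant (fun x y => |D x y|) (fun φ x y => by simp [hD, hm]) o x r
  have hsx : ∀ x, ∑ y ∈ ball X x r, D x y = s := fun x =>
    hX.sum_ball_invariant D (fun φ x y => by simp [hD, hm]) o x r
  have key : ∀ F : Finset V, #F * |s| ≤ c * (#(bd X F) * vol X r) := by
    intro F
    have h1 : ∑ x ∈ F, ∑ y ∈ F with y ∈ ball X x r, D x y = 0 := by
      have h2 : ∑ x ∈ F, ∑ y ∈ F with y ∈ ball X x r, D x y
          = ∑ x ∈ F, ∑ y ∈ F with y ∈ ball X x r, D y x := by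
        simp_rw [Finset.sum_filter]
        rw [Finset.sum_comm]
        simp_rw [hX.mem_ball_comm]
      have h3 : ∑ x ∈ F, ∑ y ∈ F with y ∈ ball X x r, D y x
          = - ∑ x ∈ F, ∑ y ∈ F with y ∈ ball X x r, D x y := by
        rw [← Finset.sum_neg_distrib]
        refine Finset.sum_congr rfl fun x _ => ?_
        rw [← Finset.sum_neg_distrib]
        exact Finset.sum_congr rfl fun y _ => by simp [hD]
      linarith
    have h4 : (#F : ℝ) * s = ∑ x ∈ F, ∑ y ∈ ball X x r with y ∉ F, D x y := by
      have : ∑ x ∈ F, ∑ y ∈ ball X x r, D x y = #F * s := by simp [hsx]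
      rw [← this, ← sub_eq_zero, ← Finset.sum_sub_distrib, ← h1]
      refine Finset.sum_congr rfl fun x _ => ?_
      rw [← Finset.sum_filter_add_sum_filter_not (ball X x r) (· ∈ F), add_sub_cancel_right]
      refine Finset.sum_congr ?_ fun _ _ => rfl
      ext y; simp [and_comm]
    have h5 : ∀ x ∈ F, |∑ y ∈ ball X x r with y ∉ F, D x y|
        ≤ if x ∈ (bd X F).biUnion (fun z => ball X z r) then c else 0 := by
      intro x hx
      split_ifs with hxz
      · refine (Finset.abs_sum_le_sum_abs _ _).trans ?_
        rw [← hcx x]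
        exact Finset.sum_le_sum_of_subset_of_nonneg (Finset.filter_subset _ _)
          fun _ _ _ => abs_nonneg _
      · rw [Finset.filter_eq_empty_iff.mpr, Finset.sum_empty, abs_zero]
        intro y hy hyF
        obtain ⟨z, hz, hz'⟩ := hX.exists_bd_between hx _ y hyF rfl
        refine hxz (Finset.mem_biUnion.mpr ⟨z, hz, ?_⟩)
        rw [hX.mem_ball_comm, hX.mem_ball]
        exact hz'.trans (hX.mem_ball.mp hy)
    calc (#F : ℝ) * |s| = |(#F : ℝ) * s| := by rw [abs_mul, Nat.abs_cast]
      _ ≤ ∑ x ∈ F, |∑ y ∈ ball X x r with y ∉ F, D x y| := by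
        rw [h4]; exact Finset.abs_sum_le_sum_abs _ _
      _ ≤ ∑ x ∈ F, if x ∈ (bd X F).biUnion (fun z => ball X z r) then c else 0 :=
        Finset.sum_le_sum h5
      _ = #{x ∈ F | x ∈ (bd X F).biUnion (fun z => ball X z r)} * c := by
        rw [← Finset.sum_filter, Finset.sum_const, nsmul_eq_mul]
      _ ≤ (#(bd X F) * vol X r : ℕ) * c := by
        gcongr
        refine (Finset.card_le_card (t := (bd X F).biUnion (fun z => ball X z r)) ?_).trans ?_
        · intro x hx; exact (Finset.mem_filter.mp hx).2
        · exact Finset.card_biUnion_le_card_mul _ _ _ fun y _ => (hX.card_ball y r).le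
      _ = c * (#(bd X F) * vol X r) := by push_cast; ring
  have hs0 : |s| ≤ 0 := by
    refine le_of_forall_pos_le_add fun ε hε => ?_
    obtain ⟨F, hF, hF'⟩ := ham (ε / (c * vol X r + 1)) (by positivity)
    have hFpos : (0 : ℝ) < #F := by exact_mod_cast hF.card_pos
    have h1 := key F
    have h2 : c * (#(bd X F) * vol X r) ≤ #F * ε := by
      have h3 : c * (#(bd X F) * vol X r) ≤ c * vol X r * (ε / (c * vol X r + 1) * #F) := by
        calc c * (#(bd X F) * vol X r) = c * vol X r * #(bd X F) := by ring
          _ ≤ _ := by gcongr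
      refine h3.trans ?_
      have : c * vol X r * (ε / (c * vol X r + 1)) ≤ ε := by
        rw [← mul_div_assoc, div_le_iff₀ (by positivity)]
        nlinarith
      nlinarith
    rw [zero_add]
    exact le_of_mul_le_mul_left (h1.trans h2) hFpos
  have : s = 0 := abs_nonpos_iff.mp hs0
  rw [hs, hD, Finset.sum_sub_distrib, sub_eq_zero] at this
  exact this

end Homog
end TransGraph

namespace TransGraph
open scoped Classical
open Finset

variable {V : Type*} {X : SimpleGraph V}

/-- The neighbours of `b` that are closer to `x`. -/
noncomputable def par (X : SimpleGraph V) (x b : V) : Finset V :=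
  {a ∈ nbr X b | X.dist x a + 1 = X.dist x b}

/-- The mass at `a` after pushing the uniform unit mass on the ball of radius `R` about `x`
towards `x` for `i` steps, each vertex splitting its mass equally between its parents. -/
noncomputable def flow (X : SimpleGraph V) (R : ℕ) : ℕ → V → V → ℝ
  | 0, x, a => if a ∈ ball X x R then 1 else 0
  | i + 1, x, a => ∑ b ∈ ball X x R, if a ∈ par X x b then flow X R i x b / #(par X x b) else 0

lemma flow_nonneg (R i : ℕ) (x a : V) : 0 ≤ flow X R i x a := by
  induction i generalizing a with
  | zero => rw [flow]; split_ifs <;> simp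
  | succ i ih =>
    rw [flow]
    refine Finset.sum_nonneg fun b _ => ?_
    split_ifs
    · exact div_nonneg (ih b) (Nat.cast_nonneg _)
    · exact le_rfl

namespace Homog
variable (hX : Homog X)
include hX

lemma mem_par {x a b : V} : a ∈ par X x b ↔ X.Adj b a ∧ X.dist x a + 1 = X.dist x b := by
  rw [par, Finset.mem_filter, hX.mem_nbr]

lemma par_map (φ : X ≃g X) (x b : V) :
    par X (φ x) (φ b) = (par X x b).map φ.toEquiv.toEmbedding := by
  rw [par, hX.nbr_map, Finset.filter_map, par]
  congr 1
  refine Finset.filter_congr fun a _ => ?_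
  change X.dist (φ x) (φ a) + 1 = _ ↔ _
  rw [dist_map, dist_map]

lemma par_nonempty {x b : V} (h : b ≠ x) : (par X x b).Nonempty := by
  have : X.dist x b ≠ 0 := fun h' => h (hX.dist_eq_zero.mp h').symm
  obtain ⟨z, h1, h2⟩ := hX.exists_step (show X.dist x b = (X.dist x b - 1) + 1 by omega)
  exact ⟨z, hX.mem_par.mpr ⟨h2.symm, by omega⟩⟩

lemma flow_map (φ : X ≃g X) (R i : ℕ) (x a : V) :
    flow X R i (φ x) (φ a) = flow X R i x a := by
  induction i generalizing a with
  | zero =>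
    simp only [flow, hX.mem_ball, dist_map]
  | succ i ih =>
    simp only [flow]
    rw [hX.ball_map, Finset.sum_map]
    refine Finset.sum_congr rfl fun b _ => ?_
    change (if φ a ∈ par X (φ x) (φ b) then flow X R i (φ x) (φ b) / #(par X (φ x) (φ b)) else 0)
      = _
    rw [ih, hX.par_map, Finset.card_map]
    congr 1
    simp only [Finset.mem_map_equiv, eq_iff_iff]
    rw [show φ.toEquiv.symm (φ a) = a from φ.symm_apply_apply a]

lemma flow_eq_zero {R i : ℕ} {x a : V} (h : R < X.dist x a + i) : flow X R i x a = 0 := by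
  induction i generalizing a with
  | zero =>
    rw [flow, if_neg]
    rw [hX.mem_ball]
    omega
  | succ i ih =>
    rw [flow]
    refine Finset.sum_eq_zero fun b _ => ?_
    split_ifs with hb
    · have := (hX.mem_par.mp hb).2
      rw [ih (by omega), zero_div]
    · rfl

lemma sum_flow_succ (R i : ℕ) (x : V) (g : V → ℝ) :
    ∑ a ∈ ball X x R, flow X R (i + 1) x a * g a
      = ∑ b ∈ ball X x R, flow X R i x b * ((∑ a ∈ par X x b, g a) / #(par X x b)) := by
  simp only [flow, Finset.sum_mul]
  rw [Finset.sum_comm]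
  refine Finset.sum_congr rfl fun b hb => ?_
  simp only [ite_mul, zero_mul]
  rw [← Finset.sum_filter, Finset.sum_div, Finset.mul_sum]
  refine Finset.sum_congr ?_ fun a _ => by ring
  ext a
  rw [Finset.mem_filter]
  refine ⟨fun h => h.2, fun h => ⟨?_, h⟩⟩
  have := (hX.mem_par.mp h).2
  have := hX.mem_ball.mp hb
  exact hX.mem_ball.mpr (by omega)

lemma sum_flow_le (R i : ℕ) (x : V) : ∑ a ∈ ball X x R, flow X R i x a ≤ vol X R := by
  induction i with
  | zero =>
    rw [← hX.card_ball x R]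
    simp [flow]
  | succ i ih =>
    refine le_trans ?_ ih
    have := hX.sum_flow_succ R i x (fun _ => 1)
    simp only [mul_one] at this
    rw [this]
    refine Finset.sum_le_sum fun b _ => ?_
    refine mul_le_of_le_one_right (flow_nonneg _ _ _ _) ?_
    simp only [Finset.sum_const, nsmul_eq_mul, mul_one]
    exact div_self_le_one _

lemma sum_flow_step (R i : ℕ) (x : V) (φ c : V → ℝ) (hx : φ x ≤ 0) (hc : ∀ a, 0 ≤ c a)
    (hφ : ∀ z a, X.Adj z a → X.dist x z + 1 = X.dist x a → φ a ≤ φ z + c a) :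
    ∑ a ∈ ball X x R, flow X R i x a * φ a ≤ ∑ a ∈ ball X x R, flow X R i x a * c a
      + ∑ a ∈ ball X x R, flow X R (i + 1) x a * φ a := by
  rw [hX.sum_flow_succ, ← Finset.sum_add_distrib]
  refine Finset.sum_le_sum fun b _ => ?_
  rw [← mul_add]
  refine mul_le_mul_of_nonneg_left ?_ (flow_nonneg _ _ _ _)
  by_cases hb : b = x
  · have : par X x b = ∅ := by
      refine Finset.eq_empty_of_forall_notMem fun a ha => ?_
      have := (hX.mem_par.mp ha).2
      rw [hb, SimpleGraph.dist_self] at this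
      omega
    rw [this, hb]
    simpa using hx.trans (hc x)
  · have hpos : (0 : ℝ) < #(par X x b) := by exact_mod_cast (hX.par_nonempty hb).card_pos
    rw [← sub_le_iff_le_add', le_div_iff₀ hpos]
    have : ∑ a ∈ par X x b, (φ b - c b) ≤ ∑ a ∈ par X x b, φ a := by
      refine Finset.sum_le_sum fun a ha => ?_
      obtain ⟨h1, h2⟩ := hX.mem_par.mp ha
      linarith [hφ a b h1.symm h2]
    rw [Finset.sum_const, nsmul_eq_mul] at this
    linarith

lemma sum_ball_le_flow (R : ℕ) (x : V) (φ c : V → ℝ) (hx : φ x ≤ 0) (hc : ∀ a, 0 ≤ c a)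
    (hφ : ∀ z a, X.Adj z a → X.dist x z + 1 = X.dist x a → φ a ≤ φ z + c a) :
    ∑ a ∈ ball X x R, φ a ≤ ∑ a ∈ ball X x R, (∑ i ∈ range R, flow X R i x a) * c a := by
  have h1 : ∀ k, ∑ a ∈ ball X x R, φ a ≤
      ∑ a ∈ ball X x R, (∑ i ∈ range k, flow X R i x a) * c a
        + ∑ a ∈ ball X x R, flow X R k x a * φ a := by
    intro k
    induction k with
    | zero =>
      simp only [Finset.range_zero, Finset.sum_empty, zero_mul, Finset.sum_const_zero, zero_add]
      refine (Finset.sum_congr rfl fun a ha => ?_).le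
      rw [flow, if_pos ha, one_mul]
    | succ k ih =>
      refine ih.trans ?_
      have := hX.sum_flow_step R k x φ c hx hc hφ
      simp only [Finset.sum_range_succ, add_mul, Finset.sum_add_distrib] at this ⊢
      linarith
  refine (h1 R).trans (add_le_of_nonpos_right ?_)
  refine Finset.sum_nonpos fun a _ => ?_
  by_cases ha : a = x
  · exact mul_nonpos_of_nonneg_of_nonpos (flow_nonneg _ _ _ _) (ha ▸ hx)
  · rw [hX.flow_eq_zero, zero_mul]
    have : X.dist x a ≠ 0 := fun h' => ha (hX.dist_eq_zero.mp h').symm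
    omega

/-- The sum over all pairs at distance at most `R` of a function that grows by at most `c`
along geodesics is controlled by the total of `c`. -/
lemma sum_pairs_le (ham : Amenable X) (R : ℕ) (F : Finset V) (φ : V → V → ℝ) (c : V → ℝ)
    (hx : ∀ x, φ x x ≤ 0) (hc : ∀ a, 0 ≤ c a)
    (hφ : ∀ x z a, X.Adj z a → X.dist x z + 1 = X.dist x a → φ x a ≤ φ x z + c a) :
    ∑ x ∈ F, ∑ y ∈ ball X x R, φ x y ≤
      R * vol X R * ∑ a ∈ F.biUnion (fun x => ball X x R), c a := by
  set M : V → V → ℝ := fun x a => ∑ i ∈ range R, flow X R i x a with hM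
  have hM0 : ∀ x a, 0 ≤ M x a := fun x a => Finset.sum_nonneg fun i _ => flow_nonneg _ _ _ _
  have hMinv : ∀ (ψ : X ≃g X) x a, M (ψ x) (ψ a) = M x a := fun ψ x a => by
    simp [hM, hX.flow_map]
  have hMsum : ∀ a, ∑ x ∈ ball X a R, M x a ≤ R * vol X R := by
    intro a
    rw [← hX.mass_transport ham M hMinv a R]
    simp only [hM]
    rw [Finset.sum_comm]
    refine (Finset.sum_le_sum fun i _ => hX.sum_flow_le R i a).trans ?_
    simp
  calc ∑ x ∈ F, ∑ y ∈ ball X x R, φ x y ≤ ∑ x ∈ F, ∑ a ∈ ball X x R, M x a * c a :=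
        Finset.sum_le_sum fun x _ => hX.sum_ball_le_flow R x (φ x) c (hx x) hc (hφ x)
    _ = ∑ x ∈ F, ∑ a ∈ F.biUnion (fun x => ball X x R), if a ∈ ball X x R then M x a * c a else 0 := by
        refine Finset.sum_congr rfl fun x hx => ?_
        rw [← Finset.sum_filter]
        refine Finset.sum_congr ?_ fun _ _ => rfl
        ext a
        simp only [Finset.mem_filter, Finset.mem_biUnion]
        exact ⟨fun h => ⟨⟨x, hx, h⟩, h⟩, fun h => h.2⟩
    _ = ∑ a ∈ F.biUnion (fun x => ball X x R), ∑ x ∈ F, if a ∈ ball X x R then M x a * c a else 0 :=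
        Finset.sum_comm
    _ ≤ ∑ a ∈ F.biUnion (fun x => ball X x R), (R * vol X R) * c a := by
        refine Finset.sum_le_sum fun a _ => ?_
        refine le_trans ?_ (mul_le_mul_of_nonneg_right (hMsum a) (hc a))
        rw [← Finset.sum_filter, Finset.sum_mul]
        refine Finset.sum_le_sum_of_subset_of_nonneg ?_ fun x _ _ => mul_nonneg (hM0 _ _) (hc _)
        intro x hx
        rw [hX.mem_ball_comm]
        exact (Finset.mem_filter.mp hx).2
    _ = _ := by rw [Finset.mul_sum]

end Homog
end TransGraph

namespace TransGraph
open scoped Classical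
open Finset

variable {V : Type*} {X : SimpleGraph V}

/-- The volume of balls is at most quadratic along a sequence of radii. -/
def QuadSubseq (X : SimpleGraph V) : Prop :=
  ∃ C : ℝ, 0 < C ∧ ∀ N : ℕ, ∃ R : ℕ, N ≤ R ∧ (vol X R : ℝ) ≤ C * (R : ℝ) ^ 2

namespace Homog
variable (hX : Homog X)
include hX

lemma card_le_bd (ham : Amenable X) {A : Finset V} {R : ℕ} (h : 2 * #A ≤ vol X R) :
    (#A : ℝ) ≤ 2 * R * ((1 + deg X) * #(bd X A)) := by
  set E : Finset V := bd X A ∪ (bd X A).biUnion (nbr X) with hE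
  have hEc : (#E : ℝ) ≤ (1 + deg X) * #(bd X A) := by
    have : #E ≤ #(bd X A) + #(bd X A) * deg X :=
      (Finset.card_union_le _ _).trans (Nat.add_le_add_left
        (Finset.card_biUnion_le_card_mul _ _ _ fun y _ => (hX.card_nbr y).le) _)
    have : (#E : ℝ) ≤ #(bd X A) + #(bd X A) * deg X := by exact_mod_cast this
    linarith
  have key := hX.sum_pairs_le ham R A (fun x y => if (x ∈ A ↔ y ∈ A) then 0 else 1)
    (fun a => if a ∈ E then 1 else 0) (fun x => by simp) (fun a => by split_ifs <;> simp)
    (by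
      intro x z a hza _
      by_cases hiff : (z ∈ A ↔ a ∈ A)
      · simp only [hiff]
        split_ifs <;> simp
      · have hEa : a ∈ E := by
          by_cases ha : a ∈ A
          · refine Finset.mem_union_right _ (Finset.mem_biUnion.mpr ⟨z, ?_, hX.mem_nbr.mpr hza⟩)
            exact hX.mem_bd.mpr ⟨by tauto, a, ha, hza⟩
          · refine Finset.mem_union_left _ (hX.mem_bd.mpr ⟨ha, z, by tauto, hza.symm⟩)
        simp only [hEa, if_true]
        split_ifs <;> simp)
  have h1 : ∀ x ∈ A, (vol X R : ℝ) / 2 ≤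
      ∑ y ∈ ball X x R, if (x ∈ A ↔ y ∈ A) then (0 : ℝ) else 1 := by
    intro x hx
    simp only [hx, true_iff]
    have h2 : ∀ y, (if y ∈ A then (0 : ℝ) else 1) = 1 - if y ∈ A then 1 else 0 := fun y => by
      split_ifs <;> simp
    simp only [h2, Finset.sum_sub_distrib, Finset.sum_boole, Finset.sum_const, nsmul_eq_mul,
      mul_one, hX.card_ball]
    have h3 : #{y ∈ ball X x R | y ∈ A} ≤ #A :=
      Finset.card_le_card fun y hy => (Finset.mem_filter.mp hy).2
    have h4 : (#{y ∈ ball X x R | y ∈ A} : ℝ) ≤ #A := by exact_mod_cast h3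
    have h5 : (2 : ℝ) * #A ≤ vol X R := by exact_mod_cast h
    linarith
  have h2 := Finset.sum_le_sum h1
  rw [Finset.sum_const, nsmul_eq_mul] at h2
  have h3 : ∑ a ∈ A.biUnion (fun x => ball X x R), (if a ∈ E then (1 : ℝ) else 0) ≤ #E := by
    rw [Finset.sum_boole]
    exact_mod_cast Finset.card_le_card fun y hy => (Finset.mem_filter.mp hy).2
  have hv : (0 : ℝ) < vol X R := by exact_mod_cast hX.vol_pos R
  have h4 : (vol X R : ℝ) * #A ≤ vol X R * (2 * R * ((1 + deg X) * #(bd X A))) := by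
    have h5 := mul_le_mul_of_nonneg_left (h3.trans hEc) (by positivity : (0 : ℝ) ≤ R * vol X R)
    have h6 := h2.trans (key.trans h5)
    linarith
  exact le_of_mul_le_mul_left h4 hv

lemma quadSubseq_of_deep (h : Deep X) : QuadSubseq X := by
  have ham := hX.amenable_of_deep h
  obtain ⟨K, hK, h⟩ := h
  have hv1 : (0 : ℝ) < vol X 1 := by exact_mod_cast hX.vol_pos 1
  refine ⟨4 * (1 + deg X) * K * vol X 1, by positivity, fun N => ?_⟩
  obtain ⟨A, x, t, hM, hA, hb⟩ := h ⌈K * N⌉₊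
  have hex : ∃ R, 2 * #A ≤ vol X R := ⟨2 * #A, (hX.lt_vol _).le⟩
  set R := Nat.find hex with hR
  have hR1 : 2 * #A ≤ vol X R := Nat.find_spec hex
  have hAt : vol X t ≤ #A := by
    rw [← hX.card_ball x]; exact Finset.card_le_card hA
  have htR : t < R := by
    by_contra! hlt
    have := hX.vol_mono hlt
    have := hX.vol_pos t
    omega
  have hR2 : vol X (R - 1) < 2 * #A := by
    have := Nat.find_min hex (m := R - 1) (by omega)
    omega
  have htR' : (t : ℝ) + 1 ≤ R := by exact_mod_cast htR
  have hbR : (#(bd X A) : ℝ) ≤ K * R := hb.trans (by gcongr)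
  refine ⟨R, ?_, ?_⟩
  · have h1 : K * N ≤ K * R := ((Nat.le_ceil _).trans (by exact_mod_cast hM)).trans hbR
    exact_mod_cast le_of_mul_le_mul_left h1 hK
  · have h1 : vol X R ≤ vol X (R - 1) * vol X 1 := by
      have := hX.vol_add (R - 1) 1
      rwa [Nat.sub_add_cancel (by omega)] at this
    have h2 : (vol X R : ℝ) ≤ 2 * #A * vol X 1 := by
      have : vol X R ≤ 2 * #A * vol X 1 := h1.trans (Nat.mul_le_mul_right _ hR2.le)
      exact_mod_cast this
    have h3 := hX.card_le_bd ham hR1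
    have h4 : (#A : ℝ) ≤ 2 * R * ((1 + deg X) * (K * R)) := h3.trans (by gcongr)
    calc (vol X R : ℝ) ≤ 2 * #A * vol X 1 := h2
      _ ≤ 2 * (2 * R * ((1 + deg X) * (K * R))) * vol X 1 := by gcongr
      _ = _ := by ring

end Homog
end TransGraph

namespace TransGraph
open scoped Classical
open Finset

variable {V : Type*} {X : SimpleGraph V}

/-- The transition probabilities of the lazy random walk. -/
noncomputable def pk (X : SimpleGraph V) : ℕ → V → V → ℝ
  | 0, x, y => if x = y then 1 else 0
  | k + 1, x, y => pk X k x y / 2 + (∑ z ∈ nbr X x, pk X k z y) / (2 * deg X)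

/-- Half the squared distance of the heat kernels at `x` and `y`. -/
noncomputable def psi (X : SimpleGraph V) (m : ℕ) (x y : V) : ℝ :=
  pk X (2 * m) x x - pk X (2 * m) x y

/-- The lazy Laplacian. -/
noncomputable def lap (X : SimpleGraph V) (g : V → ℝ) (x : V) : ℝ :=
  g x - (g x / 2 + (∑ z ∈ nbr X x, g z) / (2 * deg X))

lemma pk_succ (k : ℕ) (x y : V) : pk X (k + 1) x y
    = pk X k x y / 2 + (∑ z ∈ nbr X x, pk X k z y) / (2 * deg X) := rfl

lemma pk_nonneg (k : ℕ) (x y : V) : 0 ≤ pk X k x y := by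
  induction k generalizing x with
  | zero => rw [pk]; split_ifs <;> simp
  | succ k ih =>
    rw [pk]
    have := Finset.sum_nonneg fun z (_ : z ∈ nbr X x) => ih z
    have := ih x
    positivity

namespace Homog
variable (hX : Homog X)
include hX

lemma deg_pos' : (0 : ℝ) < deg X := by exact_mod_cast hX.deg_pos

lemma pk_map (φ : X ≃g X) (k : ℕ) (x y : V) : pk X k (φ x) (φ y) = pk X k x y := by
  induction k generalizing x with
  | zero => simp [pk]
  | succ k ih =>
    rw [pk, pk, ih, hX.nbr_map, Finset.sum_map]
    congr 2
    exact Finset.sum_congr rfl fun z _ => ih z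

lemma pk_self (k : ℕ) (x y : V) : pk X k x x = pk X k y y := by
  obtain ⟨φ, rfl⟩ := hX.trans y x
  exact hX.pk_map φ k y y

lemma pk_succ_right (k : ℕ) (x y : V) :
    pk X (k + 1) x y = pk X k x y / 2 + (∑ z ∈ nbr X y, pk X k x z) / (2 * deg X) := by
  induction k generalizing x with
  | zero =>
    simp only [pk, Finset.sum_ite_eq, Finset.sum_ite_eq', hX.mem_nbr_comm (x := x)]
  | succ k ih =>
    conv_lhs => rw [pk]
    conv_rhs => enter [2, 1, 2, z]; rw [pk_succ]
    rw [Finset.sum_add_distrib, ← Finset.sum_div, ← Finset.sum_div, Finset.sum_comm,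
      Finset.sum_congr rfl fun z _ => ih z]
    nth_rewrite 1 [ih x]
    rw [pk_succ]
    rw [Finset.sum_add_distrib, ← Finset.sum_div, ← Finset.sum_div]
    ring

lemma pk_symm (k : ℕ) (x y : V) : pk X k x y = pk X k y x := by
  induction k generalizing x y with
  | zero => simp [pk, eq_comm]
  | succ k ih =>
    rw [hX.pk_succ_right, pk, ih]
    congr 2
    exact Finset.sum_congr rfl fun z _ => ih x z

lemma pk_eq_zero {k : ℕ} {x y : V} (h : k < X.dist x y) : pk X k x y = 0 := by
  induction k generalizing x with
  | zero =>
    rw [pk, if_neg]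
    rintro rfl
    simp at h
  | succ k ih =>
    rw [pk, ih (by omega), Finset.sum_eq_zero]
    · simp
    · intro z hz
      refine ih ?_
      have := hX.dist_le_of_adj (x := y) (hX.mem_nbr.mp hz).symm
      rw [SimpleGraph.dist_comm, SimpleGraph.dist_comm (u := y)] at this
      omega

lemma sum_pk_mul (G : ℕ → V → ℝ)
    (hG : ∀ k x, G (k + 1) x = G k x / 2 + (∑ z ∈ nbr X x, G k z) / (2 * deg X))
    (j k : ℕ) (x : V) (S : Finset V) (hS : ball X x j ⊆ S) :
    ∑ z ∈ S, pk X j x z * G k z = G (j + k) x := by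
  induction j generalizing x with
  | zero =>
    simp [pk, hS (hX.self_mem_ball x 0)]
  | succ j ih =>
    rw [Nat.add_right_comm, hG, ← ih x ((hX.ball_subset_ball x (by omega)).trans hS),
      Finset.sum_congr rfl fun w hw => (ih w (fun y hy => hS (hX.mem_ball.mpr ?_))).symm]
    · rw [Finset.sum_comm, Finset.sum_div, Finset.sum_div, ← Finset.sum_add_distrib]
      refine Finset.sum_congr rfl fun z _ => ?_
      rw [pk, ← Finset.sum_mul]
      ring
    · have h1 := hX.tri x w y
      rw [SimpleGraph.dist_eq_one_iff_adj.mpr (hX.mem_nbr.mp hw)] at h1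
      have := hX.mem_ball.mp hy
      omega

lemma sum_pk (j : ℕ) (x : V) (S : Finset V) (hS : ball X x j ⊆ S) :
    ∑ z ∈ S, pk X j x z = 1 := by
  have := hX.sum_pk_mul (fun _ _ => 1) (fun k x => by
    have := hX.deg_pos'
    rw [Finset.sum_const, hX.card_nbr, nsmul_eq_mul]
    field_simp
    norm_num) j 0 x S hS
  simpa using this

lemma sum_pk_mul_pk (j k : ℕ) (x y : V) (S : Finset V) (hS : ball X x j ⊆ S) :
    ∑ z ∈ S, pk X j x z * pk X k y z = pk X (j + k) x y := by
  simp_rw [hX.pk_symm k y]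
  exact hX.sum_pk_mul (fun k x => pk X k x y) (fun k x => by rw [pk]) j k x S hS

lemma two_psi (m : ℕ) (x y : V) (S : Finset V) (hx : ball X x m ⊆ S) (hy : ball X y m ⊆ S) :
    ∑ z ∈ S, (pk X m x z - pk X m y z) ^ 2 = 2 * psi X m x y := by
  have h1 := hX.sum_pk_mul_pk m m x x S hx
  have h2 := hX.sum_pk_mul_pk m m y y S hy
  have h3 := hX.sum_pk_mul_pk m m x y S hx
  rw [← two_mul] at h1 h2 h3
  rw [hX.pk_self _ y x] at h2
  have : ∀ z, (pk X m x z - pk X m y z) ^ 2 = pk X m x z * pk X m x z + pk X m y z * pk X m y z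
    - 2 * (pk X m x z * pk X m y z) := fun z => by ring
  simp_rw [this]
  rw [Finset.sum_sub_distrib, Finset.sum_add_distrib, ← Finset.mul_sum, h1, h2, h3, psi]
  ring

lemma psi_nonneg (m : ℕ) (x y : V) : 0 ≤ psi X m x y := by
  have := hX.two_psi m x y _ Finset.subset_union_left Finset.subset_union_right
  have h2 : 0 ≤ 2 * psi X m x y := this ▸ Finset.sum_nonneg fun _ _ => sq_nonneg _
  linarith

lemma psi_map (φ : X ≃g X) (m : ℕ) (x y : V) : psi X m (φ x) (φ y) = psi X m x y := by
  simp [psi, hX.pk_map]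

lemma psi_triangle (m : ℕ) (x y z : V) : psi X m x z ≤ 2 * psi X m x y + 2 * psi X m y z := by
  set S := ball X x m ∪ ball X y m ∪ ball X z m
  have hx : ball X x m ⊆ S := Finset.subset_union_left.trans Finset.subset_union_left
  have hy : ball X y m ⊆ S := Finset.subset_union_right.trans Finset.subset_union_left
  have hz : ball X z m ⊆ S := Finset.subset_union_right
  have h1 := hX.two_psi m x y S hx hy
  have h2 := hX.two_psi m y z S hy hz
  have h3 := hX.two_psi m x z S hx hz
  have : ∑ w ∈ S, (pk X m x w - pk X m z w) ^ 2 ≤ 2 * ∑ w ∈ S, (pk X m x w - pk X m y w) ^ 2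
      + 2 * ∑ w ∈ S, (pk X m y w - pk X m z w) ^ 2 := by
    rw [Finset.mul_sum, Finset.mul_sum, ← Finset.sum_add_distrib]
    refine Finset.sum_le_sum fun w _ => ?_
    nlinarith [sq_nonneg (pk X m x w - pk X m y w - (pk X m y w - pk X m z w))]
  linarith

/-- The drop of the return probability is the average of `psi` over the edges at `o`. -/
lemma drop_eq (m : ℕ) (o : V) : pk X (2 * m) o o - pk X (2 * m + 1) o o
    = (∑ s ∈ nbr X o, psi X m o s) / (2 * deg X) := by
  have := hX.deg_pos'
  rw [hX.pk_succ_right]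
  simp only [psi]
  rw [Finset.sum_sub_distrib, Finset.sum_const, hX.card_nbr, nsmul_eq_mul]
  field_simp
  ring

/-- Positivity of the lazy walk operator and the resulting decay of increments. -/
lemma second_difference (m : ℕ) (o : V) :
    0 ≤ pk X (2 * m + 1) o o - 2 * pk X (2 * m + 2) o o + pk X (2 * m + 3) o o := by
  set S := ball X o (m + 3) with hS
  set w : V → ℝ := fun z => pk X m o z - pk X (m + 1) o z with hw
  have hsub : ∀ k ≤ m + 3, ball X o k ⊆ S := fun k hk => hX.ball_subset_ball o hk
  have hw0 : ∀ z, z ∉ S → w z = 0 := by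
    intro z hz
    rw [hX.mem_ball] at hz
    simp only [hw]
    rw [hX.pk_eq_zero (by omega), hX.pk_eq_zero (by omega), sub_zero]
  have hPw : ∀ z, pk X (m + 1) o z - pk X (m + 2) o z
      = w z / 2 + (∑ y ∈ nbr X z, w y) / (2 * deg X) := by
    intro z
    rw [hX.pk_succ_right (m + 1), hX.pk_succ_right m]
    simp only [hw]
    rw [Finset.sum_sub_distrib, hX.pk_succ_right m]
    ring
  have h1 : ∑ z ∈ S, w z * (pk X (m + 1) o z - pk X (m + 2) o z)
      = pk X (2 * m + 1) o o - 2 * pk X (2 * m + 2) o o + pk X (2 * m + 3) o o := by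
    have e1 := hX.sum_pk_mul_pk m (m + 1) o o S (hsub _ (by omega))
    have e2 := hX.sum_pk_mul_pk m (m + 2) o o S (hsub _ (by omega))
    have e3 := hX.sum_pk_mul_pk (m + 1) (m + 1) o o S (hsub _ (by omega))
    have e4 := hX.sum_pk_mul_pk (m + 1) (m + 2) o o S (hsub _ (by omega))
    rw [show m + (m + 1) = 2 * m + 1 by ring] at e1
    rw [show m + (m + 2) = 2 * m + 2 by ring] at e2
    rw [show m + 1 + (m + 1) = 2 * m + 2 by ring] at e3
    rw [show m + 1 + (m + 2) = 2 * m + 3 by ring] at e4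
    rw [← e4, two_mul (pk X (2 * m + 2) o o)]
    nth_rewrite 1 [← e2]
    rw [← e3, ← e1, ← Finset.sum_add_distrib, ← Finset.sum_sub_distrib, ← Finset.sum_add_distrib]
    exact Finset.sum_congr rfl fun z _ => by simp only [hw]; ring
  rw [← h1]
  have hd := hX.deg_pos'
  have h2 : ∑ z ∈ S, ∑ y ∈ nbr X z, w y ^ 2 ≤ deg X * ∑ y ∈ S, w y ^ 2 := by
    calc ∑ z ∈ S, ∑ y ∈ nbr X z, w y ^ 2
        = ∑ z ∈ S, ∑ y ∈ S, if y ∈ nbr X z then w y ^ 2 else 0 := by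
          refine Finset.sum_congr rfl fun z _ => ?_
          rw [← Finset.sum_filter]
          refine (Finset.sum_subset (fun y hy => (Finset.mem_filter.mp hy).2) ?_).symm
          intro y hy hy'
          rw [hw0 y fun h => hy' (Finset.mem_filter.mpr ⟨h, hy⟩)]
          simp
      _ = ∑ y ∈ S, ∑ z ∈ S, if y ∈ nbr X z then w y ^ 2 else 0 := Finset.sum_comm
      _ ≤ ∑ y ∈ S, deg X * w y ^ 2 := by
          refine Finset.sum_le_sum fun y _ => ?_
          rw [← Finset.sum_filter, Finset.sum_const, nsmul_eq_mul, ← hX.card_nbr y]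
          gcongr
          intro z hz
          exact hX.mem_nbr_comm.mp (Finset.mem_filter.mp hz).2
      _ = _ := by rw [Finset.mul_sum]
  have h3 : ∀ z ∈ S, w z ^ 2 / 4 - (∑ y ∈ nbr X z, w y ^ 2) / (4 * deg X)
      ≤ w z * (pk X (m + 1) o z - pk X (m + 2) o z) := by
    intro z _
    have h4 : ∑ y ∈ nbr X z, (-(w z ^ 2 + w y ^ 2) / 2) ≤ ∑ y ∈ nbr X z, w z * w y :=
      Finset.sum_le_sum fun y _ => by nlinarith [sq_nonneg (w z + w y)]
    rw [← Finset.sum_div, Finset.sum_neg_distrib, Finset.sum_add_distrib, Finset.sum_const,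
      hX.card_nbr, nsmul_eq_mul, ← Finset.mul_sum] at h4
    rw [hPw, mul_add, ← mul_div_assoc, ← mul_div_assoc]
    have h5 : -(deg X * w z ^ 2 + ∑ y ∈ nbr X z, w y ^ 2) / 2 / (2 * deg X)
        ≤ w z * (∑ y ∈ nbr X z, w y) / (2 * deg X) := by gcongr
    have h6 : -(deg X * w z ^ 2 + ∑ y ∈ nbr X z, w y ^ 2) / 2 / (2 * deg X)
        = - w z ^ 2 / 4 - (∑ y ∈ nbr X z, w y ^ 2) / (4 * deg X) := by
      field_simp
      ring
    rw [h6] at h5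
    nlinarith
  refine le_trans ?_ (Finset.sum_le_sum h3)
  rw [Finset.sum_sub_distrib, ← Finset.sum_div, ← Finset.sum_div, sub_nonneg,
    div_le_div_iff₀ (by positivity) (by norm_num)]
  linarith

end Homog
end TransGraph

namespace TransGraph
open scoped Classical
open Finset

variable {V : Type*} {X : SimpleGraph V}

/-- Harmonic functions on a graph. -/
def IsHarm {E : Type*} [AddCommGroup E] (X : SimpleGraph V) (h : V → E) : Prop :=
  ∀ x, ∑ y ∈ nbr X x, (h y - h x) = 0

/-- The decrement of the return probability at an even time. -/
noncomputable def drop (X : SimpleGraph V) (o : V) (m : ℕ) : ℝ :=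
  pk X (2 * m) o o - pk X (2 * m + 1) o o

/-- The second difference of the return probability at an even time. -/
noncomputable def ddrop (X : SimpleGraph V) (o : V) (m : ℕ) : ℝ :=
  pk X (2 * m) o o - 2 * pk X (2 * m + 1) o o + pk X (2 * m + 2) o o

namespace Homog
variable (hX : Homog X)
include hX

lemma drop_nonneg (o : V) (m : ℕ) : 0 ≤ drop X o m := by
  rw [drop, hX.drop_eq]
  exact div_nonneg (Finset.sum_nonneg fun s _ => hX.psi_nonneg m o s) (by positivity)

lemma sum_sq_eq_ddrop (o x : V) (m : ℕ) (S : Finset V) (hS : ball X x (m + 1) ⊆ S) :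
    ∑ z ∈ S, (pk X m x z - pk X (m + 1) x z) ^ 2 = ddrop X o m := by
  have hS' : ball X x m ⊆ S := (hX.ball_subset_ball x (by omega)).trans hS
  have e1 := hX.sum_pk_mul_pk m m x x S hS'
  have e2 := hX.sum_pk_mul_pk m (m + 1) x x S hS'
  have e3 := hX.sum_pk_mul_pk (m + 1) (m + 1) x x S hS
  rw [show m + m = 2 * m by ring, hX.pk_self _ x o] at e1
  rw [show m + (m + 1) = 2 * m + 1 by ring, hX.pk_self _ x o] at e2
  rw [show m + 1 + (m + 1) = 2 * m + 2 by ring, hX.pk_self _ x o] at e3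
  rw [ddrop, ← e1, ← e2, ← e3, Finset.mul_sum, ← Finset.sum_sub_distrib, ← Finset.sum_add_distrib]
  exact Finset.sum_congr rfl fun z _ => by ring

lemma ddrop_nonneg (o : V) (m : ℕ) : 0 ≤ ddrop X o m := by
  rw [← hX.sum_sq_eq_ddrop o o m _ subset_rfl]
  exact Finset.sum_nonneg fun _ _ => sq_nonneg _

lemma ddrop_le (o : V) (m : ℕ) : ddrop X o m ≤ drop X o m - drop X o (m + 1) := by
  have := hX.second_difference m o
  rw [ddrop, drop, drop, show 2 * (m + 1) + 1 = 2 * m + 3 by ring,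
    show 2 * (m + 1) = 2 * m + 2 by ring]
  linarith

lemma psi_le_of_adj (o : V) (m : ℕ) {x s : V} (h : X.Adj x s) :
    psi X m x s ≤ 2 * deg X * drop X o m := by
  obtain ⟨φ, rfl⟩ := hX.trans o x
  obtain ⟨s, rfl⟩ := φ.surjective s
  rw [hX.psi_map]
  have := hX.deg_pos'
  rw [drop, hX.drop_eq, mul_div_cancel₀ _ (by positivity)]
  exact Finset.single_le_sum (f := fun s => psi X m o s) (fun s _ => hX.psi_nonneg m o s)
    (hX.mem_nbr.mpr (φ.map_adj_iff.mp h))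

lemma psi_le_pow (o : V) (m n : ℕ) {x y : V} (h : X.dist x y = n) :
    psi X m x y ≤ 4 ^ n * (2 * deg X * drop X o m) := by
  have hB : 0 ≤ 2 * deg X * drop X o m := mul_nonneg (by positivity) (hX.drop_nonneg o m)
  induction n generalizing y with
  | zero =>
    rw [← hX.dist_eq_zero.mp h, psi, sub_self]
    positivity
  | succ n ih =>
    obtain ⟨z, h1, h2⟩ := hX.exists_step h
    have h3 := hX.psi_triangle m x z y
    have h4 := ih h1
    have h5 := hX.psi_le_of_adj o m h2
    have h6 : (1 : ℝ) ≤ 4 ^ n := one_le_pow₀ (by norm_num)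
    rw [pow_succ]
    nlinarith

lemma one_le_vol_mul (o : V) (m : ℕ) : 1 ≤ vol X m * pk X (2 * m) o o := by
  have h1 := hX.sum_pk m o _ subset_rfl
  have h2 := hX.sum_pk_mul_pk m m o o _ subset_rfl
  have h3 := sq_sum_le_card_mul_sum_sq (s := ball X o m) (f := fun z => pk X m o z)
  simp_rw [← sq] at h2
  rwa [h1, h2, hX.card_ball, one_pow, ← two_mul] at h3

lemma vol_mul_le (o : V) (n M : ℕ) :
    vol X n * (pk X (2 * M) o o - 4 ^ n * (2 * deg X * drop X o M)) ≤ 1 := by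
  rw [← hX.sum_pk (2 * M) o (ball X o (n + 2 * M)) (hX.ball_subset_ball o (by omega)),
    ← hX.card_ball o, ← nsmul_eq_mul, ← Finset.sum_const]
  refine le_trans (Finset.sum_le_sum fun y hy => ?_)
    (Finset.sum_le_sum_of_subset_of_nonneg (hX.ball_subset_ball o (by omega : n ≤ n + 2 * M))
      fun y _ _ => pk_nonneg _ _ _)
  have h1 := hX.psi_le_pow o M _ (rfl : X.dist o y = _)
  have h2 : (4 : ℝ) ^ X.dist o y ≤ 4 ^ n := pow_le_pow_right₀ (by norm_num) (hX.mem_ball.mp hy)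
  have hB : 0 ≤ 2 * deg X * drop X o M := mul_nonneg (by positivity) (hX.drop_nonneg o M)
  have h3 := mul_le_mul_of_nonneg_right h2 hB
  rw [psi] at h1
  linarith

lemma exists_ddrop_le (hq : QuadSubseq X) (o : V) (ε : ℝ) (hε : 0 < ε) :
    ∃ m, 0 < drop X o m ∧ ddrop X o m ≤ ε * drop X o m := by
  by_contra! hcon
  set q : ℝ := max (1 - ε) (1 / 2) with hq'
  have hq0 : 0 < q := lt_max_of_lt_right (by norm_num)
  have hq1 : q < 1 := max_lt (by linarith) (by norm_num)
  have hD0 := hX.drop_nonneg o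
  have hstep : ∀ m, drop X o (m + 1) ≤ q * drop X o m := by
    intro m
    have h1 := hX.ddrop_le o m
    rcases (hD0 m).eq_or_lt with h | h
    · have := hX.ddrop_nonneg o m
      rw [← h] at h1 ⊢
      linarith
    · have h2 := hcon m h
      have h3 : (1 - ε) * drop X o m ≤ q * drop X o m :=
        mul_le_mul_of_nonneg_right (le_max_left _ _) h.le
      linarith
  have hpow : ∀ m, drop X o m ≤ q ^ m * drop X o 0 := by
    intro m
    induction m with
    | zero => simp
    | succ m ih =>
      rw [pow_succ']
      have := mul_le_mul_of_nonneg_left ih hq0.le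
      linarith [hstep m]
  set B : ℝ := 2 * drop X o 0 / (1 - q) with hB
  have hB0 : 0 ≤ B := div_nonneg (by linarith [hD0 0]) (by linarith)
  have hBq : B * (1 - q) = 2 * drop X o 0 := div_mul_cancel₀ _ (by linarith)
  have htel : ∀ m k, pk X (2 * m) o o ≤ pk X (2 * (m + k)) o o + B * (q ^ m - q ^ (m + k)) := by
    intro m k
    induction k with
    | zero => simp
    | succ k ih =>
      have h1 := hX.ddrop_nonneg o (m + k)
      have h2 := hpow (m + k)
      have h3 : q ^ (m + (k + 1)) = q * q ^ (m + k) := by rw [← add_assoc, pow_succ']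
      have h4 : B * (q ^ (m + k) - q ^ (m + (k + 1))) = q ^ (m + k) * (2 * drop X o 0) := by
        rw [h3, ← hBq]; ring
      rw [ddrop] at h1
      rw [drop] at h2
      rw [show 2 * (m + (k + 1)) = 2 * (m + k) + 2 by ring]
      linarith
  have hlim : ∀ m, pk X (2 * m) o o ≤ B * q ^ m := by
    intro m
    have h1 : ∀ n : ℕ, vol X n * (pk X (2 * m) o o - B * q ^ m) ≤ 1 := by
      intro n
      have h2 : ∀ k : ℕ, vol X n * (pk X (2 * m) o o - B * q ^ m)
          - vol X n * (4 ^ n * (2 * deg X * (q ^ m * drop X o 0))) * q ^ k ≤ 1 := by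
        intro k
        refine le_trans ?_ (hX.vol_mul_le o n (m + k))
        have h3 := htel m k
        have h4 := hpow (m + k)
        have h5 : 4 ^ n * (2 * deg X * drop X o (m + k))
            ≤ 4 ^ n * (2 * deg X * (q ^ m * drop X o 0)) * q ^ k := by
          calc 4 ^ n * (2 * deg X * drop X o (m + k))
              ≤ 4 ^ n * (2 * deg X * (q ^ (m + k) * drop X o 0)) := by gcongr
            _ = _ := by rw [pow_add]; ring
        have h6 : 0 ≤ B * q ^ (m + k) := by positivity
        rw [mul_assoc, ← mul_sub]
        refine mul_le_mul_of_nonneg_left ?_ (Nat.cast_nonneg _)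
        linarith
      have h3 : Filter.Tendsto (fun k : ℕ => vol X n * (pk X (2 * m) o o - B * q ^ m)
          - vol X n * (4 ^ n * (2 * deg X * (q ^ m * drop X o 0))) * q ^ k) Filter.atTop
          (nhds (vol X n * (pk X (2 * m) o o - B * q ^ m)
          - vol X n * (4 ^ n * (2 * deg X * (q ^ m * drop X o 0))) * 0)) :=
        ((tendsto_pow_atTop_nhds_zero_of_lt_one hq0.le hq1).const_mul _).const_sub _
      have := le_of_tendsto h3 (Filter.Eventually.of_forall h2)
      simpa using this
    by_contra! hlt
    obtain ⟨n, hn⟩ := exists_nat_gt (1 / (pk X (2 * m) o o - B * q ^ m))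
    have hpos : 0 < pk X (2 * m) o o - B * q ^ m := by linarith
    rw [div_lt_iff₀ hpos] at hn
    have h2 : (n : ℝ) ≤ vol X n := by exact_mod_cast (hX.lt_vol n).le
    have h3 := mul_le_mul_of_nonneg_right h2 hpos.le
    linarith [h1 n]
  obtain ⟨C, hC, hvol⟩ := hq
  have hto : Filter.Tendsto (fun m : ℕ => C * B * ((m : ℝ) ^ 2 * q ^ m)) Filter.atTop
      (nhds (C * B * 0)) :=
    (tendsto_pow_const_mul_const_pow_of_lt_one 2 hq0.le hq1).const_mul _
  rw [mul_zero] at hto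
  obtain ⟨T, hT⟩ := (hto.eventually (gt_mem_nhds one_pos)).exists_forall_of_atTop
  obtain ⟨R, hTR, hR⟩ := hvol T
  have h1 := hT R hTR
  have h2 := hX.one_le_vol_mul o R
  have h3 : vol X R * pk X (2 * R) o o ≤ C * R ^ 2 * (B * q ^ R) :=
    mul_le_mul hR (hlim R) (pk_nonneg _ _ _) (by positivity)
  nlinarith

lemma exists_almost_harmonic (hq : QuadSubseq X) (o : V) (ε : ℝ) (hε : 0 < ε) :
    ∃ h : V → ℝ, (∀ x y, X.Adj x y → |h x - h y| ≤ 1) ∧ (∃ s ∈ nbr X o, 1 ≤ |h o - h s|) ∧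
      ∀ x, (lap X h x) ^ 2 ≤ ε := by
  obtain ⟨m, hm, hm'⟩ := hX.exists_ddrop_le hq o ε hε
  obtain ⟨s₀, hs₀⟩ : (nbr X o).Nonempty := by
    rw [← Finset.card_pos, hX.card_nbr]; exact hX.deg_pos
  obtain ⟨s, hs, hmax⟩ := Finset.exists_max_image (nbr X o) (psi X m o) ⟨s₀, hs₀⟩
  have hd := hX.deg_pos'
  have hν : drop X o m ≤ psi X m o s := by
    rw [drop, hX.drop_eq, div_le_iff₀ (by positivity)]
    refine (Finset.sum_le_card_nsmul _ _ _ hmax).trans ?_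
    rw [hX.card_nbr, nsmul_eq_mul]
    nlinarith [mul_nonneg hd.le (hX.psi_nonneg m o s)]
  set ν := 2 * psi X m o s with hνdef
  have hν0 : 0 < ν := by linarith
  have hmax' : ∀ x y, X.Adj x y → 2 * psi X m x y ≤ ν := by
    intro x y h
    obtain ⟨φ, rfl⟩ := hX.trans o x
    obtain ⟨y, rfl⟩ := φ.surjective y
    rw [hX.psi_map]
    linarith [hmax y (hX.mem_nbr.mpr (φ.map_adj_iff.mp h))]
  set h : V → ℝ := fun x => (pk X (2 * m) x o - pk X (2 * m) x s) / ν with hh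
  refine ⟨h, fun x y hxy => ?_, ⟨s, hs, ?_⟩, fun x => ?_⟩
  · set S := ball X x m ∪ ball X y m ∪ (ball X o m ∪ ball X s m)
    have hx : ball X x m ⊆ S := Finset.subset_union_left.trans Finset.subset_union_left
    have hy : ball X y m ⊆ S := Finset.subset_union_right.trans Finset.subset_union_left
    have ho : ball X o m ⊆ S := Finset.subset_union_left.trans Finset.subset_union_right
    have hs : ball X s m ⊆ S := Finset.subset_union_right.trans Finset.subset_union_right
    have h1 := hX.two_psi m x y S hx hy
    have h2 := hX.two_psi m o s S ho hs
    have h3 := Finset.sum_mul_sq_le_sq_mul_sq S (fun z => pk X m x z - pk X m y z)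
      (fun z => pk X m o z - pk X m s z)
    have h4 : h x - h y = (∑ z ∈ S, (pk X m x z - pk X m y z) * (pk X m o z - pk X m s z)) / ν := by
      have e1 := hX.sum_pk_mul_pk m m x o S hx
      have e2 := hX.sum_pk_mul_pk m m x s S hx
      have e3 := hX.sum_pk_mul_pk m m y o S hy
      have e4 := hX.sum_pk_mul_pk m m y s S hy
      rw [← two_mul] at e1 e2 e3 e4
      simp only [hh]
      rw [← sub_div, ← e1, ← e2, ← e3, ← e4, ← Finset.sum_sub_distrib, ← Finset.sum_sub_distrib,
        ← Finset.sum_sub_distrib]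
      congr 1
      exact Finset.sum_congr rfl fun z _ => by ring
    rw [h1, h2] at h3
    rw [h4, abs_div, abs_of_pos hν0, div_le_one hν0]
    refine abs_le_of_sq_le_sq ?_ hν0.le
    refine h3.trans ?_
    rw [sq]
    exact mul_le_mul_of_nonneg_right (hmax' x y hxy) hν0.le
  · have : h o - h s = 1 := by
      simp only [hh]
      rw [← sub_div, div_eq_one_iff_eq hν0.ne', hνdef, psi, hX.pk_self _ s o,
        hX.pk_symm _ s o]
      ring
    rw [this, abs_one]
  · set S := ball X x (m + 1) ∪ (ball X o m ∪ ball X s m)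
    have hx1 : ball X x (m + 1) ⊆ S := Finset.subset_union_left
    have hx : ball X x m ⊆ S := (hX.ball_subset_ball x (by omega)).trans hx1
    have ho : ball X o m ⊆ S := Finset.subset_union_left.trans Finset.subset_union_right
    have hs : ball X s m ⊆ S := Finset.subset_union_right.trans Finset.subset_union_right
    have h1 := hX.sum_sq_eq_ddrop o x m S hx1
    have h2 := hX.two_psi m o s S ho hs
    have h3 := Finset.sum_mul_sq_le_sq_mul_sq S (fun z => pk X m x z - pk X (m + 1) x z)
      (fun z => pk X m o z - pk X m s z)
    have h4 : lap X h x
        = (∑ z ∈ S, (pk X m x z - pk X (m + 1) x z) * (pk X m o z - pk X m s z)) / ν := by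
      have e1 := hX.sum_pk_mul_pk m m x o S hx
      have e2 := hX.sum_pk_mul_pk m m x s S hx
      have e3 := hX.sum_pk_mul_pk (m + 1) m x o S hx1
      have e4 := hX.sum_pk_mul_pk (m + 1) m x s S hx1
      rw [← two_mul] at e1 e2
      rw [show m + 1 + m = 2 * m + 1 by ring, pk_succ] at e3 e4
      have e5 : ∑ z ∈ S, (pk X m x z - pk X (m + 1) x z) * (pk X m o z - pk X m s z)
          = (pk X (2 * m) x o - pk X (2 * m) x s)
          - ((pk X (2 * m) x o / 2 + (∑ z ∈ nbr X x, pk X (2 * m) z o) / (2 * deg X))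
          - (pk X (2 * m) x s / 2 + (∑ z ∈ nbr X x, pk X (2 * m) z s) / (2 * deg X))) := by
        rw [← e3, ← e4, ← e1, ← e2, ← Finset.sum_sub_distrib, ← Finset.sum_sub_distrib,
          ← Finset.sum_sub_distrib]
        exact Finset.sum_congr rfl fun z _ => by ring
      rw [e5]
      simp only [lap, hh]
      rw [← Finset.sum_div, Finset.sum_sub_distrib]
      ring
    rw [h1, h2] at h3
    rw [h4, div_pow, div_le_iff₀ (by positivity)]
    refine h3.trans ?_
    have h5 : ddrop X o m ≤ ε * ν := hm'.trans (by gcongr; linarith)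
    calc ddrop X o m * ν ≤ ε * ν * ν := mul_le_mul_of_nonneg_right h5 hν0.le
      _ = ε * ν ^ 2 := by ring

lemma abs_sub_le_dist (h : V → ℝ) (hl : ∀ x y, X.Adj x y → |h x - h y| ≤ 1) (x y : V) :
    |h x - h y| ≤ X.dist x y := by
  have : ∀ n : ℕ, ∀ y, X.dist x y = n → |h x - h y| ≤ n := by
    intro n
    induction n with
    | zero => intro y hy; rw [hX.dist_eq_zero.mp hy]; simp
    | succ n ih =>
      intro y hy
      obtain ⟨z, h1, h2⟩ := hX.exists_step hy
      have := abs_sub_le (h x) (h z) (h y)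
      push_cast
      linarith [ih z h1, hl z y h2]
  exact this _ y rfl

lemma isHarm_of_lap {h : V → ℝ} (hl : ∀ x, lap X h x = 0) : IsHarm X h := by
  intro x
  have := hl x
  have hd := hX.deg_pos'
  rw [lap, sub_eq_zero] at this
  rw [Finset.sum_sub_distrib, Finset.sum_const, hX.card_nbr, nsmul_eq_mul]
  field_simp at this
  linarith

/-- Existence of a nonconstant Lipschitz harmonic function. -/
lemma exists_harmonic (hq : QuadSubseq X) (o : V) :
    ∃ h : V → ℝ, IsHarm X h ∧ (∀ x y, X.Adj x y → |h x - h y| ≤ 1) ∧ ∃ s, h s ≠ h o := by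
  set K : Set (V → ℝ) := Set.pi Set.univ fun x => Set.Icc (-(X.dist o x : ℝ)) (X.dist o x) with hK
  have hKc : IsCompact K := isCompact_univ_pi fun x => isCompact_Icc
  set Z : ℕ → Set (V → ℝ) := fun n => K ∩ ({h | ∀ x y, X.Adj x y → |h x - h y| ≤ 1} ∩
    {h | 1 ≤ ∑ s ∈ nbr X o, |h o - h s|} ∩ {h | ∀ x, (lap X h x) ^ 2 ≤ 1 / (n + 1)}) with hZ
  have hclosed : ∀ n, IsClosed ({h : V → ℝ | ∀ x y, X.Adj x y → |h x - h y| ≤ 1} ∩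
    {h | 1 ≤ ∑ s ∈ nbr X o, |h o - h s|} ∩ {h | ∀ x, (lap X h x) ^ 2 ≤ 1 / ((n : ℕ) + 1 : ℝ)}) := by
    intro n
    refine (IsClosed.inter ?_ ?_).inter ?_
    · simp only [Set.ofPred_forall]
      refine isClosed_iInter fun x => isClosed_iInter fun y => isClosed_iInter fun _ => ?_
      exact isClosed_le (by fun_prop) continuous_const
    · exact isClosed_le continuous_const (by fun_prop)
    · simp only [Set.ofPred_forall]
      refine isClosed_iInter fun x => ?_
      refine isClosed_le ?_ continuous_const
      unfold lap
      fun_prop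
  have hne : (⋂ n, Z n).Nonempty := by
    refine IsCompact.nonempty_iInter_of_sequence_nonempty_isCompact_isClosed Z ?_ ?_ ?_ ?_
    · rintro n h ⟨h1, h2, h3⟩
      refine ⟨h1, h2, fun x => (h3 x).trans ?_⟩
      push_cast
      gcongr
      linarith
    · intro n
      obtain ⟨h, h1, ⟨s, hs, h2⟩, h3⟩ := hX.exists_almost_harmonic hq o (1 / ((n : ℝ) + 1))
        (by positivity)
      refine ⟨fun x => h x - h o, ?_, ⟨?_, ?_⟩, ?_⟩
      · intro x _
        have := hX.abs_sub_le_dist h h1 o x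
        rw [abs_sub_comm, abs_le] at this
        exact this
      · intro x y hxy
        simpa using h1 x y hxy
      · change 1 ≤ ∑ s ∈ nbr X o, |(h o - h o) - (h s - h o)|
        simp only [sub_sub_sub_cancel_right]
        exact h2.trans (Finset.single_le_sum (f := fun s => |h o - h s|)
          (fun _ _ => abs_nonneg _) hs)
      · intro x
        refine le_of_eq_of_le ?_ (h3 x)
        congr 1
        have hd := hX.deg_pos'
        rw [lap, lap, Finset.sum_sub_distrib, Finset.sum_const, hX.card_nbr, nsmul_eq_mul]
        field_simp
        ring
    · exact hKc.inter_right (hclosed 0)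
    · exact fun n => hKc.isClosed.inter (hclosed n)
  obtain ⟨h, hh⟩ := hne
  rw [Set.mem_iInter] at hh
  refine ⟨h, hX.isHarm_of_lap fun x => ?_, (hh 0).2.1.1, ?_⟩
  · have h1 : ∀ n : ℕ, (lap X h x) ^ 2 ≤ 1 / ((n : ℝ) + 1) := fun n => (hh n).2.2 x
    have h2 := ge_of_tendsto tendsto_one_div_add_atTop_nhds_zero_nat
      (Filter.Eventually.of_forall h1)
    exact pow_eq_zero_iff two_ne_zero |>.mp (le_antisymm h2 (sq_nonneg _))
  · by_contra! hcon
    have h1 : 1 ≤ ∑ s ∈ nbr X o, |h o - h s| := (hh 0).2.1.2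
    simp [hcon] at h1
    linarith

end Homog
end TransGraph

namespace TransGraph
open scoped Classical
open Finset

variable {V : Type*} {X : SimpleGraph V}

/-- The local Dirichlet energy. -/
noncomputable def energy (X : SimpleGraph V) (u : V → ℝ) (a : V) : ℝ :=
  ∑ b ∈ nbr X a, (u b - u a) ^ 2

lemma energy_nonneg (u : V → ℝ) (a : V) : 0 ≤ energy X u a :=
  Finset.sum_nonneg fun _ _ => sq_nonneg _

/-- A maximal `r`-separated subset of a finite set. -/
lemma exists_net (X : SimpleGraph V) (B : Finset V) (r : ℕ) : ∃ Z ⊆ B,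
    (∀ z ∈ Z, ∀ z' ∈ Z, z ≠ z' → r < X.dist z z') ∧ ∀ x ∈ B, ∃ z ∈ Z, X.dist z x ≤ r := by
  induction B using Finset.induction_on with
  | empty => exact ⟨∅, subset_rfl, by simp, by simp⟩
  | insert a B _ ih =>
    obtain ⟨Z, h1, h2, h3⟩ := ih
    by_cases h : ∃ z ∈ Z, X.dist z a ≤ r
    · refine ⟨Z, h1.trans (Finset.subset_insert _ _), h2, fun x hx => ?_⟩
      rcases Finset.mem_insert.mp hx with rfl | hx
      · exact h
      · exact h3 x hx
    · push Not at h
      refine ⟨insert a Z, Finset.insert_subset_insert _ h1, ?_, ?_⟩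
      · intro z hz z' hz' hne
        rcases Finset.mem_insert.mp hz with hz1 | hz1 <;>
          rcases Finset.mem_insert.mp hz' with hz2 | hz2
        · exact absurd (hz1.trans hz2.symm) hne
        · rw [hz1, SimpleGraph.dist_comm]; exact h z' hz2
        · rw [hz2]; exact h z hz1
        · exact h2 z hz1 z' hz2 hne
      · intro x hx
        rcases Finset.mem_insert.mp hx with rfl | hx
        · exact ⟨x, Finset.mem_insert_self _ _, by simp⟩
        · obtain ⟨z, hz, hz'⟩ := h3 x hx
          exact ⟨z, Finset.mem_insert_of_mem hz, hz'⟩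

lemma sum_biUnion_le_sum_sum {ι : Type*} (Z : Finset ι) (t : ι → Finset V) {f : V → ℝ}
    (hf : ∀ x, 0 ≤ f x) : ∑ x ∈ Z.biUnion t, f x ≤ ∑ z ∈ Z, ∑ x ∈ t z, f x := by
  induction Z using Finset.induction_on with
  | empty => simp
  | insert a Z ha ih =>
    rw [Finset.biUnion_insert, Finset.sum_insert ha]
    have h1 := Finset.sum_union_inter (s₁ := t a) (s₂ := Z.biUnion t) (f := f)
    have h2 : 0 ≤ ∑ x ∈ t a ∩ Z.biUnion t, f x := Finset.sum_nonneg fun _ _ => hf _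
    linarith

lemma sum_sum_sub_sq (B : Finset V) (u : V → ℝ) (h : ∑ x ∈ B, u x = 0) :
    ∑ x ∈ B, ∑ y ∈ B, (u x - u y) ^ 2 = 2 * #B * ∑ x ∈ B, u x ^ 2 := by
  have : ∀ x y, (u x - u y) ^ 2 = u x ^ 2 + u y ^ 2 - 2 * u x * u y := fun x y => by ring
  simp_rw [this, Finset.sum_sub_distrib, Finset.sum_add_distrib, ← Finset.mul_sum, h]
  simp only [Finset.sum_const, nsmul_eq_mul, mul_zero, ← Finset.mul_sum]
  ring

namespace Homog
variable (hX : Homog X)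
include hX

lemma pairs_poincare (ham : Amenable X) (R : ℕ) (F : Finset V) (u : V → ℝ) :
    ∑ x ∈ F, ∑ y ∈ ball X x R, (u x - u y) ^ 2 ≤
      R ^ 2 * vol X R * ∑ a ∈ F.biUnion (fun x => ball X x R), energy X u a := by
  have key := hX.sum_pairs_le ham R F (fun x y => (u x - u y) ^ 2 / X.dist x y) (energy X u)
    (fun x => by simp) (energy_nonneg u) (by
      intro x z a hza hd
      have hE : (u z - u a) ^ 2 ≤ energy X u a :=
        Finset.single_le_sum (f := fun b => (u b - u a) ^ 2) (fun _ _ => sq_nonneg _)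
          (hX.mem_nbr.mpr hza.symm)
      rw [← hd]
      rcases Nat.eq_zero_or_pos (X.dist x z) with h0 | h0
      · rw [h0, hX.dist_eq_zero.mp h0]
        simpa using hE
      · have hp : (0 : ℝ) < X.dist x z := by exact_mod_cast h0
        push_cast
        set j : ℝ := ((X.dist x z : ℕ) : ℝ)
        have : (u x - u a) ^ 2 / (j + 1) ≤ (u x - u z) ^ 2 / j + (u z - u a) ^ 2 := by
          rw [div_add' _ _ _ hp.ne', div_le_div_iff₀ (by positivity) hp]
          nlinarith [sq_nonneg ((u x - u z) - j * (u z - u a))]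
        linarith)
  have h1 : ∑ x ∈ F, ∑ y ∈ ball X x R, (u x - u y) ^ 2 ≤
      R * ∑ x ∈ F, ∑ y ∈ ball X x R, (u x - u y) ^ 2 / X.dist x y := by
    rw [Finset.mul_sum]
    refine Finset.sum_le_sum fun x _ => ?_
    rw [Finset.mul_sum]
    refine Finset.sum_le_sum fun y hy => ?_
    rcases Nat.eq_zero_or_pos (X.dist x y) with h0 | h0
    · rw [hX.dist_eq_zero.mp h0]; simp
    · have hp : (0 : ℝ) < X.dist x y := by exact_mod_cast h0
      have hR : (X.dist x y : ℝ) ≤ R := by exact_mod_cast hX.mem_ball.mp hy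
      rw [← mul_div_assoc, le_div_iff₀ hp, mul_comm]
      exact mul_le_mul_of_nonneg_right hR (sq_nonneg _)
  have h2 := mul_le_mul_of_nonneg_left key (Nat.cast_nonneg R : (0 : ℝ) ≤ R)
  refine h1.trans (h2.trans (le_of_eq ?_))
  ring

lemma ball_poincare (ham : Amenable X) (ρ : ℕ) (z : V) (u : V → ℝ)
    (hu : ∑ x ∈ ball X z (2 * ρ), u x = 0) :
    vol X ρ * ∑ x ∈ ball X z (2 * ρ), u x ^ 2 ≤
      8 * ρ ^ 2 * vol X (16 * ρ) * ∑ a ∈ ball X z (6 * ρ), energy X u a := by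
  have h1 := hX.pairs_poincare ham (4 * ρ) (ball X z (2 * ρ)) u
  have h2 := sum_sum_sub_sq _ u hu
  rw [hX.card_ball] at h2
  have h3 : ∑ x ∈ ball X z (2 * ρ), ∑ y ∈ ball X z (2 * ρ), (u x - u y) ^ 2
      ≤ ∑ x ∈ ball X z (2 * ρ), ∑ y ∈ ball X x (4 * ρ), (u x - u y) ^ 2 := by
    refine Finset.sum_le_sum fun x hx => ?_
    refine Finset.sum_le_sum_of_subset_of_nonneg (fun y hy => ?_) fun _ _ _ => sq_nonneg _
    have := hX.mem_ball.mp hx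
    have := hX.mem_ball.mp hy
    have := hX.tri x z y
    rw [X.dist_comm (u := x) (v := z)] at this
    exact hX.mem_ball.mpr (by omega)
  have h4 : ∑ a ∈ (ball X z (2 * ρ)).biUnion (fun x => ball X x (4 * ρ)), energy X u a
      ≤ ∑ a ∈ ball X z (6 * ρ), energy X u a := by
    refine Finset.sum_le_sum_of_subset_of_nonneg (fun y hy => ?_) fun _ _ _ => energy_nonneg _ _
    obtain ⟨x, hx, hy⟩ := Finset.mem_biUnion.mp hy
    have := hX.mem_ball.mp hx
    have := hX.mem_ball.mp hy
    have := hX.tri z x y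
    exact hX.mem_ball.mpr (by omega)
  have hE : 0 ≤ ∑ a ∈ ball X z (6 * ρ), energy X u a :=
    Finset.sum_nonneg fun _ _ => energy_nonneg _ _
  have hQ : 0 ≤ ∑ x ∈ ball X z (2 * ρ), u x ^ 2 := Finset.sum_nonneg fun _ _ => sq_nonneg _
  have h5 : (vol X ρ : ℝ) ≤ vol X (2 * ρ) := by exact_mod_cast hX.vol_mono (by omega)
  have h6 : (vol X (4 * ρ) : ℝ) ≤ vol X (16 * ρ) := by exact_mod_cast hX.vol_mono (by omega)
  have h7 : 2 * (vol X (2 * ρ) : ℝ) * ∑ x ∈ ball X z (2 * ρ), u x ^ 2 ≤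
      ((4 * ρ : ℕ) : ℝ) ^ 2 * vol X (16 * ρ) * ∑ a ∈ ball X z (6 * ρ), energy X u a := by
    rw [← h2]
    refine h3.trans (h1.trans ?_)
    gcongr
    exact Finset.sum_nonneg fun _ _ => energy_nonneg _ _
  push_cast at h7
  have h8 := mul_le_mul_of_nonneg_right h5 hQ
  nlinarith

lemma card_net_mul_le {Z : Finset V} {ρ R : ℕ} {a : V}
    (hZ : ∀ z ∈ Z, ∀ z' ∈ Z, z ≠ z' → 2 * ρ < X.dist z z') (hR : ∀ z ∈ Z, X.dist a z ≤ R) :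
    #Z * vol X ρ ≤ vol X (R + ρ) := by
  have hdisj : (Z : Set V).PairwiseDisjoint fun z => ball X z ρ := by
    intro z hz z' hz' hne
    refine Finset.disjoint_left.mpr fun y hy hy' => ?_
    have h1 := hX.mem_ball.mp hy
    have h2 := hX.mem_ball.mp hy'
    have h3 := hX.tri z y z'
    rw [X.dist_comm (u := y)] at h3
    have := hZ z hz z' hz' hne
    omega
  rw [← hX.card_ball a (R + ρ), ← smul_eq_mul, ← Finset.sum_const,
    ← Finset.sum_congr rfl fun z _ => hX.card_ball z ρ, ← Finset.card_biUnion hdisj]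
  refine Finset.card_le_card fun y hy => ?_
  obtain ⟨z, hz, hy⟩ := Finset.mem_biUnion.mp hy
  have := hX.mem_ball.mp hy
  have := hX.tri a z y
  have := hR z hz
  exact hX.mem_ball.mpr (by omega)

/-- Caccioppoli inequality for harmonic functions. -/
lemma caccioppoli (o : V) (L : ℕ) (hL : 0 < L) (u : V → ℝ) (hu : IsHarm X u) :
    ∑ a ∈ ball X o (L - 1), energy X u a ≤
      deg X / L ^ 2 * ∑ x ∈ ball X o (2 * L + 1), u x ^ 2 := by
  set S := ball X o (2 * L + 1) with hS
  have hL' : (0 : ℝ) < L := by exact_mod_cast hL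
  set es : (V → V → ℝ) → ℝ := fun g => ∑ x ∈ S, ∑ y ∈ S, if X.Adj x y then g x y else 0 with hes
  have es_swap : ∀ g, es g = es fun x y => g y x := by
    intro g
    simp only [hes]
    rw [Finset.sum_comm]
    simp only [X.adj_comm]
  have es_add : ∀ g g', es g + es g' = es fun x y => g x y + g' x y := by
    intro g g'
    simp only [hes, ← Finset.sum_add_distrib]
    refine Finset.sum_congr rfl fun x _ => Finset.sum_congr rfl fun y _ => ?_
    split_ifs <;> simp
  have es_le : ∀ g g' : V → V → ℝ, (∀ x y, X.Adj x y → g x y ≤ g' x y) → es g ≤ es g' := by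
    intro g g' h
    refine Finset.sum_le_sum fun x _ => Finset.sum_le_sum fun y _ => ?_
    split_ifs with hxy
    · exact h x y hxy
    · exact le_rfl
  have nbr_filter : ∀ x ∈ ball X o (2 * L), {y ∈ S | X.Adj x y} = nbr X x := by
    intro x hx
    ext y
    rw [Finset.mem_filter, hX.mem_nbr]
    refine ⟨fun h => h.2, fun h => ⟨?_, h⟩⟩
    have := hX.dist_le_of_adj (x := o) h
    have := hX.mem_ball.mp hx
    exact hX.mem_ball.mpr (by omega)
  set η : V → ℝ := fun x => min 1 (max 0 ((2 * L - X.dist o x) / L)) with hη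
  have hη0 : ∀ x, 2 * L ≤ X.dist o x → η x = 0 := by
    intro x hx
    have : (2 * L : ℝ) ≤ X.dist o x := by exact_mod_cast hx
    simp only [hη]
    rw [max_eq_left (div_nonpos_of_nonpos_of_nonneg (by linarith) hL'.le)]
    simp
  have hη1 : ∀ x, X.dist o x ≤ L → η x = 1 := by
    intro x hx
    have : (X.dist o x : ℝ) ≤ L := by exact_mod_cast hx
    simp only [hη]
    have h1 : 1 ≤ (2 * L - (X.dist o x : ℝ)) / L := by
      rw [le_div_iff₀ hL']; linarith
    rw [max_eq_right (by linarith), min_eq_left h1]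
  have hηl : ∀ x y, X.Adj x y → (η x - η y) ^ 2 ≤ 1 / L ^ 2 := by
    intro x y hxy
    have h1 := hX.dist_le_of_adj (x := o) hxy
    have h2 := hX.dist_le_of_adj (x := o) hxy.symm
    have h1' : (X.dist o y : ℝ) ≤ X.dist o x + 1 := by exact_mod_cast h1
    have h2' : (X.dist o x : ℝ) ≤ X.dist o y + 1 := by exact_mod_cast h2
    have h3 : |η x - η y| ≤ 1 / L := by
      refine (abs_min_sub_min_le_max _ _ _ _).trans ?_
      refine max_le (by simp) ((abs_max_sub_max_le_max _ _ _ _).trans (max_le (by simp) ?_))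
      rw [← sub_div, abs_div, abs_of_pos hL']
      gcongr
      rw [abs_le]
      constructor <;> linarith
    rw [← one_div_pow, ← sq_abs]
    gcongr
  have hharm : es (fun x y => η x ^ 2 * u x * (u x - u y)) = 0 := by
    refine Finset.sum_eq_zero fun x _ => ?_
    by_cases hx : x ∈ ball X o (2 * L)
    · rw [← Finset.sum_filter, nbr_filter x hx, ← Finset.mul_sum]
      have := hu x
      have h2 : ∑ y ∈ nbr X x, (u x - u y) = - ∑ y ∈ nbr X x, (u y - u x) := by
        rw [← Finset.sum_neg_distrib]
        exact Finset.sum_congr rfl fun y _ => by ring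
      rw [h2, this]
      simp
    · rw [hX.mem_ball] at hx
      simp [hη0 x (by omega)]
  have hkey : es (fun x y => (η x * u x - η y * u y) ^ 2)
      = es (fun x y => (η x - η y) ^ 2 * (u x * u y)) := by
    have h1 := es_swap (fun x y => η x ^ 2 * u x * (u x - u y))
    have h2 := es_add (fun x y => η x ^ 2 * u x * (u x - u y))
      (fun y x => η x ^ 2 * u x * (u x - u y))
    rw [← h1, hharm, add_zero] at h2
    have h3 := es_add (fun x y => (η x - η y) ^ 2 * (u x * u y))
      (fun x y => η x ^ 2 * u x * (u x - u y) + η y ^ 2 * u y * (u y - u x))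
    rw [← h2, add_zero] at h3
    rw [h3]
    congr 1
    funext x y
    ring
  have h1 : ∑ a ∈ ball X o (L - 1), energy X u a
      ≤ es (fun x y => (η x * u x - η y * u y) ^ 2) := by
    refine le_trans (Finset.sum_le_sum fun x hx => ?_)
      (Finset.sum_le_sum_of_subset_of_nonneg (hX.ball_subset_ball o (by omega)) ?_)
    · rw [← Finset.sum_filter, nbr_filter x (hX.ball_subset_ball o (by omega) hx)]
      refine Finset.sum_le_sum fun y hy => ?_
      have h2 := hX.mem_ball.mp hx
      have h3 := hX.dist_le_of_adj (x := o) (hX.mem_nbr.mp hy)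
      change (u y - u x) ^ 2 ≤ (η x * u x - η y * u y) ^ 2
      rw [hη1 x (by omega), hη1 y (by omega), one_mul, one_mul]
      exact (sub_sq_comm _ _).le
    · intro x _ _
      refine Finset.sum_nonneg fun y _ => ?_
      split_ifs
      · exact sq_nonneg _
      · exact le_rfl
  have h2 : es (fun x y => (η x - η y) ^ 2 * (u x * u y)) ≤
      es (fun x y => 1 / L ^ 2 * (u x ^ 2 / 2) + 1 / L ^ 2 * (u y ^ 2 / 2)) := by
    refine es_le _ _ fun x y hxy => ?_
    have h3 := hηl x y hxy
    have h4 : u x * u y ≤ u x ^ 2 / 2 + u y ^ 2 / 2 := by nlinarith [sq_nonneg (u x - u y)]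
    have h5 := mul_le_mul_of_nonneg_left h4 (sq_nonneg (η x - η y))
    have h6 := mul_le_mul_of_nonneg_right h3
      (by positivity : 0 ≤ u x ^ 2 / 2 + u y ^ 2 / 2)
    linarith
  have h3 : es (fun x y => 1 / L ^ 2 * (u x ^ 2 / 2) + 1 / L ^ 2 * (u y ^ 2 / 2))
      ≤ deg X / L ^ 2 * ∑ x ∈ S, u x ^ 2 := by
    rw [← es_add, ← es_swap (fun x y => 1 / L ^ 2 * (u x ^ 2 / 2))]
    have h4 : es (fun x y => 1 / L ^ 2 * (u x ^ 2 / 2))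
        ≤ ∑ x ∈ S, deg X * (1 / L ^ 2 * (u x ^ 2 / 2)) := by
      refine Finset.sum_le_sum fun x _ => ?_
      rw [← Finset.sum_filter, Finset.sum_const, nsmul_eq_mul, ← hX.card_nbr x]
      gcongr
      intro y hy
      exact hX.mem_nbr.mpr (Finset.mem_filter.mp hy).2
    have h5 : ∑ x ∈ S, deg X * (1 / L ^ 2 * (u x ^ 2 / 2))
        = deg X / L ^ 2 * (∑ x ∈ S, u x ^ 2) / 2 := by
      rw [Finset.mul_sum, Finset.sum_div]
      exact Finset.sum_congr rfl fun x _ => by ring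
    linarith
  exact h1.trans (hkey.le.trans (h2.trans h3))

/-- A harmonic function with vanishing averages on the members of a suitable net of small balls
has much smaller mean square on a ball than on the four times larger ball. -/
lemma exists_net_decay (ham : Amenable X) (o : V) (ρ R : ℕ) (hρ : 0 < ρ) (hR : 16 * ρ ≤ R) :
    ∃ Z : Finset V, #Z * vol X ρ ≤ vol X (4 * R) ∧ ∀ u : V → ℝ, IsHarm X u →
      (∀ z ∈ Z, ∑ x ∈ ball X z (2 * ρ), u x = 0) →
      ∑ x ∈ ball X o R, u x ^ 2 ≤
        8 * deg X * ((vol X (16 * ρ) : ℝ) / vol X ρ) ^ 2 * ((ρ : ℝ) / R) ^ 2 *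
          ∑ x ∈ ball X o (4 * R), u x ^ 2 := by
  obtain ⟨Z, hZ1, hZ2, hZ3⟩ := exists_net X (ball X o R) (2 * ρ)
  refine ⟨Z, ?_, fun u hu hmean => ?_⟩
  · exact (hX.card_net_mul_le hZ2 fun z hz => hX.mem_ball.mp (hZ1 hz)).trans
      (hX.vol_mono (by omega))
  · have hv : (0 : ℝ) < vol X ρ := by exact_mod_cast hX.vol_pos ρ
    have hR0 : (0 : ℝ) < R := by exact_mod_cast (by omega : 0 < R)
    set κ : ℝ := (vol X (16 * ρ) : ℝ) / vol X ρ with hκ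
    have hκ0 : 0 ≤ κ := by positivity
    have h1 : ∀ z ∈ Z, ∑ x ∈ ball X z (2 * ρ), u x ^ 2
        ≤ 8 * ρ ^ 2 * κ * ∑ a ∈ ball X z (6 * ρ), energy X u a := by
      intro z hz
      have := hX.ball_poincare ham ρ z u (hmean z hz)
      rw [mul_comm, ← le_div_iff₀ hv] at this
      refine this.trans (le_of_eq ?_)
      rw [hκ]; ring
    have h2 : ∑ x ∈ ball X o R, u x ^ 2 ≤ ∑ z ∈ Z, ∑ x ∈ ball X z (2 * ρ), u x ^ 2 := by
      refine (Finset.sum_le_sum_of_subset_of_nonneg (t := Z.biUnion fun z => ball X z (2 * ρ))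
        (fun x hx => ?_) fun _ _ _ => sq_nonneg _).trans ?_
      · obtain ⟨z, hz, hz'⟩ := hZ3 x hx
        exact Finset.mem_biUnion.mpr ⟨z, hz, hX.mem_ball.mpr hz'⟩
      · exact sum_biUnion_le_sum_sum _ _ fun _ => sq_nonneg _
    have h3 : ∑ z ∈ Z, ∑ a ∈ ball X z (6 * ρ), energy X u a
        ≤ κ * ∑ a ∈ ball X o (R + 6 * ρ), energy X u a := by
      have hsub : ∀ z ∈ Z, ball X z (6 * ρ) ⊆ ball X o (R + 6 * ρ) := by
        intro z hz y hy
        have := hX.mem_ball.mp (hZ1 hz)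
        have := hX.mem_ball.mp hy
        have := hX.tri o z y
        exact hX.mem_ball.mpr (by omega)
      calc ∑ z ∈ Z, ∑ a ∈ ball X z (6 * ρ), energy X u a
          = ∑ z ∈ Z, ∑ a ∈ ball X o (R + 6 * ρ),
              if a ∈ ball X z (6 * ρ) then energy X u a else 0 := by
            refine Finset.sum_congr rfl fun z hz => ?_
            rw [← Finset.sum_filter]
            refine Finset.sum_congr ?_ fun _ _ => rfl
            ext a
            rw [Finset.mem_filter]
            exact ⟨fun h => ⟨hsub z hz h, h⟩, fun h => h.2⟩
        _ = ∑ a ∈ ball X o (R + 6 * ρ), ∑ z ∈ Z,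
              if a ∈ ball X z (6 * ρ) then energy X u a else 0 := Finset.sum_comm
        _ ≤ ∑ a ∈ ball X o (R + 6 * ρ), κ * energy X u a := by
            refine Finset.sum_le_sum fun a _ => ?_
            rw [← Finset.sum_filter, Finset.sum_const, nsmul_eq_mul]
            refine mul_le_mul_of_nonneg_right ?_ (energy_nonneg u a)
            rw [hκ, le_div_iff₀ hv]
            have h4 := hX.card_net_mul_le (Z := {z ∈ Z | a ∈ ball X z (6 * ρ)}) (ρ := ρ)
              (R := 6 * ρ) (a := a)
              (fun z hz z' hz' => hZ2 z (Finset.mem_filter.mp hz).1 z' (Finset.mem_filter.mp hz').1)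
              (fun z hz => by
                rw [X.dist_comm]
                exact hX.mem_ball.mp (Finset.mem_filter.mp hz).2)
            exact_mod_cast h4.trans (hX.vol_mono (by omega))
        _ = _ := by rw [Finset.mul_sum]
    have h4 := hX.caccioppoli o (R + 6 * ρ + 1) (by omega) u hu
    rw [Nat.add_sub_cancel] at h4
    have h5 : ∑ x ∈ ball X o (2 * (R + 6 * ρ + 1) + 1), u x ^ 2
        ≤ ∑ x ∈ ball X o (4 * R), u x ^ 2 :=
      Finset.sum_le_sum_of_subset_of_nonneg (hX.ball_subset_ball o (by omega))
        fun _ _ _ => sq_nonneg _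
    have hQ : 0 ≤ ∑ x ∈ ball X o (4 * R), u x ^ 2 := Finset.sum_nonneg fun _ _ => sq_nonneg _
    have h6 : ∑ a ∈ ball X o (R + 6 * ρ), energy X u a
        ≤ deg X / R ^ 2 * ∑ x ∈ ball X o (4 * R), u x ^ 2 := by
      refine h4.trans (mul_le_mul ?_ h5 (Finset.sum_nonneg fun _ _ => sq_nonneg _) (by positivity))
      gcongr
      exact_mod_cast (by omega : R ≤ R + 6 * ρ + 1)
    calc ∑ x ∈ ball X o R, u x ^ 2
        ≤ ∑ z ∈ Z, 8 * ρ ^ 2 * κ * ∑ a ∈ ball X z (6 * ρ), energy X u a :=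
          h2.trans (Finset.sum_le_sum h1)
      _ = 8 * ρ ^ 2 * κ * ∑ z ∈ Z, ∑ a ∈ ball X z (6 * ρ), energy X u a := by
          rw [Finset.mul_sum]
      _ ≤ 8 * ρ ^ 2 * κ * (κ * (deg X / R ^ 2 * ∑ x ∈ ball X o (4 * R), u x ^ 2)) := by
          gcongr
          exact h3.trans (mul_le_mul_of_nonneg_left h6 hκ0)
      _ = _ := by
          rw [div_pow]
          ring

end Homog
end TransGraph

namespace TransGraph
open scoped Classical
open Finset

/-- Finitely many members of a separating family of functionals on a finite-dimensional space
already separate points. -/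
lemma exists_finset_separating {𝕜 W ι : Type*} [Field 𝕜] [AddCommGroup W] [Module 𝕜 W]
    [FiniteDimensional 𝕜 W] (e : ι → W →ₗ[𝕜] 𝕜) (he : ∀ w, (∀ i, e i w = 0) → w = 0) :
    ∃ S : Finset ι, ∀ w, (∀ i ∈ S, e i w = 0) → w = 0 := by
  set k : Finset ι → Submodule 𝕜 W := fun S => ⨅ i ∈ S, LinearMap.ker (e i) with hk
  have hmem : ∀ S w, w ∈ k S ↔ ∀ i ∈ S, e i w = 0 := by
    intro S w; simp [hk, Submodule.mem_iInf]
  set S := Function.argmin (fun S => Module.finrank 𝕜 (k S)) with hS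
  refine ⟨S, fun w hw => he w fun i => ?_⟩
  have hle : k (insert i S) ≤ k S := by
    intro w hw
    rw [hmem] at hw ⊢
    exact fun j hj => hw j (Finset.mem_insert_of_mem hj)
  have heq : k (insert i S) = k S :=
    Submodule.eq_of_le_of_finrank_le hle (Function.argmin_le (fun S => Module.finrank 𝕜 (k S)) _)
  have : w ∈ k (insert i S) := heq ▸ (hmem S w).mpr hw
  exact (hmem _ _).mp this i (Finset.mem_insert_self _ _)

section Matrices
open Matrix
open scoped MatrixOrder ComplexOrder
variable {n : Type*} [Fintype n] [DecidableEq n]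

/-- Simultaneous diagonalisation of a positive definite and a symmetric form. -/
lemma exists_simultaneous_diagonalization {P Q : Matrix n n ℝ} (hP : P.IsHermitian)
    (hQ : Q.PosDef) : ∃ (T : Matrix n n ℝ) (l : n → ℝ),
      Tᵀ * P * T = Matrix.diagonal l ∧ Tᵀ * Q * T = 1 := by
  obtain ⟨B, hB⟩ := CStarAlgebra.nonneg_iff_eq_star_mul_self.mp hQ.posSemidef.nonneg
  rw [Matrix.star_eq_conjTranspose, Matrix.conjTranspose_eq_transpose_of_trivial] at hB
  have hdet : IsUnit B.det := by
    have := hQ.det_pos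
    rw [hB, Matrix.det_mul, Matrix.det_transpose] at this
    exact isUnit_iff_ne_zero.mpr fun h => by simp [h] at this
  have hBB : B * B⁻¹ = 1 := Matrix.mul_nonsing_inv _ hdet
  have hBB' : (B⁻¹)ᵀ * Bᵀ = 1 := by rw [← Matrix.transpose_mul, hBB, Matrix.transpose_one]
  have hS : ((B⁻¹)ᵀ * P * B⁻¹).IsHermitian := by
    have := Matrix.isHermitian_conjTranspose_mul_mul B⁻¹ hP
    rwa [Matrix.conjTranspose_eq_transpose_of_trivial] at this
  set U : Matrix n n ℝ := (hS.eigenvectorUnitary : Matrix n n ℝ) with hU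
  have hUU : Uᵀ * U = 1 := by
    have := (Matrix.mem_unitaryGroup_iff').mp hS.eigenvectorUnitary.2
    rwa [Matrix.star_eq_conjTranspose, Matrix.conjTranspose_eq_transpose_of_trivial] at this
  have hsp : (B⁻¹)ᵀ * P * B⁻¹ = U * Matrix.diagonal hS.eigenvalues * Uᵀ := by
    have := hS.spectral_theorem
    rw [Unitary.conjStarAlgAut_apply] at this
    simpa [Matrix.star_eq_conjTranspose, Matrix.conjTranspose_eq_transpose_of_trivial] using this
  refine ⟨B⁻¹ * U, hS.eigenvalues, ?_, ?_⟩
  · calc (B⁻¹ * U)ᵀ * P * (B⁻¹ * U) = Uᵀ * ((B⁻¹)ᵀ * P * B⁻¹) * U := by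
          simp only [Matrix.transpose_mul, Matrix.mul_assoc]
      _ = (Uᵀ * U) * Matrix.diagonal hS.eigenvalues * (Uᵀ * U) :=
          (congrArg (fun M => Uᵀ * M * U) hsp).trans (by simp only [Matrix.mul_assoc])
      _ = _ := by rw [hUU]; simp
  · calc (B⁻¹ * U)ᵀ * Q * (B⁻¹ * U) = Uᵀ * (((B⁻¹)ᵀ * Bᵀ) * (B * B⁻¹)) * U := by
          rw [hB]; simp only [Matrix.transpose_mul, Matrix.mul_assoc]
      _ = 1 := by rw [hBB, hBB']; simp [hUU]

lemma det_le_pow_mul_det {m : Type*} [Fintype m] {P Q : Matrix n n ℝ} (hP : P.PosSemidef)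
    (hQ : Q.PosDef) (hPQ : ∀ x, x ⬝ᵥ P *ᵥ x ≤ x ⬝ᵥ Q *ᵥ x) {θ : ℝ} (h0 : 0 ≤ θ) (h1 : θ ≤ 1)
    (L : (n → ℝ) →ₗ[ℝ] (m → ℝ)) (hL : ∀ x, L x = 0 → x ⬝ᵥ P *ᵥ x ≤ θ * (x ⬝ᵥ Q *ᵥ x)) :
    P.det ≤ θ ^ (Fintype.card n - Fintype.card m) * Q.det := by
  obtain ⟨T, l, hTP, hTQ⟩ := exists_simultaneous_diagonalization hP.1 hQ
  have form : ∀ (M : Matrix n n ℝ) c, (T *ᵥ c) ⬝ᵥ M *ᵥ (T *ᵥ c) = c ⬝ᵥ (Tᵀ * M * T) *ᵥ c := by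
    intro M c
    rw [← Matrix.mulVec_mulVec, ← Matrix.mulVec_mulVec, Matrix.dotProduct_mulVec c Tᵀ,
      Matrix.vecMul_transpose]
  have formP : ∀ c, (T *ᵥ c) ⬝ᵥ P *ᵥ (T *ᵥ c) = ∑ i, l i * c i ^ 2 := by
    intro c
    rw [form, hTP]
    simp only [dotProduct, Matrix.mulVec_diagonal]
    exact Finset.sum_congr rfl fun i _ => by ring
  have formQ : ∀ c, (T *ᵥ c) ⬝ᵥ Q *ᵥ (T *ᵥ c) = ∑ i, c i ^ 2 := by
    intro c
    rw [form, hTQ, Matrix.one_mulVec]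
    simp only [dotProduct]
    exact Finset.sum_congr rfl fun i _ => by ring
  have hl0 : ∀ i, 0 ≤ l i := by
    intro i
    have := hP.dotProduct_mulVec_nonneg (T *ᵥ Pi.single i 1)
    rw [star_trivial, formP, Finset.sum_eq_single i (by intro j _ hj; simp [hj]) (by simp)] at this
    simpa using this
  have hl1 : ∀ i, l i ≤ 1 := by
    intro i
    have := hPQ (T *ᵥ Pi.single i 1)
    rw [formP, formQ, Finset.sum_eq_single i (by intro j _ hj; simp [hj]) (by simp),
      Finset.sum_eq_single i (by intro j _ hj; simp [hj]) (by simp)] at this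
    simpa using this
  set I : Finset n := {i | θ < l i} with hI
  have hcard : #I ≤ Fintype.card m := by
    set ext : (I → ℝ) →ₗ[ℝ] (n → ℝ) :=
      { toFun := fun c i => if h : i ∈ I then c ⟨i, h⟩ else 0
        map_add' := by intro c d; funext i; by_cases h : i ∈ I <;> simp [h]
        map_smul' := by intro a c; funext i; by_cases h : i ∈ I <;> simp [h] } with hext
    set Φ : (I → ℝ) →ₗ[ℝ] (m → ℝ) := L ∘ₗ (Matrix.mulVecLin T) ∘ₗ ext with hΦ
    have hinj : Function.Injective Φ := by
      rw [← LinearMap.ker_eq_bot, LinearMap.ker_eq_bot']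
      intro c hc
      have h2 := hL (T *ᵥ ext c) hc
      rw [formP, formQ, Finset.mul_sum] at h2
      have h3 : ∀ i ∈ (Finset.univ : Finset n), 0 ≤ l i * ext c i ^ 2 - θ * ext c i ^ 2 := by
        intro i _
        by_cases h : i ∈ I
        · have h4 := (Finset.mem_filter.mp h).2
          nlinarith [sq_nonneg (ext c i)]
        · simp [hext, h]
      have h4 : ∑ i, (l i * ext c i ^ 2 - θ * ext c i ^ 2) = 0 :=
        le_antisymm (by rw [Finset.sum_sub_distrib]; linarith) (Finset.sum_nonneg h3)
      have h5 := (Finset.sum_eq_zero_iff_of_nonneg h3).mp h4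
      funext i
      have h6 := h5 i (Finset.mem_univ _)
      have h7 : ext c i = c i := by simp [hext]
      have h8 := (Finset.mem_filter.mp i.2).2
      rw [h7, ← sub_mul] at h6
      rcases mul_eq_zero.mp h6 with h | h
      · linarith
      · simpa using h
    have := LinearMap.finrank_le_finrank_of_injective hinj
    simpa using this
  have hdetP : T.det ^ 2 * P.det = ∏ i, l i := by
    rw [← Matrix.det_diagonal, ← hTP, Matrix.det_mul, Matrix.det_mul, Matrix.det_transpose]; ring
  have hdetQ : T.det ^ 2 * Q.det = 1 := by
    rw [← Matrix.det_one (n := n), ← hTQ, Matrix.det_mul, Matrix.det_mul, Matrix.det_transpose]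
    ring
  have hT : 0 < T.det ^ 2 := by
    refine lt_of_le_of_ne (sq_nonneg _) fun h => ?_
    rw [← h] at hdetQ; simp at hdetQ
  have hprod : ∏ i, l i ≤ θ ^ (Fintype.card n - Fintype.card m) := by
    have h2 : ∏ i, l i ≤ ∏ i : n, if i ∈ I then 1 else θ := by
      refine Finset.prod_le_prod (fun i _ => hl0 i) fun i _ => ?_
      split_ifs with h
      · exact hl1 i
      · exact not_lt.mp fun h' => h (by simp [hI, h'])
    have h3 : ∏ i : n, (if i ∈ I then (1 : ℝ) else θ) = θ ^ (Fintype.card n - #I) := by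
      rw [Finset.prod_ite, Finset.prod_const_one, one_mul, Finset.prod_const]
      congr 1
      rw [← Finset.card_compl]
      congr 1
      ext i; simp
    rw [h3] at h2
    exact h2.trans (pow_le_pow_of_le_one h0 h1 (by omega))
  have : T.det ^ 2 * P.det ≤ T.det ^ 2 * (θ ^ (Fintype.card n - Fintype.card m) * Q.det) := by
    rw [hdetP, mul_left_comm, hdetQ, mul_one]
    exact hprod
  exact le_of_mul_le_mul_left this hT

lemma det_le_trace_pow {P : Matrix n n ℝ} (hP : P.PosSemidef) :
    P.det ≤ P.trace ^ Fintype.card n := by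
  rw [hP.1.det_eq_prod_eigenvalues, hP.1.trace_eq_sum_eigenvalues]
  simp only [RCLike.ofReal_real_eq_id, id]
  have := hP.eigenvalues_nonneg
  calc ∏ i, hP.1.eigenvalues i ≤ ∏ _i : n, ∑ j, hP.1.eigenvalues j :=
        Finset.prod_le_prod (fun i _ => this i) fun i _ =>
          Finset.single_le_sum (fun j _ => this j) (Finset.mem_univ i)
    _ = _ := by rw [Finset.prod_const, Finset.card_univ]

end Matrices

lemma sum_sub_le_of_monotone {f : ℕ → ℝ} (hf : Monotone f) (k N : ℕ) :
    ∑ j ∈ range N, (f (j + k) - f j) ≤ k * (f (N + k) - f 0) := by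
  induction k with
  | zero => simp
  | succ k ih =>
    have h1 : ∑ j ∈ range N, (f (j + (k + 1)) - f j)
        = ∑ j ∈ range N, (f (j + k) - f j) + ∑ j ∈ range N, (f (j + 1 + k) - f (j + k)) := by
      rw [← Finset.sum_add_distrib]
      refine Finset.sum_congr rfl fun j _ => ?_
      rw [show j + (k + 1) = j + 1 + k by ring]; ring
    have h2 : ∑ j ∈ range N, (f (j + 1 + k) - f (j + k)) = f (N + k) - f (0 + k) :=
      Finset.sum_range_sub (fun j => f (j + k)) N
    have h3 : f (N + k) ≤ f (N + (k + 1)) := hf (by omega)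
    have h4 : f 0 ≤ f (0 + k) := hf (by omega)
    have h5 : (k : ℝ) * (f (N + k) - f 0) ≤ k * (f (N + (k + 1)) - f 0) := by gcongr
    rw [h1, h2]
    push_cast
    linarith

/-- A monotone sequence which is infinitely often below a line grows at most linearly on
suitable windows. -/
lemma exists_window {f : ℕ → ℝ} {A c : ℝ} (j₁ J : ℕ)
    (hmono : ∀ i j, j₁ ≤ i → i ≤ j → f i ≤ f j) (hio : ∀ N, ∃ n ≥ N, f n ≤ A * n + c) :
    ∃ j ≥ j₁, f (j + 2) - f j ≤ 4 * A + 1 ∧ f (j + J + 1) - f j ≤ (4 * A + 1) * (J + 1) ∧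
      f (j + J + 1) - f (j + J) ≤ 4 * A + 1 := by
  by_contra! hcon
  set g : ℕ → ℝ := fun j => f (j₁ + j) with hg
  have hgm : Monotone g := fun a b hab => hmono _ _ (by omega) (by omega)
  have hΨ : ∀ j, 4 * A + 1 ≤ (g (j + 2) - g j) + (g (j + (J + 1)) - g j) / (J + 1) +
      (g (j + J + 1) - g (j + J)) := by
    intro j
    have hJ : (0 : ℝ) < J + 1 := by positivity
    have h1 : 0 ≤ g (j + 2) - g j := sub_nonneg.mpr (hgm (by omega))
    have h2 : 0 ≤ (g (j + (J + 1)) - g j) / (J + 1) :=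
      div_nonneg (sub_nonneg.mpr (hgm (by omega))) hJ.le
    have h3 : 0 ≤ g (j + J + 1) - g (j + J) := sub_nonneg.mpr (hgm (by omega))
    by_contra! h
    have e1 : f (j₁ + j + 2) = g (j + 2) := rfl
    have e2 : f (j₁ + j + J + 1) = g (j + (J + 1)) := by rw [hg]; congr 1; omega
    have e3 : f (j₁ + j + J) = g (j + J) := by rw [hg]; congr 1; omega
    have e4 : f (j₁ + j) = g j := rfl
    have h4 := hcon (j₁ + j) (by omega) (by rw [e1, e4]; linarith) (by
      rw [e2, e4, ← div_le_iff₀ hJ]; linarith)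
    rw [e2, e3] at h4
    change 4 * A + 1 < g (j + J + 1) - g (j + J) at h4
    linarith
  have hsum : ∀ N : ℕ, N * (4 * A + 1) ≤ 4 * (g (N + J + 2) - g 0) := by
    intro N
    have hJ : (0 : ℝ) < J + 1 := by positivity
    have h1 := Finset.sum_le_sum fun j (_ : j ∈ range N) => hΨ j
    rw [Finset.sum_const, Finset.card_range, nsmul_eq_mul, Finset.sum_add_distrib,
      Finset.sum_add_distrib, ← Finset.sum_div] at h1
    have h2 := sum_sub_le_of_monotone hgm 2 N
    have h3 := sum_sub_le_of_monotone hgm (J + 1) N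
    have h4 := Finset.sum_range_sub (fun j => g (j + J)) N
    have h4' : ∑ j ∈ range N, (g (j + J + 1) - g (j + J)) = g (N + J) - g (0 + J) := by
      rw [← h4]
      refine Finset.sum_congr rfl fun j _ => ?_
      rw [show j + J + 1 = j + 1 + J by ring]
    have h5 : (∑ j ∈ range N, (g (j + (J + 1)) - g j)) / (J + 1) ≤ g (N + (J + 1)) - g 0 := by
      rw [div_le_iff₀ hJ]; push_cast at h3; linarith
    have h6 : g (N + 2) ≤ g (N + J + 2) := hgm (by omega)
    have h7 : g (N + (J + 1)) ≤ g (N + J + 2) := hgm (by omega)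
    have h8 : g (N + J) ≤ g (N + J + 2) := hgm (by omega)
    have h9 : g 0 ≤ g (0 + J) := hgm (by omega)
    push_cast at h2
    linarith
  obtain ⟨N₀, hN₀⟩ := exists_nat_gt (4 * A * (j₁ + J + 2) + 4 * c - 4 * g 0)
  obtain ⟨n, hn, hfn⟩ := hio (N₀ + j₁ + J + 2)
  obtain ⟨N, rfl⟩ : ∃ N, n = j₁ + (N + J + 2) := ⟨n - j₁ - J - 2, by omega⟩
  have h1 := hsum N
  have h2 : g (N + J + 2) ≤ A * ((j₁ + (N + J + 2) : ℕ) : ℝ) + c := hfn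
  have h3 : (N₀ : ℝ) ≤ N := by exact_mod_cast (by omega : N₀ ≤ N)
  push_cast at h2
  nlinarith

end TransGraph

namespace TransGraph
open scoped Classical
open Finset

variable {V : Type*} {X : SimpleGraph V}

/-- The space of Lipschitz harmonic functions. -/
def lipHarm (X : SimpleGraph V) (𝕜 : Type*) [RCLike 𝕜] : Submodule 𝕜 (V → 𝕜) where
  carrier := {h | IsHarm X h ∧ ∃ C : ℝ, ∀ x y, X.Adj x y → ‖h x - h y‖ ≤ C}
  zero_mem' := ⟨fun x => by simp, 0, fun x y _ => by simp⟩
  add_mem' := by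
    rintro a b ⟨ha, Ca, ha'⟩ ⟨hb, Cb, hb'⟩
    refine ⟨fun x => ?_, Ca + Cb, fun x y hxy => ?_⟩
    · have := congrArg₂ (· + ·) (ha x) (hb x)
      simp only [← Finset.sum_add_distrib, add_zero] at this
      rw [← this]
      exact Finset.sum_congr rfl fun y _ => by simp only [Pi.add_apply]; ring
    · have : (a + b) x - (a + b) y = (a x - a y) + (b x - b y) := by
        simp only [Pi.add_apply]; ring
      rw [this]
      exact (norm_add_le _ _).trans (add_le_add (ha' x y hxy) (hb' x y hxy))
  smul_mem' := by
    rintro c a ⟨ha, Ca, ha'⟩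
    refine ⟨fun x => ?_, ‖c‖ * Ca, fun x y hxy => ?_⟩
    · have := congrArg (c * ·) (ha x)
      simp only [Finset.mul_sum, mul_zero] at this
      rw [← this]
      exact Finset.sum_congr rfl fun y _ => by simp only [Pi.smul_apply, smul_eq_mul]; ring
    · have : (c • a) x - (c • a) y = c * (a x - a y) := by
        simp only [Pi.smul_apply, smul_eq_mul]; ring
      rw [this, norm_mul]
      exact mul_le_mul_of_nonneg_left (ha' x y hxy) (norm_nonneg _)

/-- The Gram matrix of a family of functions on a ball. -/
noncomputable def gram (X : SimpleGraph V) (o : V) {D : ℕ} (u : Fin D → V → ℝ) (R : ℕ) :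
    Matrix (Fin D) (Fin D) ℝ :=
  .of fun i j => ∑ x ∈ ball X o R, u i x * u j x

lemma gram_form {D : ℕ} (u : Fin D → V → ℝ) (o : V) (R : ℕ) (c : Fin D → ℝ) :
    c ⬝ᵥ (gram X o u R).mulVec c = ∑ x ∈ ball X o R, (∑ i, c i * u i x) ^ 2 := by
  simp only [dotProduct, Matrix.mulVec, gram, Matrix.of_apply, Finset.sum_mul, Finset.mul_sum, sq]
  rw [Finset.sum_congr rfl fun i _ => Finset.sum_comm, Finset.sum_comm]
  exact Finset.sum_congr rfl fun x _ => Finset.sum_congr rfl fun i _ =>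
    Finset.sum_congr rfl fun j _ => by ring

lemma gram_isHermitian {D : ℕ} (u : Fin D → V → ℝ) (o : V) (R : ℕ) :
    (gram X o u R).IsHermitian := by
  ext i j
  simp [gram, mul_comm]

lemma gram_posSemidef {D : ℕ} (u : Fin D → V → ℝ) (o : V) (R : ℕ) :
    (gram X o u R).PosSemidef :=
  Matrix.PosSemidef.of_dotProduct_mulVec_nonneg (gram_isHermitian u o R) fun c => by
    rw [star_trivial, gram_form]; exact Finset.sum_nonneg fun _ _ => sq_nonneg _

namespace Homog
variable (hX : Homog X)
include hX

lemma norm_sub_le_dist {E : Type*} [SeminormedAddCommGroup E] {h : V → E} {C : ℝ}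
    (hh : ∀ x y, X.Adj x y → ‖h x - h y‖ ≤ C) (x y : V) : ‖h x - h y‖ ≤ C * X.dist x y := by
  induction hn : X.dist x y generalizing y with
  | zero => simp [hX.dist_eq_zero.mp hn]
  | succ n ih =>
    obtain ⟨z, hz1, hz2⟩ := hX.exists_between hn
    have h1 := ih z hz1
    have h2 := hh z y (SimpleGraph.dist_eq_one_iff_adj.mp hz2)
    have h3 : h x - h y = (h x - h z) + (h z - h y) := by abel
    rw [h3]
    push_cast
    linarith [norm_add_le (h x - h z) (h z - h y)]

lemma exists_gram_posDef {D : ℕ} (u : Fin D → V → ℝ) (hli : LinearIndependent ℝ u) (o : V) :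
    ∃ R₀, ∀ R, R₀ ≤ R → (gram X o u R).PosDef := by
  obtain ⟨S, hS⟩ := exists_finset_separating
    (fun x => (LinearMap.proj x : (V → ℝ) →ₗ[ℝ] ℝ) ∘ₗ (Fintype.linearCombination ℝ u))
    (fun c hc => by
      have : Fintype.linearCombination ℝ u c = 0 := funext hc
      exact funext (Fintype.linearIndependent_iff.mp hli c (by
        simpa [Fintype.linearCombination_apply] using this)))
  replace hS : ∀ c : Fin D → ℝ, (∀ x ∈ S, ∑ i, c i * u i x = 0) → c = 0 := by
    intro c hc
    refine hS c fun x hx => ?_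
    have := hc x hx
    simpa [Fintype.linearCombination_apply, Finset.sum_apply] using this
  refine ⟨S.sup fun x => X.dist o x, fun R hR =>
    Matrix.PosDef.of_dotProduct_mulVec_pos (gram_isHermitian u o R) fun c hc => ?_⟩
  rw [star_trivial, gram_form]
  refine lt_of_le_of_ne (Finset.sum_nonneg fun _ _ => sq_nonneg _) fun h => hc (hS c ?_)
  intro x hx
  have h1 := (Finset.sum_eq_zero_iff_of_nonneg fun _ _ => sq_nonneg _).mp h.symm x
    (hX.mem_ball.mpr ((Finset.le_sup (f := fun x => X.dist o x) hx).trans hR))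
  simpa using h1

lemma gram_form_mono {D : ℕ} (u : Fin D → V → ℝ) (o : V) {R R' : ℕ} (h : R ≤ R')
    (c : Fin D → ℝ) :
    c ⬝ᵥ (gram X o u R).mulVec c ≤ c ⬝ᵥ (gram X o u R').mulVec c := by
  rw [gram_form, gram_form]
  exact Finset.sum_le_sum_of_subset_of_nonneg (hX.ball_subset_ball o h) fun _ _ _ => sq_nonneg _

lemma gram_det_mono {D : ℕ} (u : Fin D → V → ℝ) (o : V) {R R' : ℕ} (h : R ≤ R')
    (hpd : (gram X o u R').PosDef) : (gram X o u R).det ≤ (gram X o u R').det := by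
  have := det_le_pow_mul_det (m := Fin 0) (gram_posSemidef (X := X) u o R) hpd (hX.gram_form_mono u o h)
    zero_le_one le_rfl 0 (fun c _ => by rw [one_mul]; exact hX.gram_form_mono u o h c)
  simpa using this

/-- The growth of Gram determinants of Lipschitz functions. -/
lemma exists_gram_growth (hq : QuadSubseq X) {D : ℕ} (hD : 0 < D) (u : Fin D → V → ℝ)
    (hu : ∀ i, u i ∈ lipHarm X ℝ) (o : V) (R₀ : ℕ)
    (hpd : ∀ R, R₀ ≤ R → (gram X o u R).PosDef) :
    ∃ c : ℝ, ∀ N : ℕ, ∃ n : ℕ, n ≥ N ∧ Real.log (vol X (4 ^ n)) + Real.log (gram X o u (4 ^ n)).det / D ≤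
      6 * Real.log 4 * n + c := by
  have hD' : (0 : ℝ) < D := by exact_mod_cast hD
  obtain ⟨Cq, hCq, hq⟩ := hq
  have hbd : ∃ C : ℝ, 0 < C ∧ ∀ i x, |u i x| ≤ C * (X.dist o x + 1) := by
    choose Ci hCi using fun i => (hu i).2
    refine ⟨1 + ∑ i, (|Ci i| + |u i o|), by positivity, fun i x => ?_⟩
    have h1 := hX.norm_sub_le_dist (hCi i) o x
    rw [Real.norm_eq_abs, abs_sub_comm] at h1
    have h2 : |u i x| ≤ |u i x - u i o| + |u i o| := by
      have := abs_add_le (u i x - u i o) (u i o)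
      simpa using this
    have h3 : |Ci i| + |u i o| ≤ ∑ i, (|Ci i| + |u i o|) :=
      Finset.single_le_sum (f := fun i => |Ci i| + |u i o|) (fun _ _ => by positivity)
        (Finset.mem_univ i)
    have h4 := le_abs_self (Ci i)
    have h5 : (0 : ℝ) ≤ X.dist o x := by positivity
    have h6 := abs_nonneg (u i o)
    have h7 := abs_nonneg (Ci i)
    nlinarith
  obtain ⟨C, hC, hbd⟩ := hbd
  refine ⟨2 * Real.log (16 * Cq) + Real.log (4 * C ^ 2 * D), fun N => ?_⟩
  obtain ⟨R, hR, hRq⟩ := hq (4 ^ max N R₀)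
  obtain ⟨n, hn1, hn2⟩ : ∃ n, 4 ^ n ≤ R ∧ R < 4 ^ (n + 1) :=
    ⟨Nat.log 4 R, Nat.pow_log_le_self 4 (by
      have : 0 < 4 ^ max N R₀ := by positivity
      omega), Nat.lt_pow_succ_log_self (by norm_num) R⟩
  have hn3 : max N R₀ ≤ n := by
    have := (Nat.pow_lt_pow_iff_right (a := 4) (by norm_num)).mp (hR.trans_lt hn2)
    omega
  refine ⟨n, (le_max_left _ _).trans hn3, ?_⟩
  have hv : (0 : ℝ) < vol X (4 ^ n) := by exact_mod_cast hX.vol_pos _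
  have hvol : (vol X (4 ^ n) : ℝ) ≤ 16 * Cq * (4 ^ n) ^ 2 := by
    have h1 : (vol X (4 ^ n) : ℝ) ≤ vol X R := by exact_mod_cast hX.vol_mono hn1
    have h2 : (R : ℝ) ≤ 4 ^ n * 4 := by
      rw [← pow_succ]; exact_mod_cast hn2.le
    have h3 : (R : ℝ) ^ 2 ≤ (4 ^ n * 4) ^ 2 := by gcongr
    calc (vol X (4 ^ n) : ℝ) ≤ Cq * R ^ 2 := h1.trans hRq
      _ ≤ Cq * (4 ^ n * 4) ^ 2 := by gcongr
      _ = _ := by ring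
  have htr : (gram X o u (4 ^ n)).trace ≤ 4 * C ^ 2 * D * ((4 ^ n) ^ 2 * vol X (4 ^ n)) := by
    have h1 : ∀ i, gram X o u (4 ^ n) i i ≤ vol X (4 ^ n) * (C * (2 * 4 ^ n)) ^ 2 := by
      intro i
      simp only [gram, Matrix.of_apply]
      rw [← hX.card_ball o, ← nsmul_eq_mul, ← Finset.sum_const]
      refine Finset.sum_le_sum fun x hx => ?_
      rw [← sq, ← sq_abs]
      have h2 : (X.dist o x : ℝ) ≤ 4 ^ n := by exact_mod_cast hX.mem_ball.mp hx
      have h3 : (1 : ℝ) ≤ 4 ^ n := one_le_pow₀ (by norm_num)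
      have h4 := hbd i x
      have h5 : |u i x| ≤ C * (2 * 4 ^ n) :=
        h4.trans (mul_le_mul_of_nonneg_left (by linarith) hC.le)
      gcongr
    calc (gram X o u (4 ^ n)).trace = ∑ i, gram X o u (4 ^ n) i i := rfl
      _ ≤ ∑ _i : Fin D, vol X (4 ^ n) * (C * (2 * 4 ^ n)) ^ 2 :=
        Finset.sum_le_sum fun i _ => h1 i
      _ = _ := by simp; ring
  have hdpos : 0 < (gram X o u (4 ^ n)).det :=
    (hpd _ (((le_max_right _ _).trans hn3).trans (Nat.lt_pow_self (by norm_num)).le)).det_pos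
  have h1 : Real.log (gram X o u (4 ^ n)).det / D ≤
      Real.log (4 * C ^ 2 * D * ((4 ^ n) ^ 2 * vol X (4 ^ n))) := by
    rw [div_le_iff₀ hD', mul_comm, ← Real.log_pow]
    refine Real.log_le_log hdpos ?_
    have := det_le_trace_pow (gram_posSemidef (X := X) u o (4 ^ n))
    rw [Fintype.card_fin] at this
    refine this.trans (pow_le_pow_left₀ ?_ htr D)
    exact Finset.sum_nonneg fun i _ => Finset.sum_nonneg fun x _ => mul_self_nonneg _
  rw [Real.log_mul (by positivity) (by positivity), Real.log_mul (by positivity) hv.ne',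
    Real.log_pow, Real.log_pow] at h1
  have h2 := Real.log_le_log hv hvol
  rw [Real.log_mul (by positivity) (by positivity), Real.log_pow, Real.log_pow] at h2
  push_cast at h1 h2
  linarith

/-- One comparison step between concentric balls bounds the dimension. -/
lemma card_le_of_gram_step (ham : Amenable X) {D : ℕ} (u : Fin D → V → ℝ)
    (hu : ∀ i, u i ∈ lipHarm X ℝ) (o : V) {B : ℝ} (hB : 0 < B) {M j J : ℕ} (hJ2 : 2 ≤ J)
    (hJ : 8 * deg X * Real.exp (4 * B) ≤ 16 ^ J)
    (hpd : (gram X o u (4 ^ (j + J))).PosDef) (hpd' : (gram X o u (4 ^ (j + J + 1))).PosDef)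
    (hκ : (vol X (16 * 4 ^ j) : ℝ) / vol X (4 ^ j) ≤ Real.exp B)
    (hratio : (vol X (4 ^ (j + J + 1)) : ℝ) / vol X (4 ^ j) ≤ M)
    (hdr : Real.log (gram X o u (4 ^ (j + J + 1))).det -
      Real.log (gram X o u (4 ^ (j + J))).det ≤ B * D) : D ≤ 2 * M := by
  have hv : (0 : ℝ) < vol X (4 ^ j) := by exact_mod_cast hX.vol_pos _
  obtain ⟨Z, hZ, hdec⟩ := hX.exists_net_decay ham o (4 ^ j) (4 ^ (j + J)) (by positivity) (by
    rw [show 16 * 4 ^ j = 4 ^ (j + 2) by ring]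
    exact Nat.pow_le_pow_right (by norm_num) (by omega))
  rw [show 4 * 4 ^ (j + J) = 4 ^ (j + J + 1) by ring] at hZ hdec
  have hZM : #Z ≤ M := by
    have h1 : (#Z : ℝ) ≤ vol X (4 ^ (j + J + 1)) / vol X (4 ^ j) := by
      rw [le_div_iff₀ hv]; exact_mod_cast hZ
    exact_mod_cast h1.trans hratio
  by_contra! hDM
  have hθ : 8 * (deg X : ℝ) * ((vol X (16 * 4 ^ j) : ℝ) / vol X (4 ^ j)) ^ 2 *
      (((4 ^ j : ℕ) : ℝ) / ((4 ^ (j + J) : ℕ) : ℝ)) ^ 2 ≤ Real.exp (-2 * B) := by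
    have h1 : (((4 ^ j : ℕ) : ℝ) / ((4 ^ (j + J) : ℕ) : ℝ)) ^ 2 = 1 / 16 ^ J := by
      push_cast
      rw [pow_add, div_mul_eq_div_div, div_self (by positivity), div_pow, one_pow, ← pow_mul,
        mul_comm, pow_mul]
      norm_num
    rw [h1, mul_one_div, div_le_iff₀ (by positivity)]
    calc 8 * (deg X : ℝ) * ((vol X (16 * 4 ^ j) : ℝ) / vol X (4 ^ j)) ^ 2
        ≤ 8 * (deg X : ℝ) * Real.exp B ^ 2 := by gcongr
      _ = Real.exp (-2 * B) * (8 * deg X * Real.exp (4 * B)) := by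
          rw [mul_left_comm, ← Real.exp_add, ← Real.exp_nat_mul]
          congr 2; push_cast; ring
      _ ≤ Real.exp (-2 * B) * 16 ^ J := by gcongr
  set L : (Fin D → ℝ) →ₗ[ℝ] (Z → ℝ) :=
    { toFun := fun c z => ∑ x ∈ ball X (z : V) (2 * 4 ^ j), ∑ i, c i * u i x
      map_add' := by
        intro c d; funext z
        simp only [Pi.add_apply, add_mul, Finset.sum_add_distrib]
      map_smul' := by
        intro a c; funext z
        simp only [Pi.smul_apply, smul_eq_mul, mul_assoc, Finset.mul_sum, RingHom.id_apply] }
    with hL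
  have hmain := det_le_pow_mul_det (gram_posSemidef (X := X) u o (4 ^ (j + J))) hpd'
    (hX.gram_form_mono u o (Nat.pow_le_pow_right (by norm_num) (by omega)))
    (Real.exp_pos (-2 * B)).le (Real.exp_le_one_iff.mpr (by linarith)) L
    (by
      intro c hc0
      rw [gram_form, gram_form]
      have hcl : (fun x => ∑ i, c i * u i x) ∈ lipHarm X ℝ := by
        have : (fun x => ∑ i, c i * u i x) = ∑ i, c i • u i := by
          funext x; simp [Finset.sum_apply]
        rw [this]
        exact Submodule.sum_mem _ fun i _ => Submodule.smul_mem _ _ (hu i)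
      refine (hdec _ hcl.1 fun z hz => congrFun hc0 ⟨z, hz⟩).trans ?_
      exact mul_le_mul_of_nonneg_right hθ (Finset.sum_nonneg fun _ _ => sq_nonneg _))
  rw [Fintype.card_fin, Fintype.card_coe, ← Real.exp_nat_mul] at hmain
  have h1 := Real.log_le_log hpd.det_pos hmain
  rw [Real.log_mul (Real.exp_pos _).ne' hpd'.det_pos.ne', Real.log_exp,
    Nat.cast_sub (by omega)] at h1
  have h2 : (#Z : ℝ) ≤ M := by exact_mod_cast hZM
  have h3 : 2 * (M : ℝ) < D := by exact_mod_cast hDM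
  nlinarith

lemma card_le_of_linearIndependent (hq : QuadSubseq X) (ham : Amenable X) :
    ∃ M : ℕ, ∀ (D : ℕ) (u : Fin D → V → ℝ), LinearIndependent ℝ u →
      (∀ i, u i ∈ lipHarm X ℝ) → D ≤ M := by
  obtain ⟨o⟩ : Nonempty V := hX.nonempty
  set A : ℝ := 6 * Real.log 4 with hA
  have hA0 : 0 ≤ A := by positivity
  set B : ℝ := 4 * A + 1 with hB
  have hB0 : 0 < B := by positivity
  obtain ⟨J, hJ2, hJ⟩ : ∃ J : ℕ, 2 ≤ J ∧ 8 * deg X * Real.exp (4 * B) ≤ 16 ^ J := by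
    obtain ⟨J, hJ⟩ := pow_unbounded_of_one_lt (8 * deg X * Real.exp (4 * B))
      (by norm_num : (1 : ℝ) < 16)
    exact ⟨J + 2, by omega, hJ.le.trans (pow_le_pow_right₀ (by norm_num) (by omega))⟩
  obtain ⟨M, hM⟩ := exists_nat_gt (Real.exp (B * (J + 1)))
  refine ⟨2 * M, fun D u hli hu => ?_⟩
  rcases Nat.eq_zero_or_pos D with rfl | hD
  · omega
  have hD' : (0 : ℝ) < D := by exact_mod_cast hD
  obtain ⟨R₀, hpd⟩ := hX.exists_gram_posDef u hli o
  obtain ⟨c, hc⟩ := hX.exists_gram_growth hq hD u hu o R₀ hpd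
  have hvpos : ∀ r, (0 : ℝ) < vol X r := fun r => by exact_mod_cast hX.vol_pos r
  have hj₁ : ∀ j, R₀ ≤ j → R₀ ≤ 4 ^ j := fun j hj =>
    hj.trans (Nat.lt_pow_self (by norm_num)).le
  have hlv : ∀ i j, i ≤ j → Real.log (vol X (4 ^ i)) ≤ Real.log (vol X (4 ^ j)) := fun i j h =>
    Real.log_le_log (hvpos _) (by exact_mod_cast hX.vol_mono (Nat.pow_le_pow_right (by norm_num) h))
  have hld : ∀ i j, R₀ ≤ i → i ≤ j → Real.log (gram X o u (4 ^ i)).det / D ≤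
      Real.log (gram X o u (4 ^ j)).det / D := fun i j h h' =>
    div_le_div_of_nonneg_right (Real.log_le_log (hpd _ (hj₁ i h)).det_pos
      (hX.gram_det_mono u o (Nat.pow_le_pow_right (by norm_num) h')
        (hpd _ (hj₁ j (h.trans h'))))) hD'.le
  obtain ⟨j, hj, hw1, hw2, hw3⟩ := exists_window
    (f := fun n => Real.log (vol X (4 ^ n)) + Real.log (gram X o u (4 ^ n)).det / D) R₀ J
    (A := A) (fun i j hi hij => add_le_add (hlv i j hij) (hld i j hi hij)) hc
  refine hX.card_le_of_gram_step ham u hu o hB0 hJ2 hJ (j := j) (hpd _ (hj₁ _ (by omega)))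
    (hpd _ (hj₁ _ (by omega))) ?_ (le_trans ?_ hM.le) ?_
  · rw [← Real.log_le_iff_le_exp (div_pos (hvpos _) (hvpos _)),
      Real.log_div (hvpos _).ne' (hvpos _).ne', show 16 * 4 ^ j = 4 ^ (j + 2) by ring]
    have := hld j (j + 2) hj (by omega)
    linarith
  · rw [← Real.log_le_iff_le_exp (div_pos (hvpos _) (hvpos _)),
      Real.log_div (hvpos _).ne' (hvpos _).ne']
    have := hld j (j + J + 1) hj (by omega)
    linarith
  · rw [← div_le_iff₀ hD', sub_div]
    have := hlv (j + J) (j + J + 1) (by omega)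
    linarith

lemma finiteDimensional_lipHarm_real (hq : QuadSubseq X) (ham : Amenable X) :
    FiniteDimensional ℝ (lipHarm X ℝ) := by
  obtain ⟨M, hM⟩ := hX.card_le_of_linearIndependent hq ham
  have h1 : Module.rank ℝ (lipHarm X ℝ) ≤ M := by
    refine rank_le fun s hs => ?_
    set e := s.equivFin with he
    refine hM #s (fun i => ((e.symm i : lipHarm X ℝ) : V → ℝ)) ?_ fun i => (e.symm i).1.2
    have h2 := (hs.map' (lipHarm X ℝ).subtype (Submodule.ker_subtype _)).comp _ e.symm.injective
    exact h2
  exact Module.finite_def.mpr ((Module.rank_lt_aleph0_iff.mp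
    (h1.trans_lt Cardinal.natCast_lt_aleph0)).1)

lemma finiteDimensional_lipHarm (hq : QuadSubseq X) (ham : Amenable X) :
    FiniteDimensional ℂ (lipHarm X ℂ) := by
  have := hX.finiteDimensional_lipHarm_real hq ham
  have hre : ∀ u ∈ lipHarm X ℂ, (fun x => (u x).re) ∈ lipHarm X ℝ := by
    rintro u ⟨h1, C, h2⟩
    refine ⟨fun x => ?_, C, fun x y hxy => ?_⟩
    · have := congrArg Complex.re (h1 x)
      simpa using this
    · exact (Complex.abs_re_le_norm (u x - u y)).trans (h2 x y hxy)
  have him : ∀ u ∈ lipHarm X ℂ, (fun x => (u x).im) ∈ lipHarm X ℝ := by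
    rintro u ⟨h1, C, h2⟩
    refine ⟨fun x => ?_, C, fun x y hxy => ?_⟩
    · have := congrArg Complex.im (h1 x)
      simpa using this
    · exact (Complex.abs_im_le_norm (u x - u y)).trans (h2 x y hxy)
  set Φ : lipHarm X ℂ →ₗ[ℝ] lipHarm X ℝ × lipHarm X ℝ :=
    { toFun := fun u => (⟨_, hre u u.2⟩, ⟨_, him u u.2⟩)
      map_add' := by intro u v; ext x <;> simp
      map_smul' := by intro c u; ext x <;> simp } with hΦ
  have hinj : Function.Injective Φ := by
    intro u v huv
    ext x
    have h1 := congrArg (fun p => (p.1 : V → ℝ) x) huv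
    have h2 := congrArg (fun p => (p.2 : V → ℝ) x) huv
    exact Complex.ext h1 h2
  have : Module.Finite ℝ (lipHarm X ℂ) := Module.Finite.of_injective Φ hinj
  exact Module.Finite.of_restrictScalars_finite ℝ ℂ _

end Homog
end TransGraph

namespace TransGraph
open scoped Classical
open Finset

section Growth
variable {G Y : Type*} [Group G]

/-- A length function on a group. -/
structure IsLength (l : G → ℕ) : Prop where
  one : l 1 = 0
  mul_le : ∀ g h, l (g * h) ≤ l g + l h
  inv : ∀ g, l g⁻¹ = l g

/-- The map `F` takes, for infinitely many `R`, at most `C * R ^ 2` values on the elements of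
length at most `R`. -/
def Slow (l : G → ℕ) (F : G → Y) : Prop :=
  ∃ C : ℝ, 0 < C ∧ ∀ N : ℕ, ∃ R : ℕ, N ≤ R ∧ (F '' {g | l g ≤ R}).Finite ∧
    ((F '' {g | l g ≤ R}).ncard : ℝ) ≤ C * R ^ 2

/-- The product `g 0 ^ a 0 * g 1 ^ a 1 * ⋯` with `m` factors. -/
def powProd (g : ℕ → G) (a : ℕ → ℕ) : ℕ → G
  | 0 => 1
  | m + 1 => g 0 ^ a 0 * powProd (fun i => g (i + 1)) (fun i => a (i + 1)) m

lemma IsLength.pow_le {l : G → ℕ} (hl : IsLength l) (g : G) (n : ℕ) : l (g ^ n) ≤ n * l g := by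
  induction n with
  | zero => simp [hl.one]
  | succ n ih =>
    rw [pow_succ]
    have := hl.mul_le (g ^ n) g
    linarith [add_mul n 1 (l g)]

lemma IsLength.powProd_le {l : G → ℕ} (hl : IsLength l) (m : ℕ) : ∀ (g : ℕ → G) (a : ℕ → ℕ)
    (B : ℕ), (∀ i, l (g i) ≤ B * 2 ^ i) → (∀ i, a i ≤ 4) →
    l (powProd g a m) + 4 * B ≤ 4 * B * 2 ^ m := by
  induction m with
  | zero => intro g a B _ _; simp [powProd, hl.one]
  | succ m ih =>
    intro g a B hg ha
    have h1 := ih (fun i => g (i + 1)) (fun i => a (i + 1)) (2 * B)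
      (fun i => (hg (i + 1)).trans (by rw [pow_succ]; linarith)) (fun i => ha (i + 1))
    have h2 := hl.mul_le (g 0 ^ a 0) (powProd (fun i => g (i + 1)) (fun i => a (i + 1)) m)
    have h3 := hl.pow_le (g 0) (a 0)
    have h4 : a 0 * l (g 0) ≤ 4 * B := Nat.mul_le_mul (ha 0) (by simpa using hg 0)
    have h5 : 4 * (2 * B) * 2 ^ m = 4 * B * 2 ^ (m + 1) := by ring
    simp only [powProd]
    omega

/-- A pseudo-length on a group, with real values. -/
structure IsPseudoLength (N : G → ℝ) : Prop where
  one : N 1 = 0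
  mul_le : ∀ g h, N (g * h) ≤ N g + N h
  inv : ∀ g, N g⁻¹ = N g

lemma IsPseudoLength.pow_le {N : G → ℝ} (hN : IsPseudoLength N) (g : G) (n : ℕ) :
    N (g ^ n) ≤ n * N g := by
  induction n with
  | zero => simp [hN.one]
  | succ n ih =>
    rw [pow_succ]
    have := hN.mul_le (g ^ n) g
    push_cast
    linarith

/-- A sequence of elements of rapidly decreasing size, whose small powers are not too small. -/
structure IsChain (N : G → ℝ) (g : ℕ → G) : Prop where
  pos : ∀ i, 0 < N (g i)
  decay : ∀ i, N (g (i + 1)) ≤ N (g i) / 40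
  pow : ∀ i e, 1 ≤ e → e ≤ 4 → N (g i) / 2 ≤ N (g i ^ e)

lemma IsChain.tail {N : G → ℝ} {g : ℕ → G} (h : IsChain N g) : IsChain N fun i => g (i + 1) :=
  ⟨fun _ => h.pos _, fun _ => h.decay _, fun _ => h.pow _⟩

lemma IsChain.powProd_le {N : G → ℝ} (hN : IsPseudoLength N) (m : ℕ) : ∀ (g : ℕ → G) (a : ℕ → ℕ),
    IsChain N g → (∀ i, a i ≤ 4) → N (powProd g a m) ≤ 160 / 39 * N (g 0) := by
  induction m with
  | zero =>
    intro g a hg _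
    have := hg.pos 0
    simp only [powProd, hN.one]; positivity
  | succ m ih =>
    intro g a hg ha
    have h1 := ih _ (fun i => a (i + 1)) hg.tail fun i => ha (i + 1)
    have h2 := hN.mul_le (g 0 ^ a 0) (powProd (fun i => g (i + 1)) (fun i => a (i + 1)) m)
    have h3 := hN.pow_le (g 0) (a 0)
    have h4 : (a 0 : ℝ) ≤ 4 := by exact_mod_cast ha 0
    have h5 := hg.pos 0
    have h6 := hg.decay 0
    have h7 : (a 0 : ℝ) * N (g 0) ≤ 4 * N (g 0) := by gcongr
    simp only [zero_add] at h1 h6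
    simp only [powProd]
    linarith

lemma IsChain.powProd_ne {N : G → ℝ} (hN : IsPseudoLength N) {m : ℕ} {g : ℕ → G} {a b : ℕ → ℕ}
    (hg : IsChain N g) (ha : ∀ i, a i ≤ 4) (hb : ∀ i, b i ≤ 4) (hab : a 0 < b 0) :
    N ((powProd g a (m + 1))⁻¹ * powProd g b (m + 1)) ≠ 0 := by
  intro h
  simp only [powProd] at h
  set ra := powProd (fun i => g (i + 1)) (fun i => a (i + 1)) m
  set rb := powProd (fun i => g (i + 1)) (fun i => b (i + 1)) m
  obtain ⟨e, he⟩ := Nat.exists_eq_add_of_lt hab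
  have h1 : g 0 ^ (e + 1) = ra * (((g 0 ^ a 0 * ra)⁻¹ * (g 0 ^ b 0 * rb)) * rb⁻¹) := by
    rw [he, show a 0 + e + 1 = a 0 + (e + 1) by ring, pow_add (g 0) (a 0)]
    group
  have h2 := hg.pow 0 (e + 1) (by omega) (by have := hb 0; omega)
  rw [h1] at h2
  have h3 := hN.mul_le ra (((g 0 ^ a 0 * ra)⁻¹ * (g 0 ^ b 0 * rb)) * rb⁻¹)
  have h4 := hN.mul_le ((g 0 ^ a 0 * ra)⁻¹ * (g 0 ^ b 0 * rb)) rb⁻¹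
  have h5 := IsChain.powProd_le hN m _ _ hg.tail fun i => ha (i + 1)
  have h6 := IsChain.powProd_le hN m _ _ hg.tail fun i => hb (i + 1)
  have h7 := hg.decay 0
  have h8 := hg.pos 0
  rw [hN.inv] at h4
  simp only [zero_add] at h5 h6 h7
  change N ra ≤ _ at h5
  change N rb ≤ _ at h6
  linarith

lemma IsChain.eq_of_powProd {N : G → ℝ} (hN : IsPseudoLength N) (m : ℕ) : ∀ (g : ℕ → G)
    (a b : ℕ → ℕ), IsChain N g → (∀ i, a i ≤ 4) → (∀ i, b i ≤ 4) →
    N ((powProd g a m)⁻¹ * powProd g b m) = 0 → ∀ i < m, a i = b i := by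
  induction m with
  | zero => intro g a b _ _ _ _ i hi; omega
  | succ m ih =>
    intro g a b hg ha hb h
    have h0 : a 0 = b 0 := by
      rcases lt_trichotomy (a 0) (b 0) with hlt | heq | hlt
      · exact absurd h (hg.powProd_ne hN ha hb hlt)
      · exact heq
      · rw [← hN.inv, mul_inv_rev, inv_inv] at h
        exact absurd h (hg.powProd_ne hN hb ha hlt)
    have h1 := ih _ (fun i => a (i + 1)) (fun i => b (i + 1)) hg.tail (fun i => ha (i + 1))
      (fun i => hb (i + 1)) (by
        simp only [powProd] at h
        rw [← h, h0]
        congr 1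
        group)
    intro i hi
    cases i with
    | zero => exact h0
    | succ i => exact h1 i (by omega)

/-- A chain whose lengths grow at most like powers of two yields fast growth. -/
lemma IsChain.not_slow {l : G → ℕ} (hl : IsLength l) {N : G → ℝ} (hN : IsPseudoLength N)
    {F : G → Y} (hF : ∀ g h, F g = F h → N (g⁻¹ * h) = 0) {g : ℕ → G} (hg : IsChain N g) {B : ℕ}
    (hB : ∀ i, l (g i) ≤ B * 2 ^ i) : ¬ Slow l F := by
  rintro ⟨C, hC, h⟩
  wlog hB0 : 0 < B generalizing B
  · exact this (B := B + 1) (fun i => (hB i).trans (Nat.mul_le_mul_right _ (by omega))) (by omega)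
  obtain ⟨M, hM⟩ := pow_unbounded_of_one_lt (C * (8 * B) ^ 2) (by norm_num : (1 : ℝ) < 5 / 4)
  obtain ⟨R, hR, hfin, hcard⟩ := h (4 * B * 2 ^ M)
  set m := Nat.log 2 (R / (4 * B)) with hm
  have hRB : 2 ^ M ≤ R / (4 * B) := by
    rw [Nat.le_div_iff_mul_le (by positivity)]; linarith
  have hMm : M ≤ m := by
    rw [hm]
    exact Nat.le_log_of_pow_le (by norm_num) hRB
  have h1 : 4 * B * 2 ^ m ≤ R := by
    have h2 : 2 ^ m ≤ R / (4 * B) := Nat.pow_log_le_self 2 (by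
      have : 0 < 2 ^ M := by positivity
      omega)
    rw [Nat.le_div_iff_mul_le (by positivity)] at h2
    linarith
  have h2 : R ≤ 8 * B * 2 ^ m := by
    have h3 : R / (4 * B) < 2 ^ (m + 1) := Nat.lt_pow_succ_log_self (by norm_num) _
    rw [Nat.div_lt_iff_lt_mul (by positivity), pow_succ] at h3
    linarith
  set ext : (Fin m → Fin 5) → ℕ → ℕ := fun c i => if h : i < m then c ⟨i, h⟩ else 0 with hext
  have hext4 : ∀ c i, ext c i ≤ 4 := by
    intro c i
    simp only [hext]
    split_ifs
    · omega
    · omega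
  have hinj : Function.Injective fun c => F (powProd g (ext c) m) := by
    intro c c' hcc
    funext i
    have := IsChain.eq_of_powProd hN m g (ext c) (ext c') hg (hext4 c) (hext4 c') (hF _ _ hcc) i i.2
    simp only [hext, i.2, dif_pos] at this
    exact Fin.ext this
  have hsub : Set.range (fun c => F (powProd g (ext c) m)) ⊆ F '' {g | l g ≤ R} := by
    rintro _ ⟨c, rfl⟩
    refine ⟨_, ?_, rfl⟩
    have := hl.powProd_le m g (ext c) B hB (hext4 c)
    change l _ ≤ R
    omega
  have h3 := Set.ncard_le_ncard hsub hfin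
  rw [← Set.image_univ, Set.ncard_image_of_injective _ hinj, Set.ncard_univ, Nat.card_eq_fintype_card,
    Fintype.card_fun, Fintype.card_fin, Fintype.card_fin] at h3
  have h4 : ((5 : ℝ)) ^ m ≤ C * R ^ 2 := le_trans (by exact_mod_cast h3) hcard
  have h5 : (R : ℝ) ≤ 8 * B * 2 ^ m := by exact_mod_cast h2
  have h6 : (5 : ℝ) ^ m ≤ C * (8 * B) ^ 2 * 4 ^ m := by
    calc (5 : ℝ) ^ m ≤ C * R ^ 2 := h4
      _ ≤ C * (8 * B * 2 ^ m) ^ 2 := by gcongr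
      _ = C * (8 * B) ^ 2 * 4 ^ m := by
        rw [mul_pow (8 * (B : ℝ)), ← pow_mul, mul_comm m 2, pow_mul]; norm_num; ring
  rw [← div_le_iff₀ (by positivity), ← div_pow] at h6
  have h7 : (5 / 4 : ℝ) ^ M ≤ (5 / 4) ^ m := pow_le_pow_right₀ (by norm_num) hMm
  linarith

/-- Iterating a step which shrinks the size and at most roughly doubles the length produces a
chain, which is incompatible with slow growth. -/
lemma not_slow_of_step {l : G → ℕ} (hl : IsLength l) {N : G → ℝ} (hN : IsPseudoLength N)
    {F : G → Y} (hF : ∀ g h, F g = F h → N (g⁻¹ * h) = 0) (P : G → Prop) {L : ℕ}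
    (hpos : ∀ g, P g → 0 < N g)
    (hpow : ∀ g, P g → ∀ e, 1 ≤ e → e ≤ 4 → N g / 2 ≤ N (g ^ e))
    (hstep : ∀ g, P g → ∃ g', P g' ∧ N g' ≤ N g / 40 ∧ l g' ≤ 2 * l g + L)
    {g₀ : G} (hg₀ : P g₀) : ¬ Slow l F := by
  choose! st hst using hstep
  set g : ℕ → G := fun i => st^[i] g₀ with hg
  have hsucc : ∀ i, g (i + 1) = st (g i) := fun i => Function.iterate_succ_apply' st i g₀
  have hP : ∀ i, P (g i) := by
    intro i
    induction i with
    | zero => exact hg₀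
    | succ i ih => rw [hsucc]; exact (hst _ ih).1
  have hB : ∀ i, l (g i) + L ≤ (l g₀ + L) * 2 ^ i := by
    intro i
    induction i with
    | zero => simp [hg]
    | succ i ih =>
      have := (hst _ (hP i)).2.2
      rw [hsucc, pow_succ]
      linarith
  exact IsChain.not_slow hl hN hF (g := g) ⟨fun i => hpos _ (hP i),
    fun i => by rw [hsucc]; exact (hst _ (hP i)).2.1, fun i => hpow _ (hP i)⟩
    (fun i => le_trans (Nat.le_add_right _ L) (hB i))

end Growth
end TransGraph

namespace TransGraph
open scoped Classical
open Finset

section Commute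

lemma eq_one_of_pow_eq_one {z : ℂ} {d : ℕ} (hd : 0 < d) (hz : z ^ d = 1)
    (h : d * ‖z - 1‖ < 1) : z = 1 := by
  by_contra hne
  have hn : ‖z‖ = 1 := Complex.norm_eq_one_of_pow_eq_one hz hd.ne'
  have hsum : ∑ k ∈ range d, z ^ k = 0 := by
    have := geom_sum_mul z d
    rw [hz, sub_self] at this
    exact (mul_eq_zero.mp this).resolve_right (sub_ne_zero.mpr hne)
  have hk : ∀ k : ℕ, ‖z ^ k - 1‖ ≤ k * ‖z - 1‖ := by
    intro k
    rw [← geom_sum_mul z k, norm_mul]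
    refine mul_le_mul_of_nonneg_right ?_ (norm_nonneg _)
    refine (norm_sum_le _ _).trans ?_
    simp [norm_pow, hn]
  have h1 : (d : ℝ) = ‖∑ k ∈ range d, (z ^ k - 1)‖ := by
    rw [Finset.sum_sub_distrib, hsum]; simp
  have h2 : (d : ℝ) ≤ ∑ _k ∈ range d, d * ‖z - 1‖ := by
    conv_lhs => rw [h1]
    refine (norm_sum_le _ _).trans (Finset.sum_le_sum fun k hkd => (hk k).trans ?_)
    refine mul_le_mul_of_nonneg_right ?_ (norm_nonneg _)
    exact_mod_cast (Finset.mem_range.mp hkd).le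
  rw [Finset.sum_const, card_range, nsmul_eq_mul] at h2
  have hd' : (0 : ℝ) < d := by exact_mod_cast hd
  nlinarith

variable {K U Y : Type*} [Group K] [NormedAddCommGroup U] [NormedSpace ℂ U]

lemma norm_comp_eq_of_isometry {σ : K →* (U →L[ℂ] U)} (hσ : ∀ g x, ‖σ g x‖ = ‖x‖) (g : K)
    (T : U →L[ℂ] U) : ‖σ g * T‖ = ‖T‖ := by
  refine le_antisymm ?_ ?_
  · refine ContinuousLinearMap.opNorm_le_bound _ (norm_nonneg _) fun x => ?_
    change ‖σ g (T x)‖ ≤ _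
    rw [hσ]; exact T.le_opNorm x
  · refine ContinuousLinearMap.opNorm_le_bound _ (norm_nonneg _) fun x => ?_
    rw [← hσ g (T x)]
    exact (σ g * T).le_opNorm x

lemma norm_mul_le_of_isometry {σ : K →* (U →L[ℂ] U)} (hσ : ∀ g x, ‖σ g x‖ = ‖x‖) (g : K)
    (T : U →L[ℂ] U) : ‖T * σ g‖ ≤ ‖T‖ := by
  refine ContinuousLinearMap.opNorm_le_bound _ (norm_nonneg _) fun x => ?_
  rw [← hσ g x]
  exact T.le_opNorm _

lemma isPseudoLength_norm_sub_one {σ : K →* (U →L[ℂ] U)} (hσ : ∀ g x, ‖σ g x‖ = ‖x‖) :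
    IsPseudoLength fun g => ‖σ g - 1‖ := by
  have hinv : ∀ g, ‖σ g⁻¹ - 1‖ ≤ ‖σ g - 1‖ := by
    intro g
    have : σ g * (σ g⁻¹ - 1) = -(σ g - 1) := by
      rw [mul_sub, ← map_mul, mul_inv_cancel, map_one, mul_one]; abel
    rw [← norm_comp_eq_of_isometry hσ g, this, norm_neg]
  refine ⟨by simp, fun g h => ?_, fun g => le_antisymm (hinv g) ?_⟩
  · have : σ (g * h) - 1 = σ g * (σ h - 1) + (σ g - 1) := by
      rw [map_mul, mul_sub, mul_one]; abel
    change ‖σ (g * h) - 1‖ ≤ _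
    rw [this, add_comm (‖σ g - 1‖)]
    refine (norm_add_le _ _).trans ?_
    rw [norm_comp_eq_of_isometry hσ]
  · simpa using hinv g⁻¹

lemma norm_pow_sub_le {σ : K →* (U →L[ℂ] U)} (hσ : ∀ g x, ‖σ g x‖ = ‖x‖) (g : K) (e : ℕ) :
    ‖σ (g ^ e) - 1 - (e : ℝ) • (σ g - 1)‖ ≤ e ^ 2 * ‖σ g - 1‖ ^ 2 := by
  induction e with
  | zero => simp
  | succ e ih =>
    have h : σ (g ^ (e + 1)) - 1 - ((e + 1 : ℕ) : ℝ) • (σ g - 1) =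
        (σ (g ^ e) - 1 - (e : ℝ) • (σ g - 1)) + (σ (g ^ e) - 1) * (σ g - 1) := by
      rw [pow_succ, map_mul]
      push_cast
      rw [add_smul, one_smul]
      noncomm_ring
    rw [h]
    refine (norm_add_le _ _).trans ?_
    have h1 := (isPseudoLength_norm_sub_one hσ).pow_le g e
    have h2 := norm_mul_le (σ (g ^ e) - 1) (σ g - 1)
    have h3 := mul_le_mul_of_nonneg_right h1 (norm_nonneg (σ g - 1))
    push_cast
    nlinarith [norm_nonneg (σ g - 1), sq_nonneg (‖σ g - 1‖),
      mul_nonneg (Nat.cast_nonneg (α := ℝ) e) (sq_nonneg (‖σ g - 1‖))]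

lemma half_le_norm_pow_sub_one {σ : K →* (U →L[ℂ] U)} (hσ : ∀ g x, ‖σ g x‖ = ‖x‖) {g : K}
    (hg : ‖σ g - 1‖ ≤ 1 / 8) {e : ℕ} (he : 1 ≤ e) (he' : e ≤ 4) :
    ‖σ g - 1‖ / 2 ≤ ‖σ (g ^ e) - 1‖ := by
  have h1 := norm_pow_sub_le hσ g e
  have h2 : ‖(e : ℝ) • (σ g - 1)‖ = e * ‖σ g - 1‖ := by
    rw [norm_smul]; simp
  have h3 := norm_sub_norm_le ((e : ℝ) • (σ g - 1)) (σ (g ^ e) - 1)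
  rw [norm_sub_rev ((e : ℝ) • (σ g - 1)), h2] at h3
  have h4 : (1 : ℝ) ≤ e := by exact_mod_cast he
  have h5 : (e : ℝ) ≤ 4 := by exact_mod_cast he'
  have h0 := norm_nonneg (σ g - 1)
  have h6 : (e : ℝ) * ‖σ g - 1‖ ≤ 1 / 2 := by nlinarith
  nlinarith [mul_le_mul_of_nonneg_right h6 (mul_nonneg (by linarith : (0 : ℝ) ≤ e) h0),
    mul_le_mul_of_nonneg_right h4 h0]

lemma norm_commutator_le {σ : K →* (U →L[ℂ] U)} (hσ : ∀ g x, ‖σ g x‖ = ‖x‖) (g s : K) :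
    ‖σ (g * s * g⁻¹ * s⁻¹) - 1‖ ≤ 2 * ‖σ g - 1‖ * ‖σ s - 1‖ := by
  have h : σ (g * s * g⁻¹ * s⁻¹) - 1 =
      ((σ g - 1) * (σ s - 1) - (σ s - 1) * (σ g - 1)) * σ (g⁻¹ * s⁻¹) := by
    have h1 : (σ g - 1) * (σ s - 1) - (σ s - 1) * (σ g - 1) = σ (g * s) - σ (s * g) := by
      rw [map_mul, map_mul]; noncomm_ring
    rw [h1, sub_mul, ← map_mul, ← map_mul, ← map_one σ]
    congr 2 <;> group
  rw [h]
  refine (norm_mul_le_of_isometry hσ _ _).trans ((norm_sub_le _ _).trans ?_)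
  have h1 := norm_mul_le (σ g - 1) (σ s - 1)
  have h2 := norm_mul_le (σ s - 1) (σ g - 1)
  linarith

lemma IsLength.commutator_le {l : K → ℕ} (hl : IsLength l) (g s : K) :
    l (g * s * g⁻¹ * s⁻¹) ≤ 2 * l g + 2 * l s := by
  have h1 := hl.mul_le (g * s * g⁻¹) s⁻¹
  have h2 := hl.mul_le (g * s) g⁻¹
  have h3 := hl.mul_le g s
  rw [hl.inv] at h1 h2
  omega

lemma commutator_map_eq_one_iff {M : Type*} [Monoid M] (σ : K →* M) (g s : K) :
    σ (g * s * g⁻¹ * s⁻¹) = 1 ↔ Commute (σ g) (σ s) := by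
  constructor
  · intro h
    have : g * s = (g * s * g⁻¹ * s⁻¹) * (s * g) := by group
    have h2 := congrArg σ this
    rw [map_mul σ _ (s * g), h, one_mul, map_mul, map_mul] at h2
    exact h2
  · intro h
    have : g * s * g⁻¹ * s⁻¹ = (g * s) * (s * g)⁻¹ := by group
    have h2 : σ (g * s) = σ (s * g) := by rw [map_mul, map_mul]; exact h
    rw [this, map_mul, h2, ← map_mul, mul_inv_cancel, map_one]

/-- An operator commuting with an irreducible family is a scalar. -/
lemma exists_eq_smul_one [FiniteDimensional ℂ U] [Nontrivial U] {S : Set (U →L[ℂ] U)}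
    (hirr : ∀ W : Submodule ℂ U, (∀ s ∈ S, ∀ x ∈ W, s x ∈ W) → W ≠ ⊥ → W = ⊤)
    {T : U →L[ℂ] U} (hT : ∀ s ∈ S, Commute T s) : ∃ c : ℂ, ∀ x, T x = c • x := by
  obtain ⟨c, hc⟩ := Module.End.exists_eigenvalue (T : U →ₗ[ℂ] U)
  refine ⟨c, fun x => ?_⟩
  have htop := hirr (Module.End.eigenspace (T : U →ₗ[ℂ] U) c) ?_ hc
  · have hx : x ∈ Module.End.eigenspace (T : U →ₗ[ℂ] U) c := htop ▸ Submodule.mem_top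
    exact Module.End.mem_eigenspace_iff.mp hx
  · intro s hs y hy
    rw [Module.End.mem_eigenspace_iff] at hy ⊢
    have h1 : T (s y) = s (T y) := by
      simpa using congrArg (fun A : U →L[ℂ] U => A y) (hT s hs).eq
    change T (s y) = c • s y
    rw [h1, ← map_smul]
    exact congrArg s hy

/-- A group of slow growth acting irreducibly by isometries, generated by elements close to the
identity, acts through commuting operators. -/
lemma commute_of_slow [FiniteDimensional ℂ U] [Nontrivial U] {l : K → ℕ} (hl : IsLength l)
    {σ : K →* (U →L[ℂ] U)} (hσ : ∀ g x, ‖σ g x‖ = ‖x‖) {S : Set K} {L : ℕ}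
    (hL : ∀ s ∈ S, l s ≤ L) {ε : ℝ} (hε : ε ≤ 1 / 80)
    (hε' : ε * Module.finrank ℂ U ≤ 1) (hS : ∀ s ∈ S, ‖σ s - 1‖ < ε)
    (hirr : ∀ W : Submodule ℂ U, (∀ s ∈ S, ∀ x ∈ W, σ s x ∈ W) → W ≠ ⊥ → W = ⊤)
    {F : K → Y} (hF : ∀ g h, F g = F h → σ g = σ h) (hslow : Slow l F) :
    ∀ s ∈ S, ∀ t ∈ S, Commute (σ s) (σ t) := by
  intro s hs t ht
  by_contra hst
  have hdim : 0 < Module.finrank ℂ U := Module.finrank_pos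
  let P : K → Prop := fun g => σ g ≠ 1 ∧ LinearMap.det (σ g : U →ₗ[ℂ] U) = 1 ∧ ‖σ g - 1‖ < ε
  let δ : K →* ℂ := (LinearMap.det (A := ℂ) (M := U)).comp
    ((ContinuousLinearMap.toLinearMapRingHom (R₁ := ℂ) (M₁ := U)).toMonoidHom.comp σ)
  have hδ : ∀ g, δ g = LinearMap.det (σ g : U →ₗ[ℂ] U) := fun g => rfl
  have hdet : ∀ g h, LinearMap.det (σ (g * h * g⁻¹ * h⁻¹) : U →ₗ[ℂ] U) = 1 := by
    intro g h
    rw [← hδ, commutator_map_eq_one_iff]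
    exact Commute.all _ _
  have hPc : ∀ g h, ‖σ g - 1‖ < ε → h ∈ S → ¬ Commute (σ g) (σ h) →
      P (g * h * g⁻¹ * h⁻¹) ∧ ‖σ (g * h * g⁻¹ * h⁻¹) - 1‖ ≤ ‖σ g - 1‖ / 40 := by
    intro g h hg hh hc
    have h1 := norm_commutator_le hσ g h
    have h2 := hS h hh
    have h3 : ‖σ (g * h * g⁻¹ * h⁻¹) - 1‖ ≤ ‖σ g - 1‖ / 40 := by
      nlinarith [norm_nonneg (σ g - 1), norm_nonneg (σ h - 1)]
    refine ⟨⟨fun h4 => hc ((commutator_map_eq_one_iff σ g h).mp h4), hdet g h, ?_⟩, h3⟩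
    linarith [norm_nonneg (σ g - 1)]
  refine not_slow_of_step hl (isPseudoLength_norm_sub_one hσ) (F := F) ?_ P (L := 2 * L) ?_ ?_ ?_
    (hPc s t (hS s hs) ht hst).1 hslow
  · intro g h hgh
    rw [map_mul, ← hF g h hgh, ← map_mul, inv_mul_cancel, map_one, sub_self, norm_zero]
  · exact fun g hg => norm_pos_iff.mpr (sub_ne_zero.mpr hg.1)
  · exact fun g hg e he he' => half_le_norm_pow_sub_one hσ (by linarith [hg.2.2]) he he'
  · intro g hg
    by_cases hcom : ∀ h ∈ S, Commute (σ g) (σ h)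
    · exfalso
      obtain ⟨c, hc⟩ := exists_eq_smul_one (S := σ '' S) (T := σ g)
        (fun W hW => hirr W fun s hs => hW (σ s) ⟨s, hs, rfl⟩)
        (by rintro _ ⟨h, hh, rfl⟩; exact hcom h hh)
      have hlin : (σ g : U →ₗ[ℂ] U) = c • LinearMap.id := LinearMap.ext hc
      have hcd : c ^ Module.finrank ℂ U = 1 := by
        have := hg.2.1
        rwa [hlin, LinearMap.det_smul, LinearMap.det_id, mul_one] at this
      obtain ⟨x, hx⟩ := exists_ne (0 : U)
      have hle : ‖c - 1‖ ≤ ‖σ g - 1‖ := by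
        have := (σ g - 1).le_opNorm x
        have h2 : (σ g - 1) x = (c - 1) • x := by
          rw [sub_smul, one_smul, ← hc x]; rfl
        rw [h2, norm_smul] at this
        exact le_of_mul_le_mul_right this (norm_pos_iff.mpr hx)
      have hdr : (0 : ℝ) < Module.finrank ℂ U := by exact_mod_cast hdim
      have hc1 : c = 1 := eq_one_of_pow_eq_one hdim hcd (by nlinarith [hg.2.2])
      exact hg.1 (ContinuousLinearMap.ext fun x => by rw [hc x, hc1, one_smul]; rfl)
    · push Not at hcom
      obtain ⟨h, hh, hc⟩ := hcom
      refine ⟨_, (hPc g h hg.2.2 hh hc).1, (hPc g h hg.2.2 hh hc).2, ?_⟩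
      have := hl.commutator_le g h
      have := hL h hh
      omega

end Commute
end TransGraph

namespace TransGraph
open scoped Classical
open Finset

section Good
variable {G Y E : Type*} [Group G] [NormedAddCommGroup E] [NormedSpace ℂ E]

/-- A subgroup of finite index generated by elements of bounded length. -/
def Good (l : G → ℕ) (H : Subgroup G) : Prop :=
  (∃ T : Set G, T.Finite ∧ ∀ g, ∃ t ∈ T, t⁻¹ * g ∈ H) ∧
    ∃ (S : Set G) (L : ℕ), H = Subgroup.closure S ∧ ∀ s ∈ S, l s ≤ L

lemma Slow.subgroup {l : G → ℕ} {F : G → Y} (h : Slow l F) (H : Subgroup G) :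
    Slow (fun g : H => l g) (fun g : H => F g) := by
  obtain ⟨C, hC, h⟩ := h
  refine ⟨C, hC, fun N => ?_⟩
  obtain ⟨R, hR, hfin, hle⟩ := h N
  have hsub : (fun g : H => F g) '' {g | l g ≤ R} ⊆ F '' {g | l g ≤ R} := by
    rintro _ ⟨g, hg, rfl⟩
    exact ⟨g, hg, rfl⟩
  exact ⟨R, hR, hfin.subset hsub, le_trans (by exact_mod_cast Set.ncard_le_ncard hsub hfin) hle⟩

lemma IsLength.subgroup {l : G → ℕ} (hl : IsLength l) (H : Subgroup G) :
    IsLength fun g : H => l g :=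
  ⟨hl.one, fun g h => hl.mul_le g h, fun g => hl.inv g⟩

/-- The elements of a good subgroup acting almost trivially generate a good subgroup. -/
lemma Good.exists_good_close [FiniteDimensional ℂ E] {l : G → ℕ} (hl : IsLength l)
    {ρ : G →* (E →L[ℂ] E)} (hρ : ∀ g x, ‖ρ g x‖ = ‖x‖) {H : Subgroup G} (hH : Good l H)
    {ε : ℝ} (hε : 0 < ε) :
    ∃ (S : Set G) (L : ℕ), (∀ s ∈ S, s ∈ H ∧ l s ≤ L ∧ ‖ρ s - 1‖ < ε) ∧
      Good l (Subgroup.closure S) := by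
  obtain ⟨⟨T₀, hT₀, hcov⟩, S₀, L₀, rfl, hS₀⟩ := hH
  set H := Subgroup.closure S₀ with hHdef
  have hbdd : TotallyBounded (ρ '' (H : Set G)) := by
    have : ProperSpace (E →L[ℂ] E) := FiniteDimensional.proper ℂ _
    refine (isCompact_closedBall (0 : E →L[ℂ] E) 1).totallyBounded.subset ?_
    rintro _ ⟨g, -, rfl⟩
    rw [mem_closedBall_zero_iff]
    exact ContinuousLinearMap.opNorm_le_bound _ zero_le_one fun x => by rw [hρ, one_mul]
  obtain ⟨t, ht, htfin, htcov⟩ := Metric.finite_approx_of_totallyBounded hbdd ε hε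
  obtain ⟨T, hTH, hTfin, rfl⟩ : ∃ T : Set G, T ⊆ H ∧ T.Finite ∧ ρ '' T = t := by
    choose! f hf using ht
    refine ⟨f '' t, ?_, htfin.image f, ?_⟩
    · rintro _ ⟨y, hy, rfl⟩
      exact (hf hy).1
    · rw [Set.image_image]
      exact (Set.image_congr fun y hy => (hf hy).2).trans (Set.image_id t)
  have hnear : ∀ h ∈ H, ∃ t ∈ T, ‖ρ (t⁻¹ * h) - 1‖ < ε := by
    intro h hh
    obtain ⟨y, hy, hd⟩ := Set.mem_iUnion₂.mp (htcov ⟨h, hh, rfl⟩)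
    obtain ⟨t, ht, rfl⟩ := hy
    refine ⟨t, ht, ?_⟩
    rw [Metric.mem_ball, dist_eq_norm] at hd
    rw [← norm_comp_eq_of_isometry hρ t, mul_sub, ← map_mul, mul_one, mul_inv_cancel_left]
    exact hd
  obtain ⟨M, hM⟩ : ∃ M : ℕ, ∀ t ∈ T, l t ≤ M := by
    obtain ⟨M, hM⟩ := (hTfin.image l).bddAbove
    exact ⟨M, fun t ht => hM ⟨t, ht, rfl⟩⟩
  let L := 2 * M + L₀
  let S : Set G := {h | h ∈ H ∧ l h ≤ L ∧ ‖ρ h - 1‖ < ε}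
  have hstep : ∀ a ∈ H, l a ≤ L₀ → ∀ y, (∃ t ∈ T, t⁻¹ * y ∈ Subgroup.closure S) →
      ∃ t ∈ T, t⁻¹ * (a * y) ∈ Subgroup.closure S := by
    rintro a ha hla y ⟨t, ht, hy⟩
    obtain ⟨t', ht', hn⟩ := hnear (a * t) (mul_mem ha (hTH ht))
    refine ⟨t', ht', ?_⟩
    have : t'⁻¹ * (a * y) = (t'⁻¹ * (a * t)) * (t⁻¹ * y) := by group
    rw [this]
    refine mul_mem (Subgroup.subset_closure ⟨?_, ?_, hn⟩) hy
    · exact mul_mem (inv_mem (hTH ht')) (mul_mem ha (hTH ht))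
    · have h1 := hl.mul_le t'⁻¹ (a * t)
      have h2 := hl.mul_le a t
      rw [hl.inv] at h1
      have := hM t ht
      have := hM t' ht'
      change _ ≤ 2 * M + L₀
      omega
  have hcov' : ∀ h ∈ H, ∃ t ∈ T, t⁻¹ * h ∈ Subgroup.closure S := by
    intro h hh
    induction hh using Subgroup.closure_induction_left with
    | one =>
      obtain ⟨t, ht, hn⟩ := hnear 1 (one_mem H)
      refine ⟨t, ht, Subgroup.subset_closure ⟨mul_mem (inv_mem (hTH ht)) (one_mem _), ?_, hn⟩⟩
      rw [mul_one, hl.inv]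
      have := hM t ht
      change _ ≤ 2 * M + L₀
      omega
    | mul_left a ha y hy ih =>
      exact hstep a (Subgroup.subset_closure ha) (hS₀ a ha) y ih
    | inv_mul_cancel a ha y hy ih =>
      exact hstep a⁻¹ (inv_mem (Subgroup.subset_closure ha)) (by rw [hl.inv]; exact hS₀ a ha) y ih
  refine ⟨S, L, fun s hs => hs, ⟨(fun p : G × G => p.1 * p.2) '' (T₀ ×ˢ T),
    (hT₀.prod hTfin).image _, fun g => ?_⟩, S, L, rfl, fun s hs => hs.2.1⟩
  obtain ⟨t₀, ht₀, h₀⟩ := hcov g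
  obtain ⟨t, ht, h⟩ := hcov' _ h₀
  refine ⟨t₀ * t, ⟨(t₀, t), ⟨ht₀, ht⟩, rfl⟩, ?_⟩
  rwa [mul_inv_rev, mul_assoc]

/-- The restriction of a representation to an invariant subspace of a subgroup. -/
def subRep (ρ : G →* (E →L[ℂ] E)) (H : Subgroup G) (U : Submodule ℂ E)
    (h : ∀ g ∈ H, ∀ x ∈ U, ρ g x ∈ U) : H →* (U →L[ℂ] U) where
  toFun g := (ρ g).restrict (h g g.2)
  map_one' := by ext x; simp
  map_mul' g k := by ext x; simp

lemma invariant_closure [FiniteDimensional ℂ E] {ρ : G →* (E →L[ℂ] E)} {S : Set G}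
    {W : Submodule ℂ E} (hW : ∀ s ∈ S, ∀ x ∈ W, ρ s x ∈ W) :
    ∀ g ∈ Subgroup.closure S, ∀ x ∈ W, ρ g x ∈ W := by
  intro g hg
  induction hg using Subgroup.closure_induction with
  | mem s hs => exact hW s hs
  | one => intro x hx; simpa using hx
  | mul a b _ _ iha ihb =>
    intro x hx
    rw [map_mul]
    exact iha _ (ihb _ hx)
  | inv a _ ih =>
    intro x hx
    have hinv : ∀ y, ρ a⁻¹ (ρ a y) = y := by
      intro y
      have := congrArg (fun T : E →L[ℂ] E => T y) (map_mul ρ a⁻¹ a)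
      simpa using this.symm
    have hinj : Function.Injective ((ρ a : E →ₗ[ℂ] E).restrict ih) := by
      intro y z hyz
      have := congrArg (fun w : W => ρ a⁻¹ (w : E)) hyz
      simp only [LinearMap.restrict_apply, ContinuousLinearMap.coe_coe] at this
      rw [hinv, hinv] at this
      exact Subtype.ext this
    obtain ⟨y, hy⟩ := LinearMap.injective_iff_surjective.mp hinj ⟨x, hx⟩
    have h1 : ρ a y = x := congrArg (fun w : W => (w : E)) hy
    rw [← h1, hinv]
    exact y.2

/-- Given an isometric representation of a group of slow growth, some finite index subgroup,
generated by elements of bounded length, has a common eigenvector. -/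
lemma exists_common_eigenvector [FiniteDimensional ℂ E] [Nontrivial E] {l : G → ℕ}
    (hl : IsLength l) {ρ : G →* (E →L[ℂ] E)} (hρ : ∀ g x, ‖ρ g x‖ = ‖x‖)
    (hG : Good l (⊤ : Subgroup G)) {F : G → Y} (hF : ∀ g h, F g = F h → ρ g = ρ h)
    (hslow : Slow l F) :
    ∃ (S : Set G) (u : E) (χ : G → ℂ), Good l (Subgroup.closure S) ∧ u ≠ 0 ∧
      (∀ h ∈ Subgroup.closure S, ‖χ h‖ = 1 ∧ ρ h u = χ h • u) ∧
      ∀ s ∈ S, ‖χ s⁻¹ - 1‖ < 1 / 40 := by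
  let Q : ℕ → Prop := fun n => ∃ (H : Subgroup G) (U : Submodule ℂ E), Good l H ∧ U ≠ ⊥ ∧
    (∀ h ∈ H, ∀ x ∈ U, ρ h x ∈ U) ∧ Module.finrank ℂ U = n
  have hQ : ∃ n, Q n := ⟨_, ⊤, ⊤, hG, top_ne_bot, fun _ _ _ _ => Submodule.mem_top, rfl⟩
  obtain ⟨H, U, hH, hU, hinv, hdim⟩ := Nat.find_spec hQ
  have hmin : ∀ (H' : Subgroup G) (U' : Submodule ℂ E), Good l H' → U' ≠ ⊥ →
      (∀ h ∈ H', ∀ x ∈ U', ρ h x ∈ U') → Module.finrank ℂ U ≤ Module.finrank ℂ U' :=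
    fun H' U' h1 h2 h3 => hdim ▸ Nat.find_min' hQ ⟨H', U', h1, h2, h3, rfl⟩
  have : Nontrivial U := Submodule.nontrivial_iff_ne_bot.mpr hU
  have hpos : 0 < Module.finrank ℂ U := Module.finrank_pos
  have hpos' : (0 : ℝ) < Module.finrank ℂ U := by exact_mod_cast hpos
  obtain ⟨S, L, hS, hgood⟩ := hH.exists_good_close hl hρ
    (ε := min (1 / 80) (1 / Module.finrank ℂ U)) (by positivity)
  set ε : ℝ := min (1 / 80) (1 / Module.finrank ℂ U) with hε
  have hSH : Subgroup.closure S ≤ H := (Subgroup.closure_le H).mpr fun s hs => (hS s hs).1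
  let σ := subRep ρ (Subgroup.closure S) U fun h hh => hinv h (hSH hh)
  have hσ : ∀ g x, ‖σ g x‖ = ‖x‖ := fun g x => hρ g x
  let S' : Set (Subgroup.closure S) := {s | (s : G) ∈ S}
  have hσS : ∀ s ∈ S', ‖σ s - 1‖ < ε := by
    intro s hs
    refine lt_of_le_of_lt ?_ (hS s hs).2.2
    exact ContinuousLinearMap.opNorm_le_bound _ (norm_nonneg _) fun x => (ρ s - 1).le_opNorm x
  have hirr : ∀ W : Submodule ℂ U, (∀ s ∈ S', ∀ x ∈ W, σ s x ∈ W) → W ≠ ⊥ → W = ⊤ := by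
    intro W hW hne
    refine Submodule.eq_top_of_finrank_eq (le_antisymm (Submodule.finrank_le W) ?_)
    rw [← Submodule.finrank_map_subtype_eq]
    refine hmin _ _ hgood ?_ (invariant_closure ?_)
    · intro h
      exact hne (Submodule.map_injective_of_injective U.injective_subtype
        (h.trans (Submodule.map_bot _).symm))
    · rintro s hs _ ⟨x, hx, rfl⟩
      exact ⟨σ ⟨s, Subgroup.subset_closure hs⟩ x, hW ⟨s, Subgroup.subset_closure hs⟩ hs x hx, rfl⟩
  have hcomm := commute_of_slow (hl.subgroup _) hσ (S := S') (fun s hs => (hS s hs).2.1)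
    (min_le_left _ _) (by
      calc ε * Module.finrank ℂ U ≤ 1 / Module.finrank ℂ U * Module.finrank ℂ U :=
            mul_le_mul_of_nonneg_right (min_le_right _ _) hpos'.le
        _ = 1 := by field_simp) hσS hirr (F := fun g : Subgroup.closure S => F g)
    (fun g h hgh => by
      ext x
      exact congrArg (fun T : E →L[ℂ] E => T x) (hF g h hgh)) (hslow.subgroup _)
  have hscal : ∀ s ∈ S', ∃ c : ℂ, ∀ x, σ s x = c • x := by
    intro s hs
    refine exists_eq_smul_one (S := σ '' S')
      (fun W hW => hirr W fun s hs => hW (σ s) ⟨s, hs, rfl⟩) ?_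
    rintro _ ⟨t, ht, rfl⟩
    exact hcomm s hs t ht
  obtain ⟨u, hu⟩ := exists_ne (0 : U)
  have hu' : (u : E) ≠ 0 := fun h => hu (Subtype.ext h)
  have hline : ∀ h ∈ Subgroup.closure S, ∀ x ∈ Submodule.span ℂ {(u : E)},
      ρ h x ∈ Submodule.span ℂ {(u : E)} := by
    refine invariant_closure fun s hs x hx => ?_
    obtain ⟨c, rfl⟩ := Submodule.mem_span_singleton.mp hx
    obtain ⟨a, ha⟩ := hscal ⟨s, Subgroup.subset_closure hs⟩ hs
    have := congrArg (fun w : U => (w : E)) (ha u)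
    change ρ s u = a • (u : E) at this
    rw [map_smul, this]
    exact Submodule.smul_mem _ _ (Submodule.smul_mem _ _ (Submodule.mem_span_singleton_self _))
  have hex : ∀ h, h ∈ Subgroup.closure S → ∃ c : ℂ, ρ h u = c • (u : E) := by
    intro h hh
    obtain ⟨c, hc⟩ := Submodule.mem_span_singleton.mp
      (hline h hh u (Submodule.mem_span_singleton_self _))
    exact ⟨c, hc.symm⟩
  choose! χ hχ using hex
  have hupos : 0 < ‖(u : E)‖ := norm_pos_iff.mpr hu'
  refine ⟨S, u, χ, hgood, hu', fun h hh => ⟨?_, hχ h hh⟩, fun s hs => ?_⟩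
  · have h1 := hρ h u
    rw [hχ h hh, norm_smul] at h1
    exact mul_right_cancel₀ hupos.ne' (h1.trans (one_mul _).symm)
  · have h1 := (ρ s⁻¹ - 1).le_opNorm (u : E)
    have h2 : (ρ s⁻¹ - 1) (u : E) = (χ s⁻¹ - 1) • (u : E) := by
      rw [sub_smul, one_smul, ← hχ s⁻¹ (inv_mem (Subgroup.subset_closure hs))]; rfl
    rw [h2, norm_smul] at h1
    have h3 := le_of_mul_le_mul_right h1 hupos
    have h4 := (hS s hs).2.2
    have h5 : ε ≤ 1 / 80 := min_le_left _ _
    have h6 : ‖ρ s⁻¹ - 1‖ = ‖ρ s - 1‖ := (isPseudoLength_norm_sub_one hρ).inv s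
    linarith

end Good
end TransGraph

namespace TransGraph
open scoped Classical
open Finset

variable {V : Type*} {X : SimpleGraph V}

section Gradient

/-- Bounded functions on pairs of vertices. -/
noncomputable abbrev PairFun (V : Type*) := lp (fun _ : V × V => ℂ) ⊤

/-- Translation of bounded functions on pairs by a permutation. -/
noncomputable def pairShift (g : X ≃g X) : PairFun V →L[ℂ] PairFun V :=
  LinearMap.mkContinuous
    { toFun := fun φ => ⟨fun p => φ (g⁻¹ p.1, g⁻¹ p.2), memℓp_infty
        ⟨‖φ‖, by rintro _ ⟨p, rfl⟩; exact lp.norm_apply_le_norm ENNReal.top_ne_zero φ _⟩⟩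
      map_add' := fun φ ψ => rfl
      map_smul' := fun c φ => rfl } 1 fun φ => by
    rw [one_mul]
    exact lp.norm_le_of_forall_le (norm_nonneg _)
      fun p => lp.norm_apply_le_norm ENNReal.top_ne_zero φ _

lemma pairShift_apply (g : X ≃g X) (φ : PairFun V) (p : V × V) :
    pairShift g φ p = φ (g⁻¹ p.1, g⁻¹ p.2) := rfl

lemma pairShift_mul (g h : X ≃g X) : pairShift (g * h) = pairShift g * pairShift h := by
  ext φ p
  change φ ((g * h)⁻¹ p.1, (g * h)⁻¹ p.2) = φ (h⁻¹ (g⁻¹ p.1), h⁻¹ (g⁻¹ p.2))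
  rw [mul_inv_rev]
  rfl

lemma norm_pairShift (g : X ≃g X) (φ : PairFun V) : ‖pairShift g φ‖ = ‖φ‖ := by
  refine le_antisymm (lp.norm_le_of_forall_le (norm_nonneg _)
    fun p => lp.norm_apply_le_norm ENNReal.top_ne_zero φ _) ?_
  refine lp.norm_le_of_forall_le (norm_nonneg _) fun p => ?_
  have := lp.norm_apply_le_norm ENNReal.top_ne_zero (pairShift g φ) (g p.1, g p.2)
  rwa [pairShift_apply, RelIso.inv_apply_self, RelIso.inv_apply_self] at this

/-- The gradient of a Lipschitz harmonic function. -/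
noncomputable def gradMap (X : SimpleGraph V) : lipHarm X ℂ →ₗ[ℂ] PairFun V where
  toFun h := ⟨fun p => if X.Adj p.1 p.2 then h.1 p.1 - h.1 p.2 else 0, by
    obtain ⟨C, hC⟩ := h.2.2
    refine memℓp_infty ⟨max C 0, ?_⟩
    rintro _ ⟨p, rfl⟩
    dsimp only
    split_ifs with hp
    · exact (hC _ _ hp).trans (le_max_left _ _)
    · simp⟩
  map_add' a b := by
    ext p
    change (if X.Adj p.1 p.2 then (a.1 + b.1) p.1 - (a.1 + b.1) p.2 else 0) =
      (if X.Adj p.1 p.2 then a.1 p.1 - a.1 p.2 else 0) +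
        if X.Adj p.1 p.2 then b.1 p.1 - b.1 p.2 else 0
    split_ifs
    · simp only [Pi.add_apply]; ring
    · simp
  map_smul' c a := by
    ext p
    change (if X.Adj p.1 p.2 then (c • a.1) p.1 - (c • a.1) p.2 else 0) =
      c * (if X.Adj p.1 p.2 then a.1 p.1 - a.1 p.2 else 0)
    split_ifs
    · simp only [Pi.smul_apply, smul_eq_mul]; ring
    · simp

lemma gradMap_apply (h : lipHarm X ℂ) (p : V × V) :
    gradMap X h p = if X.Adj p.1 p.2 then h.1 p.1 - h.1 p.2 else 0 := rfl

end Gradient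

/-- The displacement of the base point under an automorphism. -/
noncomputable def len (X : SimpleGraph V) (o : V) (g : X ≃g X) : ℕ := X.dist o (g o)

namespace Homog
variable (hX : Homog X)
include hX

lemma isLength_len (o : V) : IsLength (len X o) := by
  refine ⟨?_, fun g h => ?_, fun g => ?_⟩
  · simp [len]
  · have := hX.tri o (g o) (g (h o))
    rwa [dist_map g] at this
  · have := dist_map g (g⁻¹ o) o
    rw [RelIso.apply_inv_self] at this
    rw [len, len, this, SimpleGraph.dist_comm]

lemma good_top (o : V) : Good (len X o) (⊤ : Subgroup (X ≃g X)) := by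
  refine ⟨⟨{1}, Set.finite_singleton _, fun g => ⟨1, rfl, Subgroup.mem_top _⟩⟩,
    {g | len X o g ≤ 1}, 1, ?_, fun s hs => hs⟩
  refine ((Subgroup.eq_top_iff' _).mpr fun g => ?_).symm
  induction hn : len X o g generalizing g with
  | zero => exact Subgroup.subset_closure (by change len X o g ≤ 1; omega)
  | succ n ih =>
    obtain ⟨z, hz, hz'⟩ := hX.exists_between (k := n) (l := 1) hn
    obtain ⟨h, rfl⟩ := hX.trans o z
    have h1 : g = h * (h⁻¹ * g) := by group
    rw [h1]
    refine mul_mem (ih h hz) (Subgroup.subset_closure ?_)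
    have := dist_map h o (h⁻¹ (g o))
    rw [RelIso.apply_inv_self, hz'] at this
    exact this.symm.le

lemma comp_mem_lipHarm {u : V → ℂ} (hu : u ∈ lipHarm X ℂ) (g : X ≃g X) :
    (fun x => u (g x)) ∈ lipHarm X ℂ := by
  obtain ⟨h1, C, hC⟩ := hu
  refine ⟨fun x => ?_, C, fun x y hxy => hC _ _ (g.map_adj_iff.mpr hxy)⟩
  have := h1 (g x)
  rw [hX.nbr_map, Finset.sum_map] at this
  exact this

lemma sub_eq_of_adj {f : V → V → ℂ} (hf : ∀ x y z, f x y + f y z = f x z)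
    (h : ∀ x y, X.Adj x y → f x y = 0) (x y : V) : f x y = 0 := by
  obtain ⟨w⟩ := hX.conn.preconnected x y
  induction w with
  | nil => have := hf ‹V› ‹V› ‹V›; simpa using this
  | cons hadj _ ih => rw [← hf _ _ _, h _ _ hadj, ih, add_zero]

/-- Translating the gradients of Lipschitz harmonic functions. -/
lemma pairShift_gradMap (g : X ≃g X) (h : lipHarm X ℂ) :
    pairShift g (gradMap X h) = gradMap X ⟨_, hX.comp_mem_lipHarm h.2 g⁻¹⟩ := by
  ext p
  rw [pairShift_apply, gradMap_apply, gradMap_apply]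
  simp only [(g⁻¹).map_adj_iff]

/-- The representation of the automorphism group on gradients of Lipschitz harmonic functions. -/
noncomputable def gradRep : (X ≃g X) →* (LinearMap.range (gradMap X) →L[ℂ]
    LinearMap.range (gradMap X)) where
  toFun g := (pairShift g).restrict (by
    rintro _ ⟨h, rfl⟩
    exact ⟨_, (hX.pairShift_gradMap g h).symm⟩)
  map_one' := by ext x; rfl
  map_mul' g h := by
    refine ContinuousLinearMap.ext fun x => Subtype.ext ?_
    exact congrArg (fun T : PairFun V →L[ℂ] PairFun V => T x) (pairShift_mul g h)

/-- Slow growth of the automorphism group modulo the kernel of its action on Lipschitz harmonic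
functions. -/
lemma exists_slow_gradRep (hq : QuadSubseq X) (ham : Amenable X) (o : V) :
    ∃ (S : Finset V), Slow (len X o) (fun (g : X ≃g X) (s : S) => g⁻¹ (s : V)) ∧
      ∀ g h : X ≃g X, (fun s : S => g⁻¹ (s : V)) = (fun s : S => h⁻¹ (s : V)) →
        hX.gradRep g = hX.gradRep h := by
  have := hX.finiteDimensional_lipHarm hq ham
  obtain ⟨S, hS⟩ := exists_finset_separating (𝕜 := ℂ) (W := lipHarm X ℂ)
    (fun x : V => (LinearMap.proj x).comp (lipHarm X ℂ).subtype)
    (fun w hw => Subtype.ext (funext hw))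
  refine ⟨S, ?_, fun g h hgh => ?_⟩
  · obtain ⟨C, hC, hR⟩ := hq
    obtain ⟨D, hD⟩ : ∃ D : ℕ, ∀ s ∈ S, X.dist o s ≤ D :=
      ⟨S.sup (X.dist o), fun s hs => Finset.le_sup (f := X.dist o) hs⟩
    refine ⟨C * (vol X D) ^ #S, by have := hX.vol_pos D; positivity, fun N => ?_⟩
    obtain ⟨R, hNR, hvR⟩ := hR N
    let B : Finset (S → V) := (ball X o R).biUnion fun x => Fintype.piFinset fun _ => ball X x D
    have hsub : (fun (g : X ≃g X) (s : S) => g⁻¹ (s : V)) '' {g | len X o g ≤ R} ⊆ B := by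
      rintro _ ⟨g, hg, rfl⟩
      simp only [B, Finset.coe_biUnion, Set.mem_iUnion, Finset.mem_coe, Fintype.mem_piFinset,
        hX.mem_ball]
      refine ⟨g⁻¹ o, ?_, fun s => ?_⟩
      · exact ((hX.isLength_len o).inv g).le.trans hg
      · rw [dist_map]
        exact hD s s.2
    refine ⟨R, hNR, B.finite_toSet.subset hsub, ?_⟩
    have h1 := Set.ncard_le_ncard hsub B.finite_toSet
    rw [Set.ncard_coe_finset] at h1
    have h2 : #B ≤ vol X R * vol X D ^ #S := by
      refine Finset.card_biUnion_le.trans ?_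
      simp [Fintype.card_piFinset, hX.card_ball]
    calc _ ≤ ((vol X R * vol X D ^ #S : ℕ) : ℝ) := by exact_mod_cast h1.trans h2
      _ = vol X R * (vol X D : ℝ) ^ #S := by push_cast; ring
      _ ≤ C * R ^ 2 * (vol X D : ℝ) ^ #S := by gcongr
      _ = _ := by ring
  · refine ContinuousLinearMap.ext fun x => Subtype.ext ?_
    obtain ⟨_, u, rfl⟩ := x
    change pairShift g (gradMap X u) = pairShift h (gradMap X u)
    rw [hX.pairShift_gradMap, hX.pairShift_gradMap]
    congr 1
    rw [← sub_eq_zero]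
    refine hS _ fun s hs => ?_
    change u.1 (g⁻¹ s) - u.1 (h⁻¹ s) = 0
    rw [show g⁻¹ s = h⁻¹ s from congrFun hgh ⟨s, hs⟩, sub_self]

/-- Some nonconstant Lipschitz harmonic function is an eigenfunction, modulo constants, of a good
group of automorphisms, the generators having eigenvalues close to `1`. -/
lemma exists_eigen_harmonic (hq : QuadSubseq X) (ham : Amenable X) (o : V) :
    ∃ (S : Set (X ≃g X)) (u : V → ℂ) (χ : (X ≃g X) → ℂ), Good (len X o) (Subgroup.closure S) ∧
      u ∈ lipHarm X ℂ ∧ (∃ x y, u x ≠ u y) ∧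
      (∀ g ∈ Subgroup.closure S, ‖χ g‖ = 1 ∧ ∀ x y, u (g x) - u (g y) = χ g * (u x - u y)) ∧
      ∀ s ∈ S, ‖χ s - 1‖ < 1 / 40 := by
  have := hX.finiteDimensional_lipHarm hq ham
  obtain ⟨T, hslow, hT⟩ := hX.exists_slow_gradRep hq ham o
  have hadj : ∀ u : lipHarm X ℂ, gradMap X u = 0 → ∀ x y, u.1 x - u.1 y = 0 := by
    intro u hu
    refine hX.sub_eq_of_adj (f := fun x y => u.1 x - u.1 y) (fun x y z => by ring) fun x y hxy => ?_
    have := gradMap_apply u (x, y)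
    rw [hu, if_pos hxy] at this
    exact this.symm
  have : Nontrivial (LinearMap.range (gradMap X)) := by
    obtain ⟨h, hh, hlip, s, hs⟩ := hX.exists_harmonic hq o
    have hmem : (fun x => (h x : ℂ)) ∈ lipHarm X ℂ := by
      refine ⟨fun x => ?_, 1, fun x y hxy => ?_⟩
      · have := hh x
        dsimp only
        exact_mod_cast congrArg (fun r : ℝ => (r : ℂ)) this
      · rw [← Complex.ofReal_sub, Complex.norm_real]
        exact hlip x y hxy
    refine ⟨⟨⟨gradMap X ⟨_, hmem⟩, ⟨_, rfl⟩⟩, 0, fun h0 => hs ?_⟩⟩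
    have := hadj ⟨_, hmem⟩ (congrArg Subtype.val h0) s o
    dsimp only at this
    exact_mod_cast sub_eq_zero.mp this
  obtain ⟨S, φ, χ, hgood, hφ, hχ, hS⟩ := exists_common_eigenvector (hX.isLength_len o)
    (ρ := hX.gradRep) (fun g x => norm_pairShift g x) (hX.good_top o) hT hslow
  obtain ⟨_, u, rfl⟩ := φ
  refine ⟨S, u, fun g => χ g⁻¹, hgood, u.2, ?_, fun g hg => ⟨(hχ g⁻¹ (inv_mem hg)).1, ?_⟩, hS⟩
  · by_contra hc
    push Not at hc
    refine hφ (Subtype.ext ?_)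
    ext p
    change gradMap X u p = 0
    rw [gradMap_apply, hc p.1 p.2, sub_self, ite_self]
  · have h1 : pairShift g⁻¹ (gradMap X u) = χ g⁻¹ • gradMap X u :=
      congrArg Subtype.val (hχ g⁻¹ (inv_mem hg)).2
    rw [hX.pairShift_gradMap, ← map_smul, ← sub_eq_zero, ← map_sub] at h1
    intro x y
    have h2 := hadj _ h1 x y
    change (u.1 (g⁻¹⁻¹ x) - χ g⁻¹ * u.1 x) - (u.1 (g⁻¹⁻¹ y) - χ g⁻¹ * u.1 y) = 0 at h2
    rw [inv_inv] at h2
    linear_combination h2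

end Homog
end TransGraph

namespace TransGraph
open scoped Classical
open Finset

variable {V : Type*} {X : SimpleGraph V}

lemma Good.exists_orbit_reps {o : V} {l : (X ≃g X) → ℕ} {H : Subgroup (X ≃g X)} (hH : Good l H)
    (htrans : ∀ x y, ∃ φ : X ≃g X, φ x = y) :
    ∃ S₀ : Finset V, ∀ x, ∃ g ∈ H, ∃ y ∈ S₀, g y = x := by
  obtain ⟨⟨T, hT, hcov⟩, -⟩ := hH
  refine ⟨(hT.image fun t => t⁻¹ o).toFinset, fun x => ?_⟩
  obtain ⟨φ, rfl⟩ := htrans o x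
  obtain ⟨t, ht, h⟩ := hcov φ⁻¹
  refine ⟨(t⁻¹ * φ⁻¹)⁻¹, inv_mem h, t⁻¹ o, by simpa using ⟨t, ht, rfl⟩, ?_⟩
  rw [mul_inv_rev, inv_inv, inv_inv, RelIso.mul_apply, RelIso.apply_inv_self]

namespace Homog
variable (hX : Homog X)
include hX

/-- The maximum principle. -/
lemma eq_of_norm_le {w : V → ℂ} (hw : IsHarm X w) {y : V} (hy : ∀ x, ‖w x‖ ≤ ‖w y‖) (x : V) :
    w x = w y := by
  have hstep : ∀ a b, X.Adj a b → w a = w y → w b = w y := by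
    intro a b hab ha
    have h1 : ∑ c ∈ nbr X a, Complex.normSq (w c - w a) ≤ 0 := by
      have h2 : ∑ c ∈ nbr X a, Complex.normSq (w c - w a) =
          ∑ c ∈ nbr X a, (Complex.normSq (w c) - Complex.normSq (w a)) -
            2 * ((starRingEnd ℂ) (w a) * ∑ c ∈ nbr X a, (w c - w a)).re := by
        rw [Finset.mul_sum, Complex.re_sum, Finset.mul_sum, ← Finset.sum_sub_distrib]
        refine Finset.sum_congr rfl fun c _ => ?_
        simp only [Complex.normSq_apply, Complex.mul_re, Complex.conj_re, Complex.conj_im,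
          Complex.sub_re, Complex.sub_im]
        ring
      rw [h2, hw a, mul_zero, Complex.zero_re, mul_zero, sub_zero]
      refine Finset.sum_nonpos fun c _ => ?_
      rw [Complex.normSq_eq_norm_sq, Complex.normSq_eq_norm_sq, ha]
      have := pow_le_pow_left₀ (norm_nonneg _) (hy c) 2
      linarith
    have h3 := (Finset.sum_eq_zero_iff_of_nonneg fun c _ => Complex.normSq_nonneg _).mp
      (le_antisymm h1 (Finset.sum_nonneg fun c _ => Complex.normSq_nonneg _)) b (hX.mem_nbr.mpr hab)
    rw [← ha]
    exact sub_eq_zero.mp (Complex.normSq_eq_zero.mp h3)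
  obtain ⟨p⟩ := hX.conn.preconnected y x
  have : ∀ a b (_ : X.Walk a b), w a = w y → w b = w y := by
    intro a b p
    induction p with
    | nil => exact id
    | cons h _ ih => exact fun ha => ih (hstep _ _ h ha)
  exact this y x p rfl

/-- A harmonic function whose modulus is invariant under a good group is constant. -/
lemma eq_of_norm_invariant {w : V → ℂ} (hw : IsHarm X w) {l : (X ≃g X) → ℕ}
    {H : Subgroup (X ≃g X)} (hH : Good l H) (hinv : ∀ g ∈ H, ∀ x, ‖w (g x)‖ = ‖w x‖) (x y : V) :
    w x = w y := by
  obtain ⟨S₀, hS₀⟩ := hH.exists_orbit_reps (o := x) hX.trans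
  have hne : S₀.Nonempty := by
    obtain ⟨g, -, z, hz, -⟩ := hS₀ x
    exact ⟨z, hz⟩
  obtain ⟨m, hm, hmax⟩ := S₀.exists_max_image (fun z => ‖w z‖) hne
  have hle : ∀ z, ‖w z‖ ≤ ‖w m‖ := by
    intro z
    obtain ⟨g, hg, a, ha, rfl⟩ := hS₀ z
    rw [hinv g hg]
    exact hmax a ha
  rw [hX.eq_of_norm_le hw hle x, hX.eq_of_norm_le hw hle y]

lemma slow_orbit (hq : QuadSubseq X) (o : V) : Slow (len X o) (fun g : X ≃g X => g o) := by
  obtain ⟨C, hC, h⟩ := hq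
  refine ⟨C, hC, fun N => ?_⟩
  obtain ⟨R, hR, hle⟩ := h N
  have hsub : (fun g : X ≃g X => g o) '' {g | len X o g ≤ R} ⊆ ball X o R := by
    rintro _ ⟨g, hg, rfl⟩
    exact hX.mem_ball.mpr hg
  refine ⟨R, hR, (ball X o R).finite_toSet.subset hsub, le_trans ?_ hle⟩
  have := Set.ncard_le_ncard hsub (ball X o R).finite_toSet
  rw [Set.ncard_coe_finset, hX.card_ball] at this
  exact_mod_cast this

/-- Slow growth forces eigenvalues close to `1` to be equal to `1`. -/
lemma eigenvalue_eq_one (hq : QuadSubseq X) {o : V} {S : Set (X ≃g X)} {u : V → ℂ}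
    {χ : (X ≃g X) → ℂ} (hgood : Good (len X o) (Subgroup.closure S)) (hu : IsHarm X u)
    (hne : ∃ x y, u x ≠ u y)
    (hχ : ∀ g ∈ Subgroup.closure S, ‖χ g‖ = 1 ∧ ∀ x y, u (g x) - u (g y) = χ g * (u x - u y))
    {s : X ≃g X} (hs : s ∈ S) (hs1 : ‖χ s - 1‖ < 1 / 40) : χ s = 1 := by
  by_contra hne1
  set H := Subgroup.closure S with hH
  have hsH : s ∈ H := Subgroup.subset_closure hs
  have hχ0 : ∀ g ∈ H, χ g ≠ 0 := fun g hg h => by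
    have := (hχ g hg).1
    rw [h, norm_zero] at this
    exact zero_ne_one this
  have hχmul : ∀ g ∈ H, ∀ h ∈ H, χ (g * h) = χ g * χ h := by
    intro g hg h hh
    obtain ⟨x, y, hxy⟩ := hne
    have h1 := (hχ _ (mul_mem hg hh)).2 x y
    rw [RelIso.mul_apply, RelIso.mul_apply, (hχ g hg).2, (hχ h hh).2, ← mul_assoc] at h1
    exact (mul_right_cancel₀ (sub_ne_zero.mpr hxy) h1).symm
  have hχone : χ 1 = 1 := by
    have := hχmul 1 (one_mem H) 1 (one_mem H)
    rw [mul_one] at this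
    exact (mul_eq_left₀ (hχ0 1 (one_mem H))).mp this.symm
  have hχinv : ∀ g ∈ H, χ g * χ g⁻¹ = 1 := fun g hg => by
    rw [← hχmul g hg _ (inv_mem hg), mul_inv_cancel, hχone]
  have hχcomm : ∀ g ∈ H, ∀ h ∈ H, χ (g * h * g⁻¹ * h⁻¹) = 1 := by
    intro g hg h hh
    rw [hχmul _ (mul_mem (mul_mem hg hh) (inv_mem hg)) _ (inv_mem hh),
      hχmul _ (mul_mem hg hh) _ (inv_mem hg), hχmul g hg h hh]
    linear_combination χ h * χ h⁻¹ * hχinv g hg + hχinv h hh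
  -- the displacement of a commutator
  have hdisp : ∀ g ∈ H, ∀ h ∈ H, u ((g * h * g⁻¹ * h⁻¹) o) - u o =
      (χ g - 1) * (u (h o) - u o) + (1 - χ h) * (u (g o) - u o) := by
    intro g hg h hh
    have h1 := (hχ g hg).2 (h (g⁻¹ (h⁻¹ o))) o
    have h2 := (hχ h hh).2 (g⁻¹ (h⁻¹ o)) o
    have h3 := (hχ g hg).2 (g⁻¹ (h⁻¹ o)) o
    have h4 := (hχ h hh).2 (h⁻¹ o) o
    rw [RelIso.apply_inv_self] at h3 h4
    change u (g (h (g⁻¹ (h⁻¹ o)))) - u o = _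
    linear_combination h1 + χ g * h2 - χ h * h3 - h4
  have hlen := hX.isLength_len o
  let N : H → ℝ := fun g => ‖u ((g : X ≃g X) o) - u o‖
  have hN : IsPseudoLength N := by
    refine ⟨by simp [N], fun g h => ?_, fun g => ?_⟩
    · have h1 := (hχ g g.2).2 ((h : X ≃g X) o) o
      have h2 : u (((g * h : H) : X ≃g X) o) - u o =
          χ g * (u ((h : X ≃g X) o) - u o) + (u ((g : X ≃g X) o) - u o) := by
        rw [← h1]; change u ((g : X ≃g X) ((h : X ≃g X) o)) - u o = _; ring
      change ‖_‖ ≤ _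
      rw [h2, add_comm (N g)]
      refine (norm_add_le _ _).trans_eq ?_
      rw [norm_mul, (hχ g g.2).1, one_mul]
    · have h1 := (hχ g g.2).2 ((g : X ≃g X)⁻¹ o) o
      rw [RelIso.apply_inv_self] at h1
      change ‖u ((g : X ≃g X)⁻¹ o) - u o‖ = ‖u ((g : X ≃g X) o) - u o‖
      rw [norm_sub_rev (u ((g : X ≃g X) o)), h1, norm_mul, (hχ g g.2).1, one_mul]
  let P : H → Prop := fun g => χ g = 1 ∧ 0 < N g
  have hpow : ∀ g : H, χ g = 1 → ∀ e : ℕ,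
      u (((g ^ e : H) : X ≃g X) o) - u o = e * (u ((g : X ≃g X) o) - u o) := by
    intro g hg e
    induction e with
    | zero => simp
    | succ e ih =>
      have h1 := (hχ g g.2).2 (((g ^ e : H) : X ≃g X) o) o
      rw [hg, one_mul, ih] at h1
      rw [pow_succ']
      change u ((g : X ≃g X) (((g ^ e : H) : X ≃g X) o)) - u o = _
      push_cast
      linear_combination h1
  have hex : ∃ g₀, P g₀ := by
    by_contra hno
    push Not at hno
    have hzero : ∀ g ∈ H,
        (χ g - 1) * (u (s o) - u o) + (1 - χ s) * (u (g o) - u o) = 0 := by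
      intro g hg
      rw [← hdisp g hg s hsH]
      by_contra h
      refine hno ⟨_, mul_mem (mul_mem (mul_mem hg hsH) (inv_mem hg)) (inv_mem hsH)⟩
        ⟨hχcomm g hg s hsH, norm_pos_iff.mpr h⟩
    have hd : 1 - χ s ≠ 0 := sub_ne_zero.mpr (Ne.symm hne1)
    set p : ℂ := u o + (u (s o) - u o) / (1 - χ s) with hp
    have hfix : ∀ g ∈ H, ∀ x, u (g x) - p = χ g * (u x - p) := by
      intro g hg x
      have h1 := (hχ g hg).2 x o
      have h2 := hzero g hg
      have h3 : (1 - χ s) * (p - u o) = u (s o) - u o := by rw [hp]; field_simp; ring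
      rw [← h3] at h2
      have h4 : (χ g - 1) * (p - u o) + (u (g o) - u o) = 0 := by
        refine (mul_eq_zero.mp ?_).resolve_left hd
        linear_combination h2
      linear_combination h1 + h4
    obtain ⟨x, y, hxy⟩ := hne
    have hharm : IsHarm X fun x => u x - p := fun x => by
      rw [← hu x]; exact Finset.sum_congr rfl fun y _ => by ring
    have := hX.eq_of_norm_invariant hharm hgood (fun g hg x => by
      rw [hfix g hg, norm_mul, (hχ g hg).1, one_mul]) x y
    exact hxy (sub_left_injective this)
  obtain ⟨g₀, hg₀⟩ := hex
  refine not_slow_of_step (hlen.subgroup H) hN (F := fun g : H => (g : X ≃g X) o) ?_ P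
    (L := 2 * len X o s) (fun g hg => hg.2) ?_ ?_ hg₀ ((hX.slow_orbit hq o).subgroup H)
  · intro g h hgh
    change g.1 o = h.1 o at hgh
    change ‖u (g.1⁻¹ (h.1 o)) - u o‖ = 0
    rw [← hgh, RelIso.inv_apply_self, sub_self, norm_zero]
  · intro g hg e he _
    change N g / 2 ≤ ‖_‖
    rw [hpow g hg.1, norm_mul, Complex.norm_natCast]
    have h1 : (1 : ℝ) ≤ e := by exact_mod_cast he
    have h2 := hg.2
    change _ ≤ e * N g
    nlinarith
  · intro g hg
    have h1 := hdisp s hsH g g.2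
    rw [hg.1, sub_self, zero_mul, add_zero] at h1
    have h2 : N (⟨s, hsH⟩ * g * ⟨s, hsH⟩⁻¹ * g⁻¹) = ‖χ s - 1‖ * N g := by
      rw [← norm_mul, ← h1]; rfl
    refine ⟨⟨s, hsH⟩ * g * ⟨s, hsH⟩⁻¹ * g⁻¹, ⟨hχcomm s hsH g g.2, ?_⟩, ?_, ?_⟩
    · rw [h2]
      exact mul_pos (norm_pos_iff.mpr (sub_ne_zero.mpr hne1)) hg.2
    · rw [h2]
      have := hg.2
      nlinarith
    · have := hlen.commutator_le s g
      change len X o (s * g * s⁻¹ * (g : X ≃g X)⁻¹) ≤ 2 * len X o g + 2 * len X o s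
      omega

/-- Some good group translates the values of a nonconstant Lipschitz harmonic function. -/
lemma exists_translated_harmonic (hq : QuadSubseq X) (ham : Amenable X) (o : V) :
    ∃ (H : Subgroup (X ≃g X)) (u : V → ℂ), Good (len X o) H ∧ u ∈ lipHarm X ℂ ∧
      (∃ x y, u x ≠ u y) ∧ ∀ g ∈ H, ∀ x y, u (g x) - u (g y) = u x - u y := by
  obtain ⟨S, u, χ, hgood, hu, hne, hχ, hS⟩ := hX.exists_eigen_harmonic hq ham o
  refine ⟨_, u, hgood, hu, hne, fun g hg => ?_⟩
  induction hg using Subgroup.closure_induction with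
  | mem s hs =>
    intro x y
    rw [(hχ s (Subgroup.subset_closure hs)).2,
      hX.eigenvalue_eq_one hq hgood hu.1 hne hχ hs (hS s hs), one_mul]
  | one => intro x y; rfl
  | mul a b _ _ iha ihb =>
    intro x y
    rw [RelIso.mul_apply, RelIso.mul_apply, iha, ihb]
  | inv a _ ih =>
    intro x y
    have := ih (a⁻¹ x) (a⁻¹ y)
    rwa [RelIso.apply_inv_self, RelIso.apply_inv_self, eq_comm] at this

end Homog
end TransGraph

namespace TransGraph
open scoped Classical
open Finset

variable {V : Type*} {X : SimpleGraph V}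

/-- The subgroup generated by the conjugates of `B` by `g ^ i` for `i ≤ k`. -/
def conjClosure {Γ : Type*} [Group Γ] (g : Γ) (B : Set Γ) (k : ℕ) : Subgroup Γ :=
  Subgroup.closure {x | ∃ i ≤ k, ∃ b ∈ B, x = g ^ i * b * (g ^ i)⁻¹}

lemma conjClosure_mono {Γ : Type*} [Group Γ] (g : Γ) (B : Set Γ) {k k' : ℕ} (h : k ≤ k') :
    conjClosure g B k ≤ conjClosure g B k' :=
  Subgroup.closure_mono fun _ ⟨i, hi, hx⟩ => ⟨i, hi.trans h, hx⟩

lemma conj_mem_conjClosure {Γ : Type*} [Group Γ] {g : Γ} {B : Set Γ} {k : ℕ}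
    (h : ∀ b ∈ B, g ^ (k + 1) * b * (g ^ (k + 1))⁻¹ ∈ conjClosure g B k) (n : ℕ) {b : Γ}
    (hb : b ∈ B) : g ^ n * b * (g ^ n)⁻¹ ∈ conjClosure g B k := by
  have hconj : ∀ x ∈ conjClosure g B k, g * x * g⁻¹ ∈ conjClosure g B k := by
    intro x hx
    change MulAut.conj g x ∈ _
    induction hx using Subgroup.closure_induction with
    | mem x hx =>
      obtain ⟨i, hi, b, hb, rfl⟩ := hx
      have h1 : MulAut.conj g (g ^ i * b * (g ^ i)⁻¹) = g ^ (i + 1) * b * (g ^ (i + 1))⁻¹ := by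
        rw [MulAut.conj_apply, pow_succ']; group
      rw [h1]
      rcases hi.lt_or_eq with hi | rfl
      · exact Subgroup.subset_closure ⟨i + 1, hi, b, hb, rfl⟩
      · exact h b hb
    | one => rw [map_one]; exact one_mem _
    | mul x y _ _ ihx ihy => rw [map_mul]; exact mul_mem ihx ihy
    | inv x _ ih => rw [map_inv]; exact inv_mem ih
  induction n with
  | zero => exact Subgroup.subset_closure ⟨0, Nat.zero_le _, b, hb, rfl⟩
  | succ n ih =>
    have h1 : g ^ (n + 1) * b * (g ^ (n + 1))⁻¹ = g * (g ^ n * b * (g ^ n)⁻¹) * g⁻¹ := by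
      rw [pow_succ']; group
    rw [h1]
    exact hconj _ ih

lemma dist_orbit {Γ : Type*} [Group Γ] (φ : Γ →* (X ≃g X)) (o : V) (a b : Γ) : X.dist (φ a o) (φ b o) = len X o (φ (a⁻¹ * b)) := by
  have := dist_map (φ a) o (φ (a⁻¹ * b) o)
  rw [← RelIso.mul_apply, ← map_mul, mul_inv_cancel_left] at this
  exact this

namespace Homog
variable (hX : Homog X)
include hX

lemma card_mul_vol_le {ι : Type*} (I : Finset ι) (p : ι → V) {n r : ℕ} (o : V)
    (hr : ∀ i ∈ I, X.dist o (p i) ≤ r)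
    (hsep : ∀ i ∈ I, ∀ j ∈ I, i ≠ j → 2 * n < X.dist (p i) (p j)) :
    #I * vol X n ≤ vol X (r + n) := by
  have h1 : #(I.biUnion fun i => ball X (p i) n) = #I * vol X n := by
    rw [Finset.card_biUnion]
    · simp [hX.card_ball]
    · intro i hi j hj hij
      refine Finset.disjoint_left.mpr fun x hx hx' => ?_
      rw [hX.mem_ball] at hx hx'
      have h2 := hX.tri (p i) x (p j)
      rw [X.dist_comm (u := x)] at h2
      have := hsep i hi j hj hij
      omega
  rw [← h1, ← hX.card_ball o]
  refine Finset.card_le_card fun x hx => ?_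
  obtain ⟨i, hi, hx⟩ := Finset.mem_biUnion.mp hx
  rw [hX.mem_ball] at hx ⊢
  have h2 := hX.tri o (p i) x
  have := hr i hi
  omega

lemma not_exponential (hq : QuadSubseq X) (A : ℕ) : ¬ ∀ k, 2 ^ k ≤ vol X (k * A) := by
  intro hexp
  obtain ⟨C, hC, h⟩ := hq
  have hlim := tendsto_pow_const_div_const_pow_of_one_lt 2 (one_lt_two : (1 : ℝ) < 2)
  have hpos : (0 : ℝ) < 1 / (2 * C * (A + 1) ^ 2) := by positivity
  obtain ⟨k₀, hk₀⟩ := Filter.eventually_atTop.mp (hlim.eventually (gt_mem_nhds hpos))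
  obtain ⟨R, hR, hvol⟩ := h (k₀ * (A + 1))
  set k := R / (A + 1) with hk
  have h1 : k₀ ≤ k := (Nat.le_div_iff_mul_le (Nat.succ_pos A)).mpr hR
  have h2 : R < (k + 1) * (A + 1) := by
    have := Nat.lt_div_mul_add (a := R) (Nat.succ_pos A)
    rw [← Nat.succ_eq_add_one, Nat.succ_mul]
    exact this
  have h3 : k * A ≤ R := by
    have := Nat.div_mul_le_self R (A + 1)
    exact (Nat.mul_le_mul_left _ (Nat.le_succ A)).trans this
  have h4 : ((2 : ℝ) ^ k) ≤ C * R ^ 2 := by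
    refine le_trans ?_ hvol
    exact_mod_cast (hexp k).trans (hX.vol_mono h3)
  have h5 := hk₀ (k + 1) (h1.trans (Nat.le_succ k))
  rw [div_lt_div_iff₀ (by positivity) (by positivity), one_mul, pow_succ (2 : ℝ)] at h5
  have h6 : (R : ℝ) ≤ (k + 1) * (A + 1) := by exact_mod_cast h2.le
  have h7 : (R : ℝ) ^ 2 ≤ ((k + 1) * (A + 1)) ^ 2 := pow_le_pow_left₀ (by positivity) h6 2
  push_cast at h5
  nlinarith

variable {Γ : Type*} [Group Γ] (φ : Γ →* (X ≃g X)) (o : V)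

lemma isLength_comp : IsLength fun γ => len X o (φ γ) :=
  ⟨by rw [map_one]; exact (hX.isLength_len o).one,
    fun g h => by rw [map_mul]; exact (hX.isLength_len o).mul_le _ _,
    fun g => by rw [map_inv]; exact (hX.isLength_len o).inv _⟩

/-- Milnor's argument: in slow growth, the conjugates of a bounded set by the powers of an element
lie in the group generated by finitely many of these conjugates. -/
lemma exists_conjClosure (hq : QuadSubseq X) (g : Γ) {B : Set Γ} {L : ℕ}
    (hB : ∀ b ∈ B, len X o (φ b) ≤ L) (hstab : ∀ γ, φ γ o = o → γ ∈ B) :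
    ∃ k, ∀ n, ∀ b ∈ B, g ^ n * b * (g ^ n)⁻¹ ∈ conjClosure g B k := by
  suffices h : ∃ k, ∀ b ∈ B, g ^ (k + 1) * b * (g ^ (k + 1))⁻¹ ∈ conjClosure g B k by
    obtain ⟨k, hk⟩ := h
    exact ⟨k, fun n b hb => conj_mem_conjClosure hk n hb⟩
  by_contra hno
  push Not at hno
  choose b hbB hb using hno
  have hl := hX.isLength_comp φ o
  set A := L + len X o (φ g) with hA
  refine hX.not_exponential hq (A + len X o (φ g)) fun k => ?_
  have key : ∃ Z : Finset Γ, #Z = 2 ^ k ∧ (∀ p ∈ Z, p ∈ conjClosure g B k) ∧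
      (∀ p ∈ Z, len X o (φ ((g ^ k)⁻¹ * p)) ≤ k * A) ∧
      ∀ p ∈ Z, ∀ q ∈ Z, φ p o = φ q o → p = q := by
    induction k with
    | zero =>
      refine ⟨{1}, by simp, ?_, ?_, ?_⟩
      · intro p hp
        rw [Finset.mem_singleton.mp hp]
        exact one_mem _
      · intro p hp
        rw [Finset.mem_singleton.mp hp, pow_zero, inv_one, mul_one, hl.one]
        exact Nat.zero_le _
      · intro p hp q hq _
        rw [Finset.mem_singleton.mp hp, Finset.mem_singleton.mp hq]
    | succ k ih =>
      obtain ⟨Z, hcard, hmem, hlen, hinj⟩ := ih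
      set c := g ^ (k + 1) * b k * (g ^ (k + 1))⁻¹ with hc
      have hne : ∀ p ∈ Z, ∀ q ∈ Z, φ (c * p) o ≠ φ q o := by
        intro p hp q hq h
        refine hb k ?_
        have h1 : φ (q⁻¹ * (c * p)) o = o := by
          rw [map_mul, RelIso.mul_apply, h, ← RelIso.mul_apply, ← map_mul, inv_mul_cancel, map_one]
          rfl
        have h2 : q⁻¹ * (c * p) ∈ conjClosure g B k :=
          Subgroup.subset_closure ⟨0, Nat.zero_le _, _, hstab _ h1, by simp⟩
        have h3 : c = q * (q⁻¹ * (c * p)) * p⁻¹ := by group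
        rw [← hc, h3]
        exact mul_mem (mul_mem (hmem q hq) h2) (inv_mem (hmem p hp))
      refine ⟨Z ∪ Z.image (c * ·), ?_, ?_, ?_, ?_⟩
      · rw [Finset.card_union_of_disjoint, Finset.card_image_of_injective _ (mul_right_injective c),
          hcard, pow_succ]
        · ring
        · refine Finset.disjoint_left.mpr fun q hq hq' => ?_
          obtain ⟨p, hp, rfl⟩ := Finset.mem_image.mp hq'
          exact hne p hp _ hq rfl
      · intro p hp
        rcases Finset.mem_union.mp hp with hp | hp
        · exact conjClosure_mono g B (Nat.le_succ k) (hmem p hp)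
        · obtain ⟨p, hp1, rfl⟩ := Finset.mem_image.mp hp
          exact mul_mem (Subgroup.subset_closure ⟨k + 1, le_rfl, _, hbB k, rfl⟩)
            (conjClosure_mono g B (Nat.le_succ k) (hmem p hp1))
      · intro p hp
        have h0 := hl.inv g
        rcases Finset.mem_union.mp hp with hp | hp
        · have h1 : (g ^ (k + 1))⁻¹ * p = g⁻¹ * ((g ^ k)⁻¹ * p) := by rw [pow_succ]; group
          have h2 := hl.mul_le g⁻¹ ((g ^ k)⁻¹ * p)
          have h3 := hlen p hp
          rw [h1, add_mul]
          omega
        · obtain ⟨p, hp1, rfl⟩ := Finset.mem_image.mp hp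
          have h1 : (g ^ (k + 1))⁻¹ * (c * p) = b k * (g⁻¹ * ((g ^ k)⁻¹ * p)) := by
            rw [hc, pow_succ]; group
          have h2 := hl.mul_le g⁻¹ ((g ^ k)⁻¹ * p)
          have h4 := hl.mul_le (b k) (g⁻¹ * ((g ^ k)⁻¹ * p))
          have h3 := hlen p hp1
          have h5 := hB _ (hbB k)
          rw [h1, add_mul]
          omega
      · intro p hp q hq hpq
        rcases Finset.mem_union.mp hp with hp | hp <;> rcases Finset.mem_union.mp hq with hq | hq
        · exact hinj p hp q hq hpq
        · obtain ⟨q, hq1, rfl⟩ := Finset.mem_image.mp hq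
          exact absurd hpq.symm (hne q hq1 p hp)
        · obtain ⟨p, hp1, rfl⟩ := Finset.mem_image.mp hp
          exact absurd hpq (hne p hp1 q hq)
        · obtain ⟨p, hp1, rfl⟩ := Finset.mem_image.mp hp
          obtain ⟨q, hq1, rfl⟩ := Finset.mem_image.mp hq
          rw [map_mul φ c p, map_mul φ c q, RelIso.mul_apply, RelIso.mul_apply] at hpq
          rw [hinj p hp1 q hq1 ((φ c).injective hpq)]
  obtain ⟨Z, hcard, -, hlen, hinj⟩ := key
  rw [← hcard, ← Finset.card_image_of_injOn (f := fun p => φ p o) fun p hp q hq h => hinj p hp q hq h,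
    ← hX.card_ball o]
  refine Finset.card_le_card fun x hx => ?_
  obtain ⟨p, hp, rfl⟩ := Finset.mem_image.mp hx
  rw [hX.mem_ball]
  have h1 := hl.mul_le (g ^ k) ((g ^ k)⁻¹ * p)
  have h2 := hl.pow_le g k
  have h3 := hlen p hp
  rw [mul_inv_cancel_left] at h1
  rw [mul_add]
  change len X o (φ p) ≤ _
  omega

/-- Along a cocompact orbit, a subadditive function bounded on elements of bounded length grows
at most linearly. -/
lemma le_of_subadditive {D : ℕ} (hD : ∀ x, ∃ γ, X.dist x (φ γ o) ≤ D) {f : Γ → ℕ} {C : ℕ}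
    (hf : ∀ a b, f (a * b) ≤ f a + f b) (hC : ∀ γ, len X o (φ γ) ≤ 2 * D + 1 → f γ ≤ C) (γ : Γ) :
    f γ ≤ C * (len X o (φ γ) + 1) := by
  have key : ∀ n : ℕ, ∀ γ, len X o (φ γ) ≤ n + D → f γ ≤ C * (n + 1) := by
    intro n
    induction n with
    | zero => intro γ h; rw [zero_add, mul_one]; exact hC γ (by omega)
    | succ n ih =>
      intro γ h
      rcases Nat.lt_or_ge (len X o (φ γ)) (n + 1 + D) with h1 | h1
      · exact (ih γ (by omega)).trans (Nat.mul_le_mul_left _ (Nat.le_succ _))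
      · obtain ⟨x, hx, hx'⟩ := hX.exists_between (x := o) (y := φ γ o) (k := n) (l := D + 1)
          (by change len X o (φ γ) = _; omega)
        obtain ⟨η, hη⟩ := hD x
        have h2 := hX.tri o x (φ η o)
        have h3 := hX.tri (φ η o) x (φ γ o)
        rw [X.dist_comm (u := φ η o) (v := x), dist_orbit φ o] at h3
        have h4 := hf η (η⁻¹ * γ)
        rw [mul_inv_cancel_left] at h4
        have h5 := ih η (by change X.dist o (φ η o) ≤ _; omega)
        have h6 := hC (η⁻¹ * γ) (by omega)
        calc f γ ≤ C * (n + 1) + C := h4.trans (add_le_add h5 h6)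
          _ = _ := by ring
  exact key _ γ (Nat.le_add_right _ _)

/-- A group with a cocompact orbit is generated by its elements of bounded length. -/
lemma closure_eq_top {D : ℕ} (hD : ∀ x, ∃ γ, X.dist x (φ γ o) ≤ D) :
    Subgroup.closure {γ | len X o (φ γ) ≤ 2 * D + 1} = ⊤ := by
  rw [Subgroup.eq_top_iff']
  intro γ
  have := hX.le_of_subadditive φ o hD (C := 0)
    (f := fun γ => if γ ∈ Subgroup.closure {γ | len X o (φ γ) ≤ 2 * D + 1} then 0 else 1)
    (fun a b => by
      by_cases ha : a ∈ Subgroup.closure {γ | len X o (φ γ) ≤ 2 * D + 1}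
      · by_cases hb : b ∈ Subgroup.closure {γ | len X o (φ γ) ≤ 2 * D + 1}
        · simp only [if_pos (mul_mem ha hb)]; exact Nat.zero_le _
        · simp only [if_neg hb]; split_ifs <;> omega
      · simp only [if_neg ha]; split_ifs <;> omega)
    (fun γ hγ => (if_pos (show γ ∈ Subgroup.closure _ from Subgroup.subset_closure hγ)).le) γ
  by_contra hγ
  simp [if_neg hγ] at this

end Homog
end TransGraph

namespace TransGraph
open scoped Classical
open Finset

variable {V : Type*} {X : SimpleGraph V}

lemma IsLength.zpow_le {Γ : Type*} [Group Γ] {l : Γ → ℕ} (hl : IsLength l) (g : Γ) (n : ℤ) :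
    l (g ^ n) ≤ n.natAbs * l g := by
  obtain ⟨m, rfl | rfl⟩ := n.eq_nat_or_neg
  · rw [zpow_natCast, Int.natAbs_natCast]
    exact hl.pow_le g m
  · rw [zpow_neg, zpow_natCast, Int.natAbs_neg, Int.natAbs_natCast, hl.inv]
    exact hl.pow_le g m

namespace Homog
variable (hX : Homog X)
include hX

lemma quadGrowth_of_vol {C : ℕ} (h : ∀ n, 1 ≤ n → vol X n ≤ C * n ^ 2) : QuadGrowth X := by
  refine ⟨C + 1, by positivity, fun v n hn => ?_⟩
  have h1 : {u | X.dist u v ≤ n} = (ball X v n : Set V) := by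
    ext u
    rw [Finset.mem_coe, hX.mem_ball, X.dist_comm]
    rfl
  rw [h1, Set.ncard_coe_finset, hX.card_ball]
  have h2 : (vol X n : ℝ) ≤ C * n ^ 2 := by exact_mod_cast h n hn
  nlinarith [sq_nonneg (n : ℝ)]

variable {Γ : Type*} [Group Γ] (φ : Γ →* (X ≃g X)) (o : V) {D : ℕ}
  (hD : ∀ x, ∃ γ, X.dist x (φ γ o) ≤ D) {τ : Γ → ℤ} (hτ : ∀ a b, τ (a * b) = τ a + τ b)
  (horb : ∀ a, φ a o = o → τ a = 0)
include hD hτ horb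

/-- A height function on a cocompact group of automorphisms grows at most linearly. -/
lemma exists_natAbs_height_le :
    ∃ C : ℕ, 1 ≤ C ∧ ∀ γ, (τ γ).natAbs ≤ C * (len X o (φ γ) + 1) := by
  have hfac : Function.FactorsThrough (fun γ => (τ γ).natAbs) (fun γ => φ γ o) := by
    intro a b hab
    have h1 : φ (a⁻¹ * b) o = o := by
      change φ a o = φ b o at hab
      rw [map_mul, RelIso.mul_apply, ← hab, map_inv, RelIso.inv_apply_self]
    have h2 := hτ a (a⁻¹ * b)
    rw [mul_inv_cancel_left, horb _ h1, add_zero] at h2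
    change (τ a).natAbs = (τ b).natAbs
    rw [h2]
  set t := Function.extend (fun γ => φ γ o) (fun γ => (τ γ).natAbs) 0 with ht
  refine ⟨(ball X o (2 * D + 1)).sup t + 1, Nat.le_add_left _ _, fun γ => ?_⟩
  refine hX.le_of_subadditive φ o hD (f := fun γ => (τ γ).natAbs) ?_ ?_ γ
  · intro a b
    rw [hτ]
    exact Int.natAbs_add_le _ _
  · intro γ hγ
    have h1 : t (φ γ o) = (τ γ).natAbs := hfac.extend_apply 0 γ
    rw [← h1]
    exact (Finset.le_sup (f := t) (hX.mem_ball.mpr hγ)).trans (Nat.le_succ _)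

/-- In slow growth, the kernel of a height function is generated by elements of bounded length. -/
lemma exists_kernel_generators (hq : QuadSubseq X) {g₁ : Γ} (hg₁ : τ g₁ = 1) :
    ∃ B : ℕ, ∀ γ, τ γ = 0 → γ ∈ Subgroup.closure {γ | τ γ = 0 ∧ len X o (φ γ) ≤ B} := by
  obtain ⟨C, -, hC⟩ := hX.exists_natAbs_height_le φ o hD hτ horb
  have hl := hX.isLength_comp φ o
  have hτ1 : τ 1 = 0 := horb 1 (by rw [map_one]; rfl)
  have hτinv : ∀ a, τ a⁻¹ = -τ a := fun a => by
    have := hτ a a⁻¹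
    rw [mul_inv_cancel, hτ1] at this
    linarith
  let T : Γ →* Multiplicative ℤ :=
    { toFun := fun a => Multiplicative.ofAdd (τ a)
      map_one' := by rw [hτ1]; rfl
      map_mul' := fun a b => by rw [hτ]; rfl }
  have hτz : ∀ n : ℤ, τ (g₁ ^ n) = n := by
    intro n
    have := congrArg Multiplicative.toAdd (map_zpow T g₁ n)
    rw [toAdd_zpow] at this
    change τ (g₁ ^ n) = n • τ g₁ at this
    rw [this, hg₁, smul_eq_mul, mul_one]
  have hτconj : ∀ a b, τ (a * b * a⁻¹) = τ b := fun a b => by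
    rw [hτ, hτ, hτinv]; ring
  set B := 2 * D + 1 + C * (2 * D + 2) * len X o (φ g₁) with hB
  set Bs : Set Γ := {γ | τ γ = 0 ∧ len X o (φ γ) ≤ B} with hBs
  have hstab : ∀ γ, φ γ o = o → γ ∈ Bs := fun γ hγ =>
    ⟨horb γ hγ, by rw [len, hγ, SimpleGraph.dist_self]; exact Nat.zero_le _⟩
  obtain ⟨k₁, hk₁⟩ := hX.exists_conjClosure φ o hq g₁ (fun b (hb : b ∈ Bs) => hb.2) hstab
  obtain ⟨k₂, hk₂⟩ := hX.exists_conjClosure φ o hq g₁⁻¹ (fun b (hb : b ∈ Bs) => hb.2) hstab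
  set B' := B + 2 * ((k₁ + k₂) * len X o (φ g₁)) with hB'
  set M := Subgroup.closure {γ | τ γ = 0 ∧ len X o (φ γ) ≤ B'} with hM
  have hle : ∀ g k, len X o (φ g) = len X o (φ g₁) → k ≤ k₁ + k₂ → conjClosure g Bs k ≤ M := by
    intro g k hg hk
    refine Subgroup.closure_mono ?_
    rintro _ ⟨i, hi, b, hb, rfl⟩
    refine ⟨(hτconj _ _).trans hb.1, ?_⟩
    have h1 := hl.mul_le (g ^ i * b) (g ^ i)⁻¹
    have h2 := hl.mul_le (g ^ i) b
    have h3 := hl.inv (g ^ i)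
    have h4 := hl.pow_le g i
    have h5 := hb.2
    have h6 : i * len X o (φ g) ≤ (k₁ + k₂) * len X o (φ g₁) := by
      rw [hg]
      exact Nat.mul_le_mul_right _ (hi.trans hk)
    omega
  have hconjM : ∀ n : ℤ, ∀ b ∈ Bs, g₁ ^ n * b * (g₁ ^ n)⁻¹ ∈ M := by
    intro n b hb
    obtain ⟨m, rfl | rfl⟩ := n.eq_nat_or_neg
    · rw [zpow_natCast]
      exact hle g₁ k₁ rfl (Nat.le_add_right _ _) (hk₁ m b hb)
    · rw [zpow_neg, zpow_natCast, ← inv_pow]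
      exact hle g₁⁻¹ k₂ (hl.inv g₁) (Nat.le_add_left _ _) (hk₂ m b hb)
  set M' := Subgroup.closure {x | ∃ n : ℤ, ∃ b ∈ Bs, x = g₁ ^ n * b * (g₁ ^ n)⁻¹} with hM'
  have hM'M : M' ≤ M := by
    rw [hM', Subgroup.closure_le]
    rintro _ ⟨n, b, hb, rfl⟩
    exact hconjM n b hb
  have hnorm : ∀ (n : ℤ), ∀ x ∈ M', g₁ ^ n * x * (g₁ ^ n)⁻¹ ∈ M' := by
    intro n x hx
    change MulAut.conj (g₁ ^ n) x ∈ _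
    induction hx using Subgroup.closure_induction with
    | mem x hx =>
      obtain ⟨m, b, hb, rfl⟩ := hx
      refine Subgroup.subset_closure ⟨n + m, b, hb, ?_⟩
      rw [MulAut.conj_apply, zpow_add]
      group
    | one => rw [map_one]; exact one_mem _
    | mul x y _ _ ihx ihy => rw [map_mul]; exact mul_mem ihx ihy
    | inv x _ ih => rw [map_inv]; exact inv_mem ih
  have hstep : ∀ a y, len X o (φ a) ≤ 2 * D + 1 → y * (g₁ ^ τ y)⁻¹ ∈ M' →
      a * y * (g₁ ^ τ (a * y))⁻¹ ∈ M' := by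
    intro a y ha hy
    have h1 : a * y * (g₁ ^ τ (a * y))⁻¹ =
        a * (g₁ ^ τ a)⁻¹ * (g₁ ^ τ a * (y * (g₁ ^ τ y)⁻¹) * (g₁ ^ τ a)⁻¹) := by
      rw [hτ, zpow_add]; group
    rw [h1]
    refine mul_mem (Subgroup.subset_closure ⟨0, a * (g₁ ^ τ a)⁻¹, ⟨?_, ?_⟩, by simp⟩)
      (hnorm _ _ hy)
    · rw [hτ, hτinv, hτz, add_neg_cancel]
    · have h2 := hl.mul_le a (g₁ ^ τ a)⁻¹
      have h3 := hl.inv (g₁ ^ τ a)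
      have h4 := hl.zpow_le g₁ (τ a)
      have h5 : (τ a).natAbs * len X o (φ g₁) ≤ C * (2 * D + 2) * len X o (φ g₁) :=
        Nat.mul_le_mul_right _ ((hC a).trans (Nat.mul_le_mul_left _ (by omega)))
      omega
  refine ⟨B', fun γ hγ => hM'M ?_⟩
  have key : γ * (g₁ ^ τ γ)⁻¹ ∈ M' := by
    have hmem : γ ∈ Subgroup.closure {γ | len X o (φ γ) ≤ 2 * D + 1} := by
      rw [hX.closure_eq_top φ o hD]; exact Subgroup.mem_top γ
    clear hγ
    induction hmem using Subgroup.closure_induction_left with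
    | one => rw [hτ1, zpow_zero, inv_one, mul_one]; exact one_mem _
    | mul_left a ha y _ ih => exact hstep a y ha ih
    | inv_mul_cancel a ha y _ ih => exact hstep a⁻¹ y ((hl.inv a).le.trans ha) ih
  rwa [hγ, zpow_zero, inv_one, mul_one] at key

/-- Linear growth when the kernel of the height function has a finite orbit. -/
lemma quadGrowth_of_finite_kernel_orbit {g₁ : Γ} (hg₁ : τ g₁ = 1)
    (hfin : {x | ∃ ν, τ ν = 0 ∧ φ ν o = x}.Finite) : QuadGrowth X := by
  obtain ⟨C, -, hC⟩ := hX.exists_natAbs_height_le φ o hD hτ horb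
  have hτ1 : τ 1 = 0 := horb 1 (by rw [map_one]; rfl)
  let T : Γ →* Multiplicative ℤ :=
    { toFun := fun a => Multiplicative.ofAdd (τ a)
      map_one' := by rw [hτ1]; rfl
      map_mul' := fun a b => by rw [hτ]; rfl }
  have hτz : ∀ n : ℤ, τ (g₁ ^ n) = n := by
    intro n
    have := congrArg Multiplicative.toAdd (map_zpow T g₁ n)
    rw [toAdd_zpow] at this
    change τ (g₁ ^ n) = n • τ g₁ at this
    rw [this, hg₁, smul_eq_mul, mul_one]
  set Z := hfin.toFinset with hZ
  refine hX.quadGrowth_of_vol (C := (2 * C * (D + 2) + 1) * (#Z * vol X D)) fun n hn => ?_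
  set m : ℕ := C * (n + D + 1) with hm
  have hsub : ball X o n ⊆ (Finset.Icc (-m : ℤ) m).biUnion fun k =>
      Z.biUnion fun z => ball X (φ (g₁ ^ k) z) D := by
    intro x hx
    rw [hX.mem_ball] at hx
    obtain ⟨γ, hγ⟩ := hD x
    have h1 := hX.tri o x (φ γ o)
    have h2 : (τ γ).natAbs ≤ m := (hC γ).trans (Nat.mul_le_mul_left _ (by
      change X.dist o (φ γ o) + 1 ≤ _; omega))
    simp only [Finset.mem_biUnion, Finset.mem_Icc]
    refine ⟨τ γ, by omega, φ (g₁ ^ (-τ γ) * γ) o, ?_, ?_⟩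
    · rw [hZ, Set.Finite.mem_toFinset]
      exact ⟨_, by rw [hτ, hτz, neg_add_cancel], rfl⟩
    · rw [← RelIso.mul_apply, ← map_mul, zpow_neg, mul_inv_cancel_left, hX.mem_ball_comm,
        hX.mem_ball]
      exact hγ
  have hcard : vol X n ≤ (2 * m + 1) * (#Z * vol X D) := by
    rw [← hX.card_ball o n]
    refine (Finset.card_le_card hsub).trans (Finset.card_biUnion_le.trans ?_)
    refine (Finset.sum_le_card_nsmul _ _ (#Z * vol X D) fun k _ => ?_).trans ?_
    · refine Finset.card_biUnion_le.trans ?_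
      simp [hX.card_ball]
    · rw [smul_eq_mul, Int.card_Icc]
      exact Nat.mul_le_mul_right _ (by omega)
  refine hcard.trans ?_
  rw [mul_right_comm]
  refine Nat.mul_le_mul_right _ ?_
  rw [hm]
  nlinarith [Nat.zero_le (C * D), Nat.zero_le C, Nat.mul_le_mul_left (C * D) hn,
    Nat.mul_le_mul_left C hn, Nat.mul_le_mul hn hn, Nat.mul_le_mul_left (C * n) hn,
    Nat.mul_le_mul_left (C * n * D) hn]

/-- Quadratic growth when the kernel of the height function has an infinite orbit. -/
lemma quadGrowth_of_infinite_kernel_orbit (hq : QuadSubseq X) {g₁ : Γ} (hg₁ : τ g₁ = 1)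
    (hinf : {x | ∃ ν, τ ν = 0 ∧ φ ν o = x}.Infinite) : QuadGrowth X := by
  obtain ⟨C, hC1, hC⟩ := hX.exists_natAbs_height_le φ o hD hτ horb
  obtain ⟨B, hB⟩ := hX.exists_kernel_generators φ o hD hτ horb hq hg₁
  have hl := hX.isLength_comp φ o
  have hτ1 : τ 1 = 0 := horb 1 (by rw [map_one]; rfl)
  have hτinv : ∀ a, τ a⁻¹ = -τ a := fun a => by
    have := hτ a a⁻¹
    rw [mul_inv_cancel, hτ1] at this
    linarith
  have hτpow : ∀ n : ℕ, τ (g₁ ^ n) = n := by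
    intro n
    induction n with
    | zero => rw [pow_zero, hτ1]; rfl
    | succ n ih => rw [pow_succ, hτ, ih, hg₁]; push_cast; rfl
  have hker : ∀ t : ℕ, ∃ ν, τ ν = 0 ∧ t ≤ len X o (φ ν) ∧ len X o (φ ν) ≤ t + B := by
    intro t
    by_contra hno
    push Not at hno
    rcases Nat.eq_zero_or_pos t with rfl | ht
    · have := hno 1 hτ1 (Nat.zero_le _)
      rw [hl.one] at this
      omega
    have hlt : ∀ ν, τ ν = 0 → len X o (φ ν) < t := by
      intro ν hν
      have hmem := hB ν hν
      have hstep : ∀ y s, τ y = 0 → τ s = 0 → len X o (φ s) ≤ B → len X o (φ y) < t →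
          len X o (φ (s * y)) < t := by
        intro y s hy hs hsB hyt
        by_contra hge
        have h1 := hno (s * y) (by rw [hτ, hy, hs, add_zero]) (not_lt.mp hge)
        have h2 := hl.mul_le s y
        omega
      have key : τ ν = 0 ∧ len X o (φ ν) < t := by
        clear hν
        induction hmem using Subgroup.closure_induction_left with
        | one => exact ⟨hτ1, by rw [hl.one]; exact ht⟩
        | mul_left s hs y _ ih =>
          exact ⟨by rw [hτ, hs.1, ih.1, add_zero], hstep y s ih.1 hs.1 hs.2 ih.2⟩
        | inv_mul_cancel s hs y _ ih =>
          have h0 : τ s⁻¹ = 0 := by rw [hτinv, hs.1, neg_zero]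
          exact ⟨by rw [hτ, h0, ih.1, add_zero],
            hstep y s⁻¹ ih.1 h0 ((hl.inv s).le.trans hs.2) ih.2⟩
      exact key.2
    refine hinf ((ball X o t).finite_toSet.subset ?_)
    rintro _ ⟨ν, hν, rfl⟩
    exact hX.mem_ball.mpr (hlt ν hν).le
  choose ν hν0 hνge hνle using hker
  set ℓ := len X o (φ g₁) with hℓ
  set A := (3 * C + 1) * ℓ + 2 + 2 * B + 1 with hA
  have hpack : ∀ n q : ℕ, 1 ≤ n → q ^ 2 * vol X n ≤ vol X (q * (A * n) + n) := by
    intro n q hn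
    set m := C * (2 * n + 1) + 1 with hm
    set w := 2 * n + B + 1 with hw
    have h := hX.card_mul_vol_le (Finset.range q ×ˢ Finset.range q)
      (fun p => φ (g₁ ^ (p.1 * m) * ν (p.2 * w)) o) (n := n) (r := q * (A * n)) o ?_ ?_
    · rwa [Finset.card_product, Finset.card_range, ← sq] at h
    · rintro ⟨j, i⟩ hp
      obtain ⟨hj, hi⟩ := Finset.mem_product.mp hp
      rw [Finset.mem_range] at hj hi
      dsimp only at hj hi
      change len X o (φ (g₁ ^ (j * m) * ν (i * w))) ≤ _
      have h1 := hl.mul_le (g₁ ^ (j * m)) (ν (i * w))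
      have h2 : len X o (φ (g₁ ^ (j * m))) ≤ j * m * ℓ := hl.pow_le g₁ (j * m)
      have h3 := hνle (i * w)
      have h4 : j * m * ℓ ≤ q * (m * ℓ) := by
        rw [mul_assoc]; exact Nat.mul_le_mul_right _ hj.le
      have h5 : i * w + B ≤ q * (w + B) := by
        calc i * w + B ≤ (i + 1) * (w + B) := by nlinarith [Nat.zero_le (i * B), Nat.zero_le w]
          _ ≤ _ := Nat.mul_le_mul_right _ hi
      have h6 : m * ℓ + (w + B) ≤ A * n := by
        have e1 : m ≤ (3 * C + 1) * n := by
          rw [hm]; nlinarith [Nat.mul_le_mul_left C hn]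
        have e2 : w + B ≤ (2 + 2 * B + 1) * n := by
          rw [hw]; nlinarith [Nat.mul_le_mul_left B hn]
        calc m * ℓ + (w + B) ≤ (3 * C + 1) * n * ℓ + (2 + 2 * B + 1) * n :=
              add_le_add (Nat.mul_le_mul_right _ e1) e2
          _ = A * n := by rw [hA]; ring
      have h7 := Nat.mul_le_mul_left q h6
      rw [mul_add] at h7
      omega
    · rintro ⟨j, i⟩ hp ⟨j', i'⟩ hp' hne
      dsimp only
      rw [dist_orbit φ o]
      by_cases hjj : j = j'
      · subst hjj
        have hii : i ≠ i' := fun h => hne (by rw [h])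
        have h1 : (g₁ ^ (j * m) * ν (i * w))⁻¹ * (g₁ ^ (j * m) * ν (i' * w)) =
            (ν (i * w))⁻¹ * ν (i' * w) := by group
        rw [h1]
        have h2 := hl.mul_le (ν (i * w)) ((ν (i * w))⁻¹ * ν (i' * w))
        have h3 := hl.mul_le (ν (i' * w)) ((ν (i * w))⁻¹ * ν (i' * w))⁻¹
        rw [mul_inv_cancel_left] at h2
        rw [hl.inv, mul_inv_rev, inv_inv, mul_inv_cancel_left] at h3
        have e1 := hνge (i * w)
        have e2 := hνle (i * w)
        have e3 := hνge (i' * w)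
        have e4 := hνle (i' * w)
        rcases lt_or_gt_of_ne hii with h | h
        · have h5 := Nat.mul_le_mul_right w (Nat.succ_le_of_lt h)
          rw [Nat.succ_mul] at h5
          omega
        · have h5 := Nat.mul_le_mul_right w (Nat.succ_le_of_lt h)
          rw [Nat.succ_mul] at h5
          omega
      · by_contra hle
        push Not at hle
        have h1 := hC ((g₁ ^ (j * m) * ν (i * w))⁻¹ * (g₁ ^ (j' * m) * ν (i' * w)))
        have h2 : τ ((g₁ ^ (j * m) * ν (i * w))⁻¹ * (g₁ ^ (j' * m) * ν (i' * w))) =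
            ((j' : ℤ) - j) * m := by
          rw [hτ, hτinv, hτ, hτ, hν0, hν0, hτpow, hτpow]; push_cast; ring
        rw [h2, Int.natAbs_mul, Int.natAbs_natCast] at h1
        have h3 : 1 ≤ ((j' : ℤ) - j).natAbs := by omega
        have h4 := Nat.mul_le_mul_right m h3
        have h5 := h1.trans (Nat.mul_le_mul_left C (Nat.succ_le_succ hle))
        rw [Nat.succ_eq_add_one] at h5
        omega
  obtain ⟨C', hC', hio⟩ := hq
  obtain ⟨C₂, hC₂⟩ := exists_nat_ge (4 * C' * (A + 1) ^ 2)
  refine hX.quadGrowth_of_vol (C := C₂) fun n hn => ?_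
  obtain ⟨R, hR, hvol⟩ := hio ((A + 1) * n)
  have hAn : 0 < (A + 1) * n := by positivity
  set q := R / ((A + 1) * n) with hq'
  have hq1 : 1 ≤ q := (Nat.le_div_iff_mul_le hAn).mpr (by rwa [one_mul])
  have h1 : q * (A * n) + n ≤ R := by
    have := Nat.div_mul_le_self R ((A + 1) * n)
    rw [← hq'] at this
    nlinarith [Nat.mul_le_mul_right n hq1]
  have h2 : R ≤ 2 * q * ((A + 1) * n) := by
    have := Nat.lt_div_mul_add (a := R) hAn
    rw [← hq'] at this
    nlinarith [Nat.mul_le_mul_right ((A + 1) * n) hq1]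
  have h3 : ((q : ℝ) ^ 2) * vol X n ≤ C' * R ^ 2 := by
    refine le_trans ?_ hvol
    exact_mod_cast (hpack n q hn).trans (hX.vol_mono h1)
  have h4 : (R : ℝ) ^ 2 ≤ (2 * q * ((A + 1) * n)) ^ 2 := by
    exact_mod_cast Nat.pow_le_pow_left h2 2
  have hq0 : (0 : ℝ) < (q : ℝ) ^ 2 := by
    have : (1 : ℝ) ≤ q := by exact_mod_cast hq1
    positivity
  have h5 : (vol X n : ℝ) ≤ 4 * C' * (A + 1) ^ 2 * n ^ 2 := by
    refine le_of_mul_le_mul_left ?_ hq0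
    calc (q : ℝ) ^ 2 * vol X n ≤ C' * (2 * q * ((A + 1) * n)) ^ 2 :=
          h3.trans (mul_le_mul_of_nonneg_left h4 hC'.le)
      _ = _ := by ring
  have h6 : (vol X n : ℝ) ≤ C₂ * n ^ 2 :=
    h5.trans (mul_le_mul_of_nonneg_right hC₂ (sq_nonneg _))
  exact_mod_cast h6

end Homog
end TransGraph

namespace TransGraph
open scoped Classical
open Finset

variable {V : Type*} {X : SimpleGraph V}

/-- A nontrivial homomorphism to `ℂ` with finitely generated image refines to one onto `ℤ`. -/
lemma exists_integer_height {Γ : Type*} [Group Γ] {b : Γ → ℂ} (hb : ∀ x y, b (x * y) = b x + b y)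
    {S : Set Γ} (hS : Subgroup.closure S = ⊤) (hfin : (b '' S).Finite) (hne : ∃ g, b g ≠ 0) :
    ∃ τ : Γ → ℤ, (∀ x y, τ (x * y) = τ x + τ y) ∧ (∀ x, b x = 0 → τ x = 0) ∧ ∃ g, τ g = 1 := by
  have hb1 : b 1 = 0 := by simpa using hb 1 1
  have hbinv : ∀ x, b x⁻¹ = -b x := fun x => by
    have := hb x⁻¹ x
    rw [inv_mul_cancel, hb1] at this
    exact (neg_eq_of_add_eq_zero_left this.symm).symm
  let M : Submodule ℤ ℂ :=
    { carrier := Set.range b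
      zero_mem' := ⟨1, hb1⟩
      add_mem' := by
        rintro _ _ ⟨x, rfl⟩ ⟨y, rfl⟩
        exact ⟨x * y, hb x y⟩
      smul_mem' := by
        have hnat : ∀ (n : ℕ) x, b (x ^ n) = n * b x := by
          intro n x
          induction n with
          | zero => simp [hb1]
          | succ n ih => rw [pow_succ, hb, ih]; push_cast; ring
        rintro n _ ⟨x, rfl⟩
        refine ⟨x ^ n, ?_⟩
        obtain ⟨m, rfl | rfl⟩ := n.eq_nat_or_neg
        · rw [zpow_natCast, hnat]
          simp
        · rw [zpow_neg, zpow_natCast, hbinv, hnat]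
          simp }
  have hspan : Submodule.span ℤ (b '' S) = M := by
    refine le_antisymm (Submodule.span_le.mpr ?_) ?_
    · rintro _ ⟨s, -, rfl⟩
      exact ⟨s, rfl⟩
    · rintro _ ⟨x, rfl⟩
      have hx : x ∈ Subgroup.closure S := hS ▸ Subgroup.mem_top x
      induction hx using Subgroup.closure_induction with
      | mem s hs => exact Submodule.subset_span ⟨s, hs, rfl⟩
      | one => rw [hb1]; exact zero_mem _
      | mul x y _ _ hx hy => rw [hb]; exact add_mem hx hy
      | inv x _ hx => rw [hbinv]; exact neg_mem hx
  have : Module.Finite ℤ M :=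
    Module.Finite.iff_fg.mpr (hspan ▸ Submodule.fg_span hfin)
  have hnt : Nontrivial M := by
    obtain ⟨g, hg⟩ := hne
    exact ⟨⟨⟨b g, g, rfl⟩, 0, fun h => hg (congrArg Subtype.val h)⟩⟩
  let B := Module.Free.chooseBasis ℤ M
  obtain ⟨i⟩ := B.index_nonempty
  obtain ⟨g, hg⟩ := (B i).2
  refine ⟨fun x => B.coord i ⟨b x, x, rfl⟩, fun x y => ?_, fun x hx => ?_, g, ?_⟩
  · rw [← map_add]
    exact congrArg (B.coord i) (Subtype.ext (hb x y))
  · rw [← map_zero (B.coord i)]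
    exact congrArg (B.coord i) (Subtype.ext hx)
  · have : (⟨b g, g, rfl⟩ : M) = B i := Subtype.ext hg
    change B.coord i ⟨b g, g, rfl⟩ = 1
    rw [this, B.coord_apply, B.repr_self, Finsupp.single_eq_same]

namespace Homog
variable (hX : Homog X)
include hX

lemma quadGrowth (hq : QuadSubseq X) (ham : Amenable X) : QuadGrowth X := by
  obtain ⟨o⟩ := hX.conn.nonempty
  obtain ⟨H, u, hH, hu, hnc, htr⟩ := hX.exists_translated_harmonic hq ham o
  obtain ⟨S₀, hS₀⟩ := hH.exists_orbit_reps (o := o) hX.trans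
  have hD : ∀ x, ∃ γ : H, X.dist x (H.subtype γ o) ≤ S₀.sup (X.dist o) := by
    intro x
    obtain ⟨g, hg, y, hy, rfl⟩ := hS₀ x
    refine ⟨⟨g, hg⟩, ?_⟩
    change X.dist (g y) (g o) ≤ _
    rw [dist_map, X.dist_comm]
    exact Finset.le_sup (f := X.dist o) hy
  let b : H → ℂ := fun g => u ((g : X ≃g X) o) - u o
  have hb : ∀ x y, b (x * y) = b x + b y := by
    intro x y
    have := htr x x.2 ((y : X ≃g X) o) o
    change u ((x : X ≃g X) ((y : X ≃g X) o)) - u o = _ + (u ((y : X ≃g X) o) - u o)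
    rw [← this]
    ring
  have hne : ∃ g, b g ≠ 0 := by
    by_contra! h
    obtain ⟨x, y, hxy⟩ := hnc
    refine hxy (hX.eq_of_norm_invariant hu.1 hH (fun g hg z => ?_) x y)
    have h1 := htr g hg z o
    have h2 : u (g o) - u o = 0 := h ⟨g, hg⟩
    rw [sub_eq_zero.mp h2, sub_left_inj] at h1
    rw [h1]
  obtain ⟨-, S, L, rfl, hL⟩ := hH
  obtain ⟨τ, hτ, hker, g₁, hg₁⟩ := exists_integer_height hb
    (S := (Subtype.val : Subgroup.closure S → X ≃g X) ⁻¹' S) Subgroup.closure_closure_coe_preimage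
    (by
      refine ((ball X o L).finite_toSet.image fun z => u z - u o).subset ?_
      rintro _ ⟨g, hg, rfl⟩
      exact ⟨(g : X ≃g X) o, hX.mem_ball.mpr (hL g hg), rfl⟩) hne
  have horb : ∀ a, (Subgroup.closure S).subtype a o = o → τ a = 0 := fun a ha =>
    hker a (sub_eq_zero.mpr (congrArg u ha))
  by_cases hfin : {x | ∃ ν, τ ν = 0 ∧ (Subgroup.closure S).subtype ν o = x}.Finite
  · exact hX.quadGrowth_of_finite_kernel_orbit _ o hD hτ horb hg₁ hfin
  · exact hX.quadGrowth_of_infinite_kernel_orbit _ o hD hτ horb hq hg₁ hfin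

end Homog
end TransGraph

theorem statement_12 {V : Type*} (X : SimpleGraph V)
    (hinf : Infinite V) (hconn : X.Connected)
    (hlf : ∀ v : V, (X.neighborSet v).Finite)
    (htrans : ∀ u v : V, ∃ φ : X ≃g X, φ u = v)
    (K : ℝ) (hK : 0 < K) (A : ℕ → Set V)
    (hfin : ∀ n : ℕ, (A n).Finite) (hconnA : ∀ n : ℕ, ConnSet X (A n))
    (hbdry : ∀ M : ℕ, ∃ N : ℕ, ∀ n : ℕ, N ≤ n → M ≤ (vertexBoundary X (A n)).ncard)
    (hdepth : ∀ n : ℕ,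
      ((vertexBoundary X (A n)).ncard : ℝ) / K - K < gdepth X (A n)) :
    QuadGrowth X := by
  have hX : TransGraph.Homog X := ⟨hconn, hlf, htrans, hinf⟩
  have hdeep := hX.deep_of_gdepth K hK A hfin hbdry hdepth
  exact hX.quadGrowth (hX.quadSubseq_of_deep hdeep) (hX.amenable_of_deep hdeep)
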